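/- Let B ⊆ (0,1] be a Borel set whose topological boundary has Lebesgue measure zero. For all x ≤ y in ℝ and all integers k₁ ≥ k₃ ≥ 0 and k₂ ≥ k₄ ≥ 0, lim_{n→∞} P( Ñ_n^x(B) = k₁, N̂_n^x(B) = k₂, Ñ_n^y(B) = k₃, N̂_n^y(B) = k₄ ) = E ∫_{−∞}^{+∞} { (λ m(B) g(y,z))^{k₃}/k₃! · (λ m(B)(g(x,z) − g(y,z)))^{k₁−k₃}/(k₁−k₃)! · exp(−λ m(B) g(x,z)) · ((1−λ) m(B) g(y,z))^{k₄}/k₄! · ((1−λ) m(B)(g(x,z) − g(y,z)))^{k₂−k₄}/(k₂−k₄)! · exp(−(1−λ) m(B) g(x,z)) } dΦ(z). -/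

import Mathlib

open MeasureTheory ProbabilityTheory Filter Real
open scoped Classical NNReal ENNReal

/-- The normalizing levels `u_n(x) = x/a_n + b_n` with `a_n = (2 ln n)^{1/2}` and
`b_n = a_n - (ln ln n + ln (4π))/(2 a_n)`. -/
noncomputable def un (n : ℕ) (x : ℝ) : ℝ :=
  x / Real.sqrt (2 * Real.log n) +
    (Real.sqrt (2 * Real.log n) -
      (Real.log (Real.log n) + Real.log (4 * Real.pi)) / (2 * Real.sqrt (2 * Real.log n)))

/-- `g(x,z) = exp(-x - γ + √(2γ) z)`. -/
noncomputable def g (γ x z : ℝ) : ℝ := Real.exp (-x - γ + Real.sqrt (2 * γ) * z)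

theorem hasDerivAt_gaussianPDFReal_std (x : ℝ) :
    HasDerivAt (gaussianPDFReal 0 1) (-(x * gaussianPDFReal 0 1 x)) x := by
  have h : HasDerivAt (fun y : ℝ => (√(2 * π))⁻¹ * rexp (-y ^ 2 / 2))
      ((√(2 * π))⁻¹ * (rexp (-x ^ 2 / 2) * (-(2 * x) / 2))) x := by
    have h1 : HasDerivAt (fun y : ℝ => -y ^ 2 / 2) (-(2 * x) / 2) x := by
      simpa using ((hasDerivAt_pow 2 x).neg.div_const 2)
    exact (h1.exp).const_mul _
  have e : gaussianPDFReal 0 1 = fun y : ℝ => (√(2 * π))⁻¹ * rexp (-y ^ 2 / 2) := by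
    ext y; simp [gaussianPDFReal]
  rw [e]
  convert h using 1
  ring

theorem integral_mul_gaussian_eq_integral_deriv {f f' : ℝ → ℝ} {C : ℝ}
    (hf : ∀ x, HasDerivAt f (f' x) x) (hf' : Measurable f') (hC : ∀ x, |f x| ≤ C)
    (hC' : ∀ x, |f' x| ≤ C) :
    ∫ x, x * f x ∂(gaussianReal 0 1) = ∫ x, f' x ∂(gaussianReal 0 1) := by
  rw [integral_gaussianReal_eq_integral_smul one_ne_zero,
    integral_gaussianReal_eq_integral_smul one_ne_zero]
  have hfc : Measurable f :=
    (continuous_iff_continuousAt.2 fun x => (hf x).continuousAt).measurable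
  have hp := integrable_gaussianPDFReal 0 1
  have hxp : Integrable (fun x => x * gaussianPDFReal 0 1 x) := by
    have h := (integrable_withDensity_iff_integrable_smul' (μ := volume)
      (f := gaussianPDF 0 1) (by fun_prop) (by simp [gaussianPDF]) (g := (id : ℝ → ℝ))).1 (by
        have := (memLp_id_gaussianReal (μ := 0) (v := 1) 1).integrable (by simp)
        rwa [gaussianReal_of_var_ne_zero _ one_ne_zero] at this)
    refine h.congr (ae_of_all _ fun x => ?_)
    simp [mul_comm]
  have h := integral_mul_deriv_eq_deriv_mul_of_integrable (u := f) (u' := f')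
    (v := fun x => -gaussianPDFReal 0 1 x) (v' := fun x => x * gaussianPDFReal 0 1 x)
    (fun x _ => hf x) (fun x _ => by simpa using (hasDerivAt_gaussianPDFReal_std x).fun_neg)
    (hxp.bdd_mul hfc.aestronglyMeasurable (ae_of_all _ hC))
    (hp.neg.bdd_mul hf'.aestronglyMeasurable (ae_of_all _ hC'))
    (hp.neg.bdd_mul hfc.aestronglyMeasurable (ae_of_all _ hC))
  calc _ = ∫ x, f x * (x * gaussianPDFReal 0 1 x) := by
        congr with x; simp; ring
    _ = _ := h
    _ = _ := by
        rw [← integral_neg]; congr with x; simp; ring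

section

variable {Ω : Type*} [MeasurableSpace Ω] {P : Measure Ω} {ι : Type*} [Fintype ι]

theorem abs_prod_le_one {κ : Type*} (s : Finset κ) (f : κ → ℝ) (hf : ∀ i, |f i| ≤ 1) :
    |∏ i ∈ s, f i| ≤ 1 := by
  rw [Finset.abs_prod]
  exact Finset.prod_le_one (fun _ _ => abs_nonneg _) fun i _ => hf i

theorem abs_integral_mul_prod_le_of_hasGaussianLaw [IsProbabilityMeasure P]
    {U : Ω → ℝ} {V : ι → Ω → ℝ} (hUm : Measurable U) (hVm : ∀ i, Measurable (V i))
    (hG : HasGaussianLaw (fun ω => (U ω, fun i => V i ω)) P)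
    (hU : P.map U = gaussianReal 0 1)
    {φ φ' : ι → ℝ → ℝ} {C : ℝ} (hφ : ∀ i x, HasDerivAt (φ i) (φ' i x) x)
    (hφ'm : ∀ i, Measurable (φ' i)) (hφ1 : ∀ i x, |φ i x| ≤ 1) (hφC : ∀ i x, |φ' i x| ≤ C)
    (i : ι) (hi : cov[U, V i; P] = 0) :
    |∫ ω, U ω * (φ' i (V i ω) * ∏ k ∈ Finset.univ.erase i, φ k (V k ω)) ∂P| ≤
      ∑ k ∈ Finset.univ.erase i, |cov[U, V k; P]| *
        ∫ ω, |φ' i (V i ω)| * |φ' k (V k ω)| ∂P := by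
  set c : ι → ℝ := fun k => cov[U, V k; P] with hc
  set W : ι → Ω → ℝ := fun k ω => V k ω - c k * U ω with hW
  have hC0 : 0 ≤ C := (abs_nonneg _).trans (hφC i 0)
  have hWm : ∀ k, Measurable (W k) := fun k => (hVm k).sub (hUm.const_mul _)
  have hWm' : Measurable (fun ω k => W k ω) := measurable_pi_lambda _ hWm
  have hφm : ∀ k, Measurable (φ k) := fun k =>
    (continuous_iff_continuousAt.2 fun x => (hφ k x).continuousAt).measurable
  have hU2 : MemLp U 2 P := hG.fst.memLp_two
  have hV2 : ∀ k, MemLp (V k) 2 P := fun k => (hG.snd.eval k).memLp_two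
  have hvar : cov[U, U; P] = 1 := by
    rw [covariance_self hUm.aemeasurable, ← variance_id_map hUm.aemeasurable, hU]
    simp
  have hind : IndepFun U (fun ω k => W k ω) P := by
    have h1 : HasGaussianLaw (fun ω => ((fun _ : Unit => U ω), fun k => W k ω)) P := by
      have := hG.map (((ContinuousLinearMap.pi fun _ : Unit =>
          ContinuousLinearMap.fst ℝ ℝ (ι → ℝ))).prod
        (ContinuousLinearMap.pi fun k : ι =>
          ((ContinuousLinearMap.proj k).comp (ContinuousLinearMap.snd ℝ ℝ (ι → ℝ))
            - c k • ContinuousLinearMap.fst ℝ ℝ (ι → ℝ))))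
      refine this.congr (ae_of_all _ fun ω => ?_)
      simp [hW]
    have h2 := h1.indepFun_of_covariance_eval (fun _ k => by
      simp only [hW]
      rw [covariance_fun_sub_right hU2 (hV2 k) (hU2.const_mul _), covariance_const_mul_right,
        hvar]
      simp [hc])
    exact h2.comp (φ := fun f : Unit → ℝ => f ()) (ψ := id) (measurable_pi_apply _) measurable_id
  set ν := P.map (fun ω k => W k ω) with hν
  have : IsProbabilityMeasure ν := Measure.isProbabilityMeasure_map hWm'.aemeasurable
  have hlaw : P.map (fun ω => (U ω, fun k => W k ω)) = (gaussianReal 0 1).prod ν := by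
    rw [← hU]
    exact (indepFun_iff_map_prod_eq_prod_map_map hUm.aemeasurable hWm'.aemeasurable).1 hind
  have htrans : ∀ H : ℝ × (ι → ℝ) → ℝ, Measurable H →
      Integrable H ((gaussianReal 0 1).prod ν) →
      ∫ ω, H (U ω, fun k => W k ω) ∂P = ∫ w, ∫ u, H (u, w) ∂(gaussianReal 0 1) ∂ν := by
    intro H hH hI
    rw [← integral_prod_symm _ hI, ← hlaw,
      integral_map (hUm.prodMk hWm').aemeasurable hH.aestronglyMeasurable]
  have hVW : ∀ k ω, V k ω = W k ω + c k * U ω := fun k ω => by simp [hW]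
  have hci : c i = 0 := hi
  have hid : Integrable (fun p : ℝ × (ι → ℝ) => p.1) ((gaussianReal 0 1).prod ν) := by
    have := (memLp_id_gaussianReal (μ := 0) (v := 1) 1).integrable (by simp)
    exact this.comp_fst ν
  have hL : ∫ ω, U ω * (φ' i (V i ω) * ∏ k ∈ Finset.univ.erase i, φ k (V k ω)) ∂P =
      ∫ w, ∫ u, u * (φ' i (w i) * ∏ k ∈ Finset.univ.erase i, φ k (w k + c k * u))
        ∂(gaussianReal 0 1) ∂ν := by
    rw [← htrans (fun p => p.1 *
      (φ' i (p.2 i) * ∏ k ∈ Finset.univ.erase i, φ k (p.2 k + c k * p.1))) (by fun_prop)]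
    · congr with ω
      simp [hVW, hci]
    · refine hid.mul_bdd (c := C) (by fun_prop) (ae_of_all _ fun p => ?_)
      rw [Real.norm_eq_abs, abs_mul]
      calc _ ≤ C * 1 := by
            gcongr
            · exact hφC _ _
            · exact abs_prod_le_one _ _ fun k => hφ1 _ _
        _ = C := mul_one C
  have hdm : ∀ w : ι → ℝ, Measurable (fun u : ℝ => φ' i (w i) *
      ∑ k ∈ Finset.univ.erase i, (∏ l ∈ (Finset.univ.erase i).erase k, φ l (w l + c l * u)) •
        (φ' k (w k + c k * u) * c k)) := fun w => by
    simp only [smul_eq_mul]; fun_prop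
  have hstein : ∀ w : ι → ℝ,
      ∫ u, u * (φ' i (w i) * ∏ k ∈ Finset.univ.erase i, φ k (w k + c k * u))
        ∂(gaussianReal 0 1) =
      ∫ u, φ' i (w i) * ∑ k ∈ Finset.univ.erase i,
        (∏ l ∈ (Finset.univ.erase i).erase k, φ l (w l + c l * u)) •
          (φ' k (w k + c k * u) * c k) ∂(gaussianReal 0 1) := by
    intro w
    refine integral_mul_gaussian_eq_integral_deriv
      (C := C * 1 + C * ∑ k ∈ Finset.univ.erase i, 1 * (C * |c k|)) (fun u => ?_) (hdm w)
      (fun u => ?_) (fun u => ?_)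
    · refine HasDerivAt.const_mul _ ?_
      refine HasDerivAt.fun_finsetProd fun k _ => ?_
      have h1 : HasDerivAt (fun u : ℝ => w k + c k * u) (c k) u := by
        simpa using ((hasDerivAt_id u).const_mul (c k)).const_add (w k)
      exact (hφ k _).comp u h1
    · rw [abs_mul]
      have h2 : 0 ≤ C * ∑ k ∈ Finset.univ.erase i, 1 * (C * |c k|) := by positivity
      have h3 : |φ' i (w i)| * |∏ k ∈ Finset.univ.erase i, φ k (w k + c k * u)| ≤ C * 1 := by
        gcongr
        · exact hφC _ _
        · exact abs_prod_le_one _ _ fun k => hφ1 _ _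
      linarith
    · rw [abs_mul]
      have h3 : |φ' i (w i)| * |∑ k ∈ Finset.univ.erase i,
        (∏ l ∈ (Finset.univ.erase i).erase k, φ l (w l + c l * u)) •
          (φ' k (w k + c k * u) * c k)| ≤
          C * ∑ k ∈ Finset.univ.erase i, 1 * (C * |c k|) := by
        gcongr
        · exact hφC _ _
        · refine (Finset.abs_sum_le_sum_abs _ _).trans (Finset.sum_le_sum fun k _ => ?_)
          rw [smul_eq_mul, abs_mul, abs_mul]
          gcongr
          · exact abs_prod_le_one _ _ fun k => hφ1 _ _
          · exact hφC _ _
      linarith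
  have hbd : ∀ (k : ι), Integrable (fun p : ℝ × (ι → ℝ) =>
      |φ' i (p.2 i)| * |φ' k (p.2 k + c k * p.1)|) ((gaussianReal 0 1).prod ν) := by
    intro k
    refine Integrable.of_bound (C := C * C) (by fun_prop) (ae_of_all _ fun p => ?_)
    rw [Real.norm_eq_abs, abs_mul, abs_abs, abs_abs]
    gcongr
    · exact hφC _ _
    · exact hφC _ _
  have hR : ∀ k, ∫ ω, |φ' i (V i ω)| * |φ' k (V k ω)| ∂P =
      ∫ w, ∫ u, |φ' i (w i)| * |φ' k (w k + c k * u)| ∂(gaussianReal 0 1) ∂ν := by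
    intro k
    rw [← htrans (fun p => |φ' i (p.2 i)| * |φ' k (p.2 k + c k * p.1)|) (by fun_prop) (hbd k)]
    congr with ω
    simp [hVW, hci]
  rw [hL]
  simp_rw [hstein, hR]
  have hsum : ∑ k ∈ Finset.univ.erase i, |c k| *
      ∫ w, ∫ u, |φ' i (w i)| * |φ' k (w k + c k * u)| ∂(gaussianReal 0 1) ∂ν =
      ∫ w, ∫ u, ∑ k ∈ Finset.univ.erase i, |c k| * (|φ' i (w i)| * |φ' k (w k + c k * u)|)
        ∂(gaussianReal 0 1) ∂ν := by
    rw [← integral_prod_symm (fun p : ℝ × (ι → ℝ) => ∑ k ∈ Finset.univ.erase i, |c k| *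
      (|φ' i (p.2 i)| * |φ' k (p.2 k + c k * p.1)|))
      (integrable_finsetSum _ fun k _ => (hbd k).const_mul _)]
    rw [integral_finsetSum _ fun k _ => (hbd k).const_mul _]
    refine Finset.sum_congr rfl fun k _ => ?_
    rw [integral_const_mul, integral_prod_symm _ (hbd k)]
  change _ ≤ ∑ k ∈ Finset.univ.erase i, |c k| *
      ∫ w, ∫ u, |φ' i (w i)| * |φ' k (w k + c k * u)| ∂(gaussianReal 0 1) ∂ν
  rw [hsum]
  have hbi : Integrable (fun p : ℝ × (ι → ℝ) => ∑ k ∈ Finset.univ.erase i, |c k| *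
      (|φ' i (p.2 i)| * |φ' k (p.2 k + c k * p.1)|)) ((gaussianReal 0 1).prod ν) :=
    integrable_finsetSum _ fun k _ => (hbd k).const_mul _
  rw [← integral_prod_symm _ hbi]
  have hpt : ∀ p : ℝ × (ι → ℝ), |φ' i (p.2 i) * ∑ k ∈ Finset.univ.erase i,
        (∏ l ∈ (Finset.univ.erase i).erase k, φ l (p.2 l + c l * p.1)) •
          (φ' k (p.2 k + c k * p.1) * c k)| ≤ ∑ k ∈ Finset.univ.erase i, |c k| *
      (|φ' i (p.2 i)| * |φ' k (p.2 k + c k * p.1)|) := by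
    intro p
    rw [abs_mul]
    calc _ ≤ |φ' i (p.2 i)| * ∑ k ∈ Finset.univ.erase i,
        |(∏ l ∈ (Finset.univ.erase i).erase k, φ l (p.2 l + c l * p.1)) •
          (φ' k (p.2 k + c k * p.1) * c k)| := by
          gcongr; exact Finset.abs_sum_le_sum_abs _ _
      _ ≤ _ := by
        rw [Finset.mul_sum]
        refine Finset.sum_le_sum fun k _ => ?_
        rw [smul_eq_mul, abs_mul, abs_mul]
        have h1 := abs_prod_le_one ((Finset.univ.erase i).erase k)
          (fun l => φ l (p.2 l + c l * p.1)) fun l => hφ1 _ _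
        calc |φ' i (p.2 i)| * (|∏ l ∈ (Finset.univ.erase i).erase k, φ l (p.2 l + c l * p.1)| *
              (|φ' k (p.2 k + c k * p.1)| * |c k|))
            ≤ |φ' i (p.2 i)| * (1 * (|φ' k (p.2 k + c k * p.1)| * |c k|)) := by gcongr
          _ = _ := by ring
  have hfi : Integrable (fun p : ℝ × (ι → ℝ) => φ' i (p.2 i) * ∑ k ∈ Finset.univ.erase i,
        (∏ l ∈ (Finset.univ.erase i).erase k, φ l (p.2 l + c l * p.1)) •
          (φ' k (p.2 k + c k * p.1) * c k)) ((gaussianReal 0 1).prod ν) :=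
    hbi.mono' (by simp only [smul_eq_mul]; fun_prop) (ae_of_all _ hpt)
  rw [← integral_prod_symm _ hfi]
  rw [← Real.norm_eq_abs]
  refine norm_integral_le_of_norm_le hbi (ae_of_all _ fun p => ?_)
  rw [Real.norm_eq_abs]
  exact hpt p

end

section

variable {Ω : Type*} [MeasurableSpace Ω] {P : Measure Ω} {ι : Type*} [Fintype ι]

theorem integral_eq_zero_of_map_eq_gaussianReal {X : Ω → ℝ} {v : ℝ≥0} (hX : Measurable X)
    (h : P.map X = gaussianReal 0 v) : ∫ ω, X ω ∂P = 0 := by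
  have := integral_map (μ := P) hX.aemeasurable (f := fun x : ℝ => x)
    measurable_id.aestronglyMeasurable
  rw [← this, h, integral_id_gaussianReal]

theorem covariance_self_of_map_eq_gaussianReal {X : Ω → ℝ} {v : ℝ≥0} (hX : Measurable X)
    (h : P.map X = gaussianReal 0 v) : cov[X, X; P] = v := by
  rw [covariance_self hX.aemeasurable, ← variance_id_map hX.aemeasurable, h]
  simp

theorem covariance_fun_add_right_of_memLp [IsFiniteMeasure P] {X Y Z : Ω → ℝ} (hX : MemLp X 2 P)
    (hY : MemLp Y 2 P) (hZ : MemLp Z 2 P) :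
    cov[X, fun ω => Y ω + Z ω; P] = cov[X, Y; P] + cov[X, Z; P] :=
  covariance_add_right hX hY hZ

theorem abs_integral_prod_sub_integral_prod_le [IsProbabilityMeasure P]
    {X Y : ι → Ω → ℝ} (hXm : ∀ i, Measurable (X i)) (hYm : ∀ i, Measurable (Y i))
    (hG : HasGaussianLaw (fun ω => (fun i => X i ω, fun i => Y i ω)) P)
    (hX : ∀ i, P.map (X i) = gaussianReal 0 1) (hY : ∀ i, P.map (Y i) = gaussianReal 0 1)
    (hXY : ∀ i j, cov[X i, Y j; P] = 0)
    {φ φ' : ι → ℝ → ℝ} {C : ℝ} (hφ : ∀ i x, HasDerivAt (φ i) (φ' i x) x)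
    (hφ'm : ∀ i, Measurable (φ' i)) (hφ1 : ∀ i x, |φ i x| ≤ 1) (hφC : ∀ i x, |φ' i x| ≤ C)
    (D : ι → ι → ℝ)
    (hD : ∀ θ : ℝ, ∀ i j, i ≠ j →
      ∫ ω, |φ' i (sin θ * X i ω + cos θ * Y i ω)| * |φ' j (sin θ * X j ω + cos θ * Y j ω)| ∂P
        ≤ D i j) :
    |∫ ω, ∏ i, φ i (X i ω) ∂P - ∫ ω, ∏ i, φ i (Y i ω) ∂P| ≤
      (∑ i, ∑ j, |cov[X i, X j; P] - cov[Y i, Y j; P]| * D i j) * (π / 2) := by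
  have hC0 : ∀ i : ι, 0 ≤ C := fun i => (abs_nonneg _).trans (hφC i 0)
  have hφm : ∀ k, Measurable (φ k) := fun k =>
    (continuous_iff_continuousAt.2 fun x => (hφ k x).continuousAt).measurable
  have hX2 : ∀ k, MemLp (X k) 2 P := fun k => (hG.fst.eval k).memLp_two
  have hY2 : ∀ k, MemLp (Y k) 2 P := fun k => (hG.snd.eval k).memLp_two
  have hX1 : ∀ k, Integrable (X k) P := fun k => (hX2 k).integrable one_le_two
  have hY1 : ∀ k, Integrable (Y k) P := fun k => (hY2 k).integrable one_le_two
  set V : ℝ → ι → Ω → ℝ := fun θ i ω => sin θ * X i ω + cos θ * Y i ω with hV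
  set U : ℝ → ι → Ω → ℝ := fun θ i ω => cos θ * X i ω - sin θ * Y i ω with hU
  have hVm : ∀ θ i, Measurable (V θ i) := fun θ i =>
    ((hXm i).const_mul _).add ((hYm i).const_mul _)
  have hUm : ∀ θ i, Measurable (U θ i) := fun θ i =>
    ((hXm i).const_mul _).sub ((hYm i).const_mul _)
  set F' : ℝ → Ω → ℝ := fun θ ω => ∑ i, (∏ j ∈ Finset.univ.erase i, φ j (V θ j ω)) •
    (φ' i (V θ i ω) * U θ i ω) with hF'
  have hterm : ∀ θ i ω, ‖(∏ j ∈ Finset.univ.erase i, φ j (V θ j ω)) •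
      (φ' i (V θ i ω) * U θ i ω)‖ ≤ C * (|X i ω| + |Y i ω|) := by
    intro θ i ω
    rw [smul_eq_mul, Real.norm_eq_abs, abs_mul, abs_mul]
    have h1 := abs_prod_le_one (Finset.univ.erase i) (fun l => φ l (V θ l ω)) fun l => hφ1 _ _
    have h2 : |U θ i ω| ≤ |X i ω| + |Y i ω| := by
      refine (abs_sub _ _).trans ?_
      rw [abs_mul, abs_mul]
      have := abs_cos_le_one θ
      have := abs_sin_le_one θ
      nlinarith [abs_nonneg (X i ω), abs_nonneg (Y i ω)]
    calc _ ≤ 1 * (C * (|X i ω| + |Y i ω|)) := by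
          gcongr
          · exact hC0 i
          · exact hφC _ _
      _ = _ := one_mul _
  have hbi : ∀ i, Integrable (fun ω => C * (|X i ω| + |Y i ω|)) P := fun i =>
    ((hX1 i).abs.add (hY1 i).abs).const_mul C
  have hderiv : ∀ θ, HasDerivAt (fun θ => ∫ ω, ∏ i, φ i (V θ i ω) ∂P) (∫ ω, F' θ ω ∂P) θ := by
    intro θ
    refine (hasDerivAt_integral_of_dominated_loc_of_deriv_le (s := Set.univ)
      (F := fun θ ω => ∏ i, φ i (V θ i ω)) (F' := F')
      (bound := fun ω => ∑ i, C * (|X i ω| + |Y i ω|)) univ_mem ?_ ?_ ?_ ?_ ?_ ?_).2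
    · exact Eventually.of_forall fun θ => Measurable.aestronglyMeasurable (by fun_prop)
    · exact Integrable.of_bound (C := 1) (Measurable.aestronglyMeasurable (by fun_prop))
        (ae_of_all _ fun ω => abs_prod_le_one _ _ fun i => hφ1 _ _)
    · exact Measurable.aestronglyMeasurable (by simp only [hF', smul_eq_mul]; fun_prop)
    · exact ae_of_all _ fun ω θ _ =>
        (norm_sum_le _ _).trans (Finset.sum_le_sum fun i _ => hterm θ i ω)
    · exact integrable_finsetSum _ fun i _ => hbi i
    · refine ae_of_all _ fun ω θ _ => ?_
      refine HasDerivAt.fun_finsetProd fun i _ => ?_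
      have h1 : HasDerivAt (fun θ => V θ i ω) (U θ i ω) θ := by
        have := ((hasDerivAt_sin θ).mul_const (X i ω)).add ((hasDerivAt_cos θ).mul_const (Y i ω))
        refine this.congr_deriv ?_
        simp only [hU]; ring
      exact (hφ i _).comp θ h1
  have hcov : ∀ θ i j, cov[U θ i, V θ j; P] =
      cos θ * sin θ * (cov[X i, X j; P] - cov[Y i, Y j; P]) := by
    intro θ i j
    simp only [hU, hV]
    rw [covariance_fun_sub_left ((hX2 i).const_mul _) ((hY2 i).const_mul _)
        (show MemLp (fun ω => sin θ * X j ω + cos θ * Y j ω) 2 P from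
          ((hX2 j).const_mul _).add ((hY2 j).const_mul _)),
      covariance_fun_add_right_of_memLp ((hX2 i).const_mul _) ((hX2 j).const_mul _)
        ((hY2 j).const_mul _),
      covariance_fun_add_right_of_memLp ((hY2 i).const_mul _) ((hX2 j).const_mul _)
        ((hY2 j).const_mul _)]
    simp only [covariance_const_mul_left, covariance_const_mul_right, hXY,
      covariance_comm (Y i) (X j)]
    ring
  have hdiag : ∀ i, cov[X i, X i; P] - cov[Y i, Y i; P] = 0 := fun i => by
    rw [covariance_self_of_map_eq_gaussianReal (hXm i) (hX i),
      covariance_self_of_map_eq_gaussianReal (hYm i) (hY i), sub_self]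
  have hUlaw : ∀ θ i, P.map (U θ i) = gaussianReal 0 1 := by
    intro θ i
    have hg : HasGaussianLaw (U θ i) P := by
      have := hG.map (cos θ • ((ContinuousLinearMap.proj i).comp
        (ContinuousLinearMap.fst ℝ (ι → ℝ) (ι → ℝ))) - sin θ • ((ContinuousLinearMap.proj i).comp
        (ContinuousLinearMap.snd ℝ (ι → ℝ) (ι → ℝ))))
      exact this.congr (ae_of_all _ fun ω => by simp [hU])
    have hm : ∫ ω, U θ i ω ∂P = 0 := by
      simp only [hU]
      rw [integral_sub ((hX1 i).const_mul _) ((hY1 i).const_mul _), integral_const_mul,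
        integral_const_mul, integral_eq_zero_of_map_eq_gaussianReal (hXm i) (hX i),
        integral_eq_zero_of_map_eq_gaussianReal (hYm i) (hY i)]
      simp
    have hv : Var[U θ i; P] = 1 := by
      rw [← covariance_self (hUm θ i).aemeasurable]
      simp only [hU]
      rw [covariance_fun_sub_left ((hX2 i).const_mul _) ((hY2 i).const_mul _)
        (show MemLp (fun ω => cos θ * X i ω - sin θ * Y i ω) 2 P from
          ((hX2 i).const_mul _).sub ((hY2 i).const_mul _)),
      covariance_fun_sub_right ((hX2 i).const_mul _) ((hX2 i).const_mul _) ((hY2 i).const_mul _),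
      covariance_fun_sub_right ((hY2 i).const_mul _) ((hX2 i).const_mul _) ((hY2 i).const_mul _)]
      simp only [covariance_const_mul_left, covariance_const_mul_right, hXY,
        covariance_comm (Y i) (X i), covariance_self_of_map_eq_gaussianReal (hXm i) (hX i),
        covariance_self_of_map_eq_gaussianReal (hYm i) (hY i)]
      have := sin_sq_add_cos_sq θ
      push_cast
      linear_combination this
    rw [hg.map_eq_gaussianReal, hm, hv]
    simp
  have hGUV : ∀ θ i, HasGaussianLaw (fun ω => (U θ i ω, fun j => V θ j ω)) P := by
    intro θ i
    have := hG.map ((cos θ • ((ContinuousLinearMap.proj i).comp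
        (ContinuousLinearMap.fst ℝ (ι → ℝ) (ι → ℝ))) - sin θ • ((ContinuousLinearMap.proj i).comp
        (ContinuousLinearMap.snd ℝ (ι → ℝ) (ι → ℝ)))).prod
        (ContinuousLinearMap.pi fun j => sin θ • ((ContinuousLinearMap.proj j).comp
        (ContinuousLinearMap.fst ℝ (ι → ℝ) (ι → ℝ))) + cos θ • ((ContinuousLinearMap.proj j).comp
        (ContinuousLinearMap.snd ℝ (ι → ℝ) (ι → ℝ)))))
    exact this.congr (ae_of_all _ fun ω => by simp [hU, hV])
  have hbound : ∀ θ, ‖∫ ω, F' θ ω ∂P‖ ≤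
      ∑ i, ∑ j, |cov[X i, X j; P] - cov[Y i, Y j; P]| * D i j := by
    intro θ
    have hInt : ∀ i, Integrable (fun ω => (∏ j ∈ Finset.univ.erase i, φ j (V θ j ω)) •
      (φ' i (V θ i ω) * U θ i ω)) P := fun i =>
      (hbi i).mono' (Measurable.aestronglyMeasurable (by simp only [smul_eq_mul]; fun_prop))
        (ae_of_all _ fun ω => hterm θ i ω)
    simp only [hF']
    rw [integral_finsetSum _ fun i _ => hInt i]
    refine (norm_sum_le _ _).trans (Finset.sum_le_sum fun i _ => ?_)
    have h1 := abs_integral_mul_prod_le_of_hasGaussianLaw (hUm θ i) (hVm θ) (hGUV θ i)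
      (hUlaw θ i) hφ hφ'm hφ1 hφC i (by rw [hcov, hdiag, mul_zero])
    have h2 : ∫ ω, (∏ j ∈ Finset.univ.erase i, φ j (V θ j ω)) • (φ' i (V θ i ω) * U θ i ω) ∂P =
        ∫ ω, U θ i ω * (φ' i (V θ i ω) * ∏ k ∈ Finset.univ.erase i, φ k (V θ k ω)) ∂P := by
      congr with ω
      rw [smul_eq_mul]; ring
    rw [h2, Real.norm_eq_abs]
    refine h1.trans ?_
    rw [← Finset.add_sum_erase _ _ (Finset.mem_univ i), hdiag, abs_zero, zero_mul, zero_add]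
    refine Finset.sum_le_sum fun j hj => ?_
    have hij : i ≠ j := (Finset.ne_of_mem_erase hj).symm
    have h3 : |cov[U θ i, V θ j; P]| ≤ |cov[X i, X j; P] - cov[Y i, Y j; P]| := by
      rw [hcov, abs_mul, abs_mul]
      have h4 : |cos θ| * |sin θ| ≤ 1 := mul_le_one₀ (abs_cos_le_one θ) (abs_nonneg _)
        (abs_sin_le_one θ)
      exact mul_le_of_le_one_left (abs_nonneg _) h4
    exact mul_le_mul h3 (hD θ i j hij) (by positivity) (abs_nonneg _)
  have := norm_image_sub_le_of_norm_deriv_le_segment' (a := 0) (b := π / 2)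
    (fun θ _ => (hderiv θ).hasDerivWithinAt) (fun θ _ => hbound θ) (π / 2)
    ⟨by positivity, le_rfl⟩
  simpa [hV] using this

end

/-- An upper bound, at correlation `w`, for the bivariate Gaussian density beyond the level `u`. -/
noncomputable def bivariateBound (w u : ℝ) : ℝ :=
  (2 * π)⁻¹ * (√(1 - w ^ 2))⁻¹ * rexp (-u ^ 2 / (1 + w))

theorem bivariateBound_nonneg (w u : ℝ) : 0 ≤ bivariateBound w u := by
  unfold bivariateBound; positivity

theorem gaussianPDFReal_mul_le {r w u a b : ℝ} (hrw : |r| ≤ w) (hw : w < 1) (hu : 0 ≤ u)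
    (ha : u ≤ a) (hb : u ≤ b) {v : ℝ≥0} (hv : (v : ℝ) = 1 - r ^ 2) :
    gaussianPDFReal 0 1 a * gaussianPDFReal (r * a) v b ≤ bivariateBound w u := by
  have hw0 : 0 ≤ w := (abs_nonneg r).trans hrw
  have hr2 : r ^ 2 ≤ w ^ 2 := by
    rw [← sq_abs r]; exact pow_le_pow_left₀ (abs_nonneg r) hrw 2
  have hw2 : 0 < 1 - w ^ 2 := by nlinarith
  have hs : 0 < 1 - r ^ 2 := by linarith
  have e : gaussianPDFReal 0 1 a * gaussianPDFReal (r * a) v b =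
      (2 * π)⁻¹ * (√(1 - r ^ 2))⁻¹ *
        rexp (-(a ^ 2 / 2 + (b - r * a) ^ 2 / (2 * (1 - r ^ 2)))) := by
    simp only [gaussianPDFReal, hv, NNReal.coe_one, mul_one, sub_zero]
    rw [Real.sqrt_mul (by positivity) (1 - r ^ 2), mul_inv, neg_add, Real.exp_add]
    have h2 : (2 * π)⁻¹ = (√(2 * π))⁻¹ * (√(2 * π))⁻¹ := by
      rw [← mul_inv, Real.mul_self_sqrt (by positivity)]
    rw [h2, neg_div, neg_div]
    ring
  rw [e, bivariateBound]
  have hexp : u ^ 2 / (1 + w) ≤ a ^ 2 / 2 + (b - r * a) ^ 2 / (2 * (1 - r ^ 2)) := by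
    have h1 : a ^ 2 / 2 + (b - r * a) ^ 2 / (2 * (1 - r ^ 2)) =
        (a ^ 2 + b ^ 2 - 2 * r * a * b) / (2 * (1 - r ^ 2)) := by
      field_simp; ring
    have hr1 : |r| < 1 := hrw.trans_lt hw
    have h2 : 2 * (1 - |r|) * u ^ 2 ≤ a ^ 2 + b ^ 2 - 2 * r * a * b := by
      have h3 : r * (a * b) ≤ |r| * (a * b) :=
        mul_le_mul_of_nonneg_right (le_abs_self r) (mul_nonneg (hu.trans ha) (hu.trans hb))
      have h4 : u ^ 2 ≤ a ^ 2 := pow_le_pow_left₀ hu ha 2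
      have h5 : u ^ 2 ≤ b ^ 2 := pow_le_pow_left₀ hu hb 2
      have h6 : (1 - |r|) * (2 * u ^ 2) ≤ (1 - |r|) * (a ^ 2 + b ^ 2) :=
        mul_le_mul_of_nonneg_left (by linarith) (by linarith)
      have h7 : 0 ≤ |r| * (a - b) ^ 2 := by positivity
      nlinarith
    rw [h1, le_div_iff₀ (by positivity), div_mul_eq_mul_div, div_le_iff₀ (by positivity)]
    have h8 : 1 - r ^ 2 = (1 - |r|) * (1 + |r|) := by rw [← sq_abs r]; ring
    rw [h8]
    have h9 : 2 * (1 - |r|) * u ^ 2 * (1 + |r|) ≤ 2 * (1 - |r|) * u ^ 2 * (1 + w) :=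
      mul_le_mul_of_nonneg_left (by linarith)
        (mul_nonneg (by linarith) (sq_nonneg u))
    have h10 := mul_le_mul_of_nonneg_right h2 (show 0 ≤ 1 + w by linarith)
    nlinarith
  have hsq : (√(1 - r ^ 2))⁻¹ ≤ (√(1 - w ^ 2))⁻¹ := by
    apply inv_anti₀ (Real.sqrt_pos.2 hw2)
    exact Real.sqrt_le_sqrt (by linarith)
  have hex : rexp (-(a ^ 2 / 2 + (b - r * a) ^ 2 / (2 * (1 - r ^ 2)))) ≤
      rexp (-u ^ 2 / (1 + w)) := by
    rw [Real.exp_le_exp, neg_div]; linarith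
  gcongr

section

variable {Ω : Type*} [MeasurableSpace Ω] {P : Measure Ω} {ι : Type*} [Fintype ι]

theorem integral_mul_le_bivariateBound [IsProbabilityMeasure P] {V₁ V₂ : Ω → ℝ}
    (hm₁ : Measurable V₁) (hm₂ : Measurable V₂)
    (hG : HasGaussianLaw (fun ω => (V₁ ω, V₂ ω)) P)
    (h₁ : P.map V₁ = gaussianReal 0 1) (h₂ : P.map V₂ = gaussianReal 0 1)
    {w u : ℝ} (hrw : |cov[V₁, V₂; P]| ≤ w) (hw : w < 1) (hu : 0 ≤ u)
    {f₁ f₂ : ℝ → ℝ} {C K : ℝ} (hf₁m : Measurable f₁) (hf₂m : Measurable f₂)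
    (hf₁0 : ∀ x, 0 ≤ f₁ x) (hf₂0 : ∀ x, 0 ≤ f₂ x) (hf₁C : ∀ x, f₁ x ≤ C) (hf₂C : ∀ x, f₂ x ≤ C)
    (hf₁u : ∀ x < u, f₁ x = 0) (hf₂u : ∀ x < u, f₂ x = 0)
    (hf₁i : Integrable f₁) (hf₂i : Integrable f₂) (hf₁K : ∫ x, f₁ x ≤ K) (hf₂K : ∫ x, f₂ x ≤ K) :
    ∫ ω, f₁ (V₁ ω) * f₂ (V₂ ω) ∂P ≤ K ^ 2 * bivariateBound w u := by
  set r := cov[V₁, V₂; P] with hr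
  have hK : 0 ≤ K := (integral_nonneg hf₁0).trans hf₁K
  have hC : 0 ≤ C := (hf₁0 0).trans (hf₁C 0)
  have hB := bivariateBound_nonneg w u
  have hs : 0 < 1 - r ^ 2 := by
    have : r ^ 2 ≤ w ^ 2 := by
      rw [← sq_abs r]; exact pow_le_pow_left₀ (abs_nonneg r) hrw 2
    nlinarith [(abs_nonneg r).trans hrw]
  set v : ℝ≥0 := (1 - r ^ 2).toNNReal with hv
  have hvr : (v : ℝ) = 1 - r ^ 2 := Real.coe_toNNReal _ hs.le
  have hv0 : v ≠ 0 := by rw [hv]; simpa using hs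
  have hL1 : MemLp V₁ 2 P := hG.fst.memLp_two
  have hL2 : MemLp V₂ 2 P := hG.snd.memLp_two
  set W : Ω → ℝ := fun ω => V₂ ω - r * V₁ ω with hW
  have hWm : Measurable W := hm₂.sub (hm₁.const_mul _)
  have hGW : HasGaussianLaw (fun ω => (V₁ ω, W ω)) P := by
    have := hG.map ((ContinuousLinearMap.fst ℝ ℝ ℝ).prod
      (ContinuousLinearMap.snd ℝ ℝ ℝ - r • ContinuousLinearMap.fst ℝ ℝ ℝ))
    exact this.congr (ae_of_all _ fun ω => by simp [hW])
  have hLW : MemLp W 2 P := hGW.snd.memLp_two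
  have hc1 : cov[V₁, V₁; P] = 1 := by simpa using covariance_self_of_map_eq_gaussianReal hm₁ h₁
  have hc2 : cov[V₂, V₂; P] = 1 := by simpa using covariance_self_of_map_eq_gaussianReal hm₂ h₂
  have hind : IndepFun V₁ W P := by
    refine hGW.indepFun_of_covariance_eq_zero ?_
    simp only [hW]
    rw [covariance_fun_sub_right hL1 hL2 (hL1.const_mul _), covariance_const_mul_right, hc1]
    simp [hr]
  have hWlaw : P.map W = gaussianReal 0 v := by
    rw [hGW.snd.map_eq_gaussianReal, ← covariance_self hWm.aemeasurable]
    congr 1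
    · simp only [hW]
      rw [integral_sub (hL2.integrable one_le_two) ((hL1.integrable one_le_two).const_mul _),
        integral_const_mul, integral_eq_zero_of_map_eq_gaussianReal hm₁ h₁,
        integral_eq_zero_of_map_eq_gaussianReal hm₂ h₂]
      simp
    · rw [hv]
      congr 1
      simp only [hW]
      rw [covariance_fun_sub_left hL2 (hL1.const_mul _) hLW,
        covariance_fun_sub_right hL2 hL2 (hL1.const_mul _),
        covariance_fun_sub_right (hL1.const_mul _) hL2 (hL1.const_mul _)]
      simp only [covariance_const_mul_left, covariance_const_mul_right, hc1, hc2,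
        covariance_comm V₂ V₁]
      rw [← hr]; ring
  have hlaw : P.map (fun ω => (V₁ ω, W ω)) = (gaussianReal 0 1).prod (gaussianReal 0 v) := by
    rw [← h₁, ← hWlaw]
    exact (indepFun_iff_map_prod_eq_prod_map_map hm₁.aemeasurable hWm.aemeasurable).1 hind
  have e1 : ∫ ω, f₁ (V₁ ω) * f₂ (V₂ ω) ∂P =
      ∫ a, ∫ b, f₁ a * f₂ (b + r * a) ∂(gaussianReal 0 v) ∂(gaussianReal 0 1) := by
    rw [← integral_prod (fun p : ℝ × ℝ => f₁ p.1 * f₂ (p.2 + r * p.1)), ← hlaw,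
      integral_map (hm₁.prodMk hWm).aemeasurable]
    · congr with ω; simp [hW]
    · exact Measurable.aestronglyMeasurable (by fun_prop)
    · refine Integrable.of_bound (C := C * C) (Measurable.aestronglyMeasurable (by fun_prop))
        (ae_of_all _ fun p => ?_)
      rw [Real.norm_eq_abs, abs_mul, abs_of_nonneg (hf₁0 _), abs_of_nonneg (hf₂0 _)]
      exact mul_le_mul (hf₁C _) (hf₂C _) (hf₂0 _) hC
  have e2 : ∀ a, ∫ b, f₁ a * f₂ (b + r * a) ∂(gaussianReal 0 v) =
      f₁ a * ∫ b, gaussianPDFReal (r * a) v b * f₂ b := by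
    intro a
    rw [integral_const_mul]
    congr 1
    have := gaussianReal_map_add_const (μ := 0) (v := v) (r * a)
    rw [zero_add] at this
    have h3 := integral_gaussianReal_eq_integral_smul (μ := r * a) (f := f₂) hv0
    simp only [smul_eq_mul] at h3
    rw [← h3, ← this, integral_map (by fun_prop) hf₂m.aestronglyMeasurable]
  rw [e1]
  simp_rw [e2]
  rw [integral_gaussianReal_eq_integral_smul one_ne_zero]
  simp only [smul_eq_mul]
  have hpt : ∀ a, gaussianPDFReal 0 1 a * (f₁ a * ∫ b, gaussianPDFReal (r * a) v b * f₂ b) ≤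
      f₁ a * (bivariateBound w u * K) := by
    intro a
    by_cases ha : a < u
    · simp [hf₁u a ha]
    push Not at ha
    have h4 : gaussianPDFReal 0 1 a * (f₁ a * ∫ b, gaussianPDFReal (r * a) v b * f₂ b) =
        f₁ a * ∫ b, gaussianPDFReal 0 1 a * (gaussianPDFReal (r * a) v b * f₂ b) := by
      rw [integral_const_mul]; ring
    rw [h4]
    refine mul_le_mul_of_nonneg_left ?_ (hf₁0 a)
    calc ∫ b, gaussianPDFReal 0 1 a * (gaussianPDFReal (r * a) v b * f₂ b)
        ≤ ∫ b, bivariateBound w u * f₂ b := by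
          refine integral_mono_of_nonneg (ae_of_all _ fun b => ?_) (hf₂i.const_mul _)
            (ae_of_all _ fun b => ?_)
          · exact mul_nonneg (gaussianPDFReal_nonneg _ _ _)
              (mul_nonneg (gaussianPDFReal_nonneg _ _ _) (hf₂0 b))
          · by_cases hb : b < u
            · simp [hf₂u b hb]
            push Not at hb
            simp only
            rw [← mul_assoc]
            exact mul_le_mul_of_nonneg_right (gaussianPDFReal_mul_le hrw hw hu ha hb hvr) (hf₂0 b)
      _ = bivariateBound w u * ∫ b, f₂ b := integral_const_mul _ _
      _ ≤ bivariateBound w u * K := mul_le_mul_of_nonneg_left hf₂K hB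
  calc _ ≤ ∫ a, f₁ a * (bivariateBound w u * K) := by
        refine integral_mono_of_nonneg (ae_of_all _ fun a => ?_) (hf₁i.mul_const _)
          (ae_of_all _ hpt)
        exact mul_nonneg (gaussianPDFReal_nonneg _ _ _) (mul_nonneg (hf₁0 a)
          (integral_nonneg fun b => mul_nonneg (gaussianPDFReal_nonneg _ _ _) (hf₂0 b)))
    _ = (∫ a, f₁ a) * (bivariateBound w u * K) := integral_mul_const _ _
    _ ≤ K * (bivariateBound w u * K) := by gcongr
    _ = _ := by ring

end

/-- The function equal to `1` up to `u₁`, to `s` on `(u₁, u₂]` and to `t` beyond `u₂`. -/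
noncomputable def levelWeight (u₁ u₂ s t x : ℝ) : ℝ :=
  if x ≤ u₁ then 1 else if x ≤ u₂ then s else t

theorem measurable_levelWeight (u₁ u₂ s t : ℝ) : Measurable (levelWeight u₁ u₂ s t) :=
  Measurable.ite measurableSet_Iic measurable_const
    (Measurable.ite measurableSet_Iic measurable_const measurable_const)

theorem levelWeight_mem_Icc {s t : ℝ} (hs : s ∈ Set.Icc (0 : ℝ) 1) (ht : t ∈ Set.Icc (0 : ℝ) 1)
    (u₁ u₂ x : ℝ) : levelWeight u₁ u₂ s t x ∈ Set.Icc (0 : ℝ) 1 := by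
  unfold levelWeight
  split_ifs
  · simp
  · exact hs
  · exact ht

theorem abs_levelWeight_le_one {s t : ℝ} (hs : s ∈ Set.Icc (0 : ℝ) 1)
    (ht : t ∈ Set.Icc (0 : ℝ) 1) (u₁ u₂ x : ℝ) : |levelWeight u₁ u₂ s t x| ≤ 1 := by
  have := levelWeight_mem_Icc hs ht u₁ u₂ x
  rw [abs_of_nonneg this.1]; exact this.2

theorem hasDerivAt_smoothTransition (x : ℝ) :
    HasDerivAt smoothTransition (deriv smoothTransition x) x :=
  ((smoothTransition.contDiff (n := 1)).differentiable (by simp) x).hasDerivAt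

theorem continuous_deriv_smoothTransition : Continuous (deriv smoothTransition) :=
  (smoothTransition.contDiff (n := 1)).continuous_deriv (by simp)

theorem deriv_smoothTransition_nonneg (x : ℝ) : 0 ≤ deriv smoothTransition x :=
  smoothTransition.monotone.deriv_nonneg

theorem deriv_smoothTransition_of_neg {x : ℝ} (hx : x < 0) : deriv smoothTransition x = 0 := by
  have : smoothTransition =ᶠ[nhds x] fun _ => 0 := by
    filter_upwards [Iio_mem_nhds hx] with y hy
    exact smoothTransition.zero_of_nonpos hy.le
  rw [this.deriv_eq]; simp

theorem deriv_smoothTransition_of_one_lt {x : ℝ} (hx : 1 < x) : deriv smoothTransition x = 0 := by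
  have : smoothTransition =ᶠ[nhds x] fun _ => 1 := by
    filter_upwards [Ioi_mem_nhds hx] with y hy
    exact smoothTransition.one_of_one_le hy.le
  rw [this.deriv_eq]; simp

theorem hasCompactSupport_deriv_smoothTransition :
    HasCompactSupport (deriv smoothTransition) := by
  refine HasCompactSupport.intro (isCompact_Icc (a := (0 : ℝ)) (b := 1)) fun x hx => ?_
  rw [Set.mem_Icc, not_and_or, not_le, not_le] at hx
  exact hx.elim deriv_smoothTransition_of_neg deriv_smoothTransition_of_one_lt

theorem integral_deriv_smoothTransition : ∫ x, deriv smoothTransition x = 1 := by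
  have h1 : ∫ x, deriv smoothTransition x = ∫ x in Set.Icc 0 1, deriv smoothTransition x := by
    refine (setIntegral_eq_integral_of_forall_compl_eq_zero fun x hx => ?_).symm
    rw [Set.mem_Icc, not_and_or, not_le, not_le] at hx
    exact hx.elim deriv_smoothTransition_of_neg deriv_smoothTransition_of_one_lt
  rw [h1, integral_Icc_eq_integral_Ioc, ← intervalIntegral.integral_of_le zero_le_one,
    intervalIntegral.integral_eq_sub_of_hasDerivAt (fun x _ => hasDerivAt_smoothTransition x)
      (continuous_deriv_smoothTransition.intervalIntegrable _ _)]
  simp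

theorem exists_deriv_smoothTransition_le : ∃ M : ℝ, 0 ≤ M ∧ ∀ x, deriv smoothTransition x ≤ M := by
  obtain ⟨M, hM⟩ := hasCompactSupport_deriv_smoothTransition.exists_bound_of_continuous
    continuous_deriv_smoothTransition
  exact ⟨M, (norm_nonneg _).trans (hM 0), fun x => (le_abs_self _).trans (hM x)⟩

theorem tendsto_smoothTransition_mul (x u : ℝ) :
    Tendsto (fun m : ℕ => smoothTransition (m * (x - u))) atTop
      (nhds (if x ≤ u then 0 else 1)) := by
  split_ifs with h
  · refine tendsto_const_nhds.congr fun m => (smoothTransition.zero_of_nonpos ?_).symm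
    exact mul_nonpos_of_nonneg_of_nonpos (Nat.cast_nonneg m) (by linarith)
  · push Not at h
    refine tendsto_const_nhds.congr' ?_
    have h1 : Tendsto (fun m : ℕ => (m : ℝ) * (x - u)) atTop atTop :=
      tendsto_natCast_atTop_atTop.atTop_mul_const (by linarith)
    filter_upwards [h1.eventually_ge_atTop 1] with m hm
    exact (smoothTransition.one_of_one_le hm).symm

/-- A smooth approximation of `levelWeight u₁ u₂ s t`. -/
noncomputable def smoothLevelWeight (m : ℕ) (u₁ u₂ s t x : ℝ) : ℝ :=
  1 + (s - 1) * smoothTransition (m * (x - u₁)) + (t - s) * smoothTransition (m * (x - u₂))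

/-- The derivative of `smoothLevelWeight m u₁ u₂ s t`. -/
noncomputable def derivSmoothLevelWeight (m : ℕ) (u₁ u₂ s t x : ℝ) : ℝ :=
  (s - 1) * (deriv smoothTransition (m * (x - u₁)) * m) +
    (t - s) * (deriv smoothTransition (m * (x - u₂)) * m)

theorem hasDerivAt_smoothLevelWeight (m : ℕ) (u₁ u₂ s t x : ℝ) :
    HasDerivAt (smoothLevelWeight m u₁ u₂ s t) (derivSmoothLevelWeight m u₁ u₂ s t x) x := by
  have h1 : ∀ u : ℝ, HasDerivAt (fun x => smoothTransition (m * (x - u)))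
      (deriv smoothTransition (m * (x - u)) * m) x := fun u => by
    have : HasDerivAt (fun x : ℝ => (m : ℝ) * (x - u)) m x := by
      simpa using ((hasDerivAt_id x).sub_const u).const_mul (m : ℝ)
    exact (hasDerivAt_smoothTransition _).comp x this
  exact (((h1 u₁).const_mul (s - 1)).const_add 1).add ((h1 u₂).const_mul (t - s))

theorem abs_smoothLevelWeight_le_one (m : ℕ) {u₁ u₂ s t : ℝ} (hu : u₁ ≤ u₂)
    (hs : s ∈ Set.Icc (0 : ℝ) 1) (ht : t ∈ Set.Icc (0 : ℝ) 1) (x : ℝ) :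
    |smoothLevelWeight m u₁ u₂ s t x| ≤ 1 := by
  unfold smoothLevelWeight
  have h1 : smoothTransition (m * (x - u₂)) ≤ smoothTransition (m * (x - u₁)) :=
    smoothTransition.monotone (mul_le_mul_of_nonneg_left (by linarith) (Nat.cast_nonneg m))
  have h2 := smoothTransition.nonneg (m * (x - u₂))
  have h3 := smoothTransition.le_one (m * (x - u₁))
  set a := smoothTransition (m * (x - u₁))
  set b := smoothTransition (m * (x - u₂))
  obtain ⟨hs0, hs1⟩ := hs
  obtain ⟨ht0, ht1⟩ := ht
  rw [abs_le]
  constructor <;> nlinarith [mul_nonneg hs0 (sub_nonneg.2 h1), mul_nonneg ht0 h2,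
    mul_nonneg (sub_nonneg.2 hs1) (sub_nonneg.2 h1), mul_nonneg (sub_nonneg.2 ht1) h2]

theorem tendsto_smoothLevelWeight {u₁ u₂ : ℝ} (hu : u₁ ≤ u₂) (s t x : ℝ) :
    Tendsto (fun m : ℕ => smoothLevelWeight m u₁ u₂ s t x) atTop
      (nhds (levelWeight u₁ u₂ s t x)) := by
  have := (((tendsto_smoothTransition_mul x u₁).const_mul (s - 1)).const_add 1).add
    ((tendsto_smoothTransition_mul x u₂).const_mul (t - s))
  refine this.trans_eq (congrArg nhds ?_)
  unfold levelWeight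
  split_ifs with h1 h2
  · ring
  · exact absurd (h1.trans hu) h2
  · ring
  · ring

theorem abs_derivSmoothLevelWeight_le (m : ℕ) (u₁ u₂ : ℝ) {s t : ℝ}
    (hs : s ∈ Set.Icc (0 : ℝ) 1) (ht : t ∈ Set.Icc (0 : ℝ) 1) (x : ℝ) :
    |derivSmoothLevelWeight m u₁ u₂ s t x| ≤
      deriv smoothTransition (m * (x - u₁)) * m + deriv smoothTransition (m * (x - u₂)) * m := by
  unfold derivSmoothLevelWeight
  have h0 : ∀ u : ℝ, 0 ≤ deriv smoothTransition (m * (x - u)) * m := fun u =>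
    mul_nonneg (deriv_smoothTransition_nonneg _) (Nat.cast_nonneg m)
  refine (abs_add_le _ _).trans (add_le_add ?_ ?_)
  · rw [abs_mul, abs_of_nonneg (h0 u₁)]
    exact mul_le_of_le_one_left (h0 u₁) (abs_le.2 ⟨by linarith [hs.1], by linarith [hs.2]⟩)
  · rw [abs_mul, abs_of_nonneg (h0 u₂)]
    exact mul_le_of_le_one_left (h0 u₂)
      (abs_le.2 ⟨by linarith [hs.2, ht.1], by linarith [hs.1, ht.2]⟩)

theorem integrable_deriv_smoothTransition_mul {m : ℕ} (hm : m ≠ 0) (u : ℝ) :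
    Integrable (fun x => deriv smoothTransition (m * (x - u)) * m) := by
  have h : Integrable (deriv smoothTransition) :=
    continuous_deriv_smoothTransition.integrable_of_hasCompactSupport
      hasCompactSupport_deriv_smoothTransition
  exact ((h.comp_mul_left' (R := (m : ℝ)) (by exact_mod_cast hm)).comp_sub_right u).mul_const _

theorem integral_deriv_smoothTransition_mul {m : ℕ} (hm : m ≠ 0) (u : ℝ) :
    ∫ x, deriv smoothTransition (m * (x - u)) * m = 1 := by
  rw [integral_mul_const,
    integral_sub_right_eq_self (fun x => deriv smoothTransition (m * x)) u,
    Measure.integral_comp_mul_left, integral_deriv_smoothTransition]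
  simp [abs_of_nonneg, hm]

section

variable {Ω : Type*} [MeasurableSpace Ω] {P : Measure Ω} {ι : Type*} [Fintype ι]

/-- The normal comparison inequality for products of two-level step functions. -/
theorem abs_integral_prod_levelWeight_sub_le [IsProbabilityMeasure P]
    {X Y : ι → Ω → ℝ} (hXm : ∀ i, Measurable (X i)) (hYm : ∀ i, Measurable (Y i))
    (hG : HasGaussianLaw (fun ω => (fun i => X i ω, fun i => Y i ω)) P)
    (hX : ∀ i, P.map (X i) = gaussianReal 0 1) (hY : ∀ i, P.map (Y i) = gaussianReal 0 1)
    (hXY : ∀ i j, cov[X i, Y j; P] = 0) {u₁ u₂ : ℝ} (hu0 : 0 ≤ u₁) (hu : u₁ ≤ u₂)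
    {s t : ι → ℝ} (hs : ∀ i, s i ∈ Set.Icc (0 : ℝ) 1) (ht : ∀ i, t i ∈ Set.Icc (0 : ℝ) 1)
    {w : ι → ι → ℝ} (hw : ∀ i j, w i j < 1)
    (hwX : ∀ i j, i ≠ j → |cov[X i, X j; P]| ≤ w i j)
    (hwY : ∀ i j, i ≠ j → |cov[Y i, Y j; P]| ≤ w i j) :
    |∫ ω, ∏ i, levelWeight u₁ u₂ (s i) (t i) (X i ω) ∂P -
      ∫ ω, ∏ i, levelWeight u₁ u₂ (s i) (t i) (Y i ω) ∂P| ≤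
      (∑ i, ∑ j, |cov[X i, X j; P] - cov[Y i, Y j; P]| * (2 ^ 2 * bivariateBound (w i j) u₁)) *
        (π / 2) := by
  have hX2 : ∀ k, MemLp (X k) 2 P := fun k => (hG.fst.eval k).memLp_two
  have hY2 : ∀ k, MemLp (Y k) 2 P := fun k => (hG.snd.eval k).memLp_two
  obtain ⟨M, hM0, hM⟩ := exists_deriv_smoothTransition_le
  have hlim : ∀ Z : ι → Ω → ℝ, (∀ i, Measurable (Z i)) → Tendsto
      (fun m : ℕ => ∫ ω, ∏ i, smoothLevelWeight m u₁ u₂ (s i) (t i) (Z i ω) ∂P) atTop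
      (nhds (∫ ω, ∏ i, levelWeight u₁ u₂ (s i) (t i) (Z i ω) ∂P)) := by
    intro Z hZ
    refine tendsto_integral_of_dominated_convergence (fun _ => 1) (fun m => ?_)
      (integrable_const _) (fun m => ae_of_all _ fun ω => ?_) (ae_of_all _ fun ω => ?_)
    · have : ∀ i, Measurable (smoothLevelWeight m u₁ u₂ (s i) (t i)) := fun i =>
        (continuous_iff_continuousAt.2 fun x =>
          (hasDerivAt_smoothLevelWeight m u₁ u₂ (s i) (t i) x).continuousAt).measurable
      exact Measurable.aestronglyMeasurable (by fun_prop)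
    · exact abs_prod_le_one _ _ fun i => abs_smoothLevelWeight_le_one m hu (hs i) (ht i) _
    · exact tendsto_finsetProd _ fun i _ => tendsto_smoothLevelWeight hu _ _ _
  refine le_of_tendsto ((hlim X hXm).sub (hlim Y hYm)).abs ?_
  filter_upwards [eventually_ne_atTop 0] with m hm
  have hmeas : ∀ i, Measurable (derivSmoothLevelWeight m u₁ u₂ (s i) (t i)) := fun i => by
    have := continuous_deriv_smoothTransition.measurable
    unfold derivSmoothLevelWeight
    fun_prop
  have hbd : ∀ i x, |derivSmoothLevelWeight m u₁ u₂ (s i) (t i) x| ≤ M * m + M * m := fun i x =>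
    (abs_derivSmoothLevelWeight_le m u₁ u₂ (hs i) (ht i) x).trans (by gcongr <;> exact hM _)
  have hInt : Integrable (fun x => deriv smoothTransition (m * (x - u₁)) * m +
      deriv smoothTransition (m * (x - u₂)) * m) :=
    (integrable_deriv_smoothTransition_mul hm _).add (integrable_deriv_smoothTransition_mul hm _)
  have hInti : ∀ i, Integrable (fun x => |derivSmoothLevelWeight m u₁ u₂ (s i) (t i) x|) :=
    fun i => hInt.mono' (hmeas i).abs.aestronglyMeasurable (ae_of_all _ fun x => by
      rw [Real.norm_eq_abs, abs_abs]
      exact abs_derivSmoothLevelWeight_le m u₁ u₂ (hs i) (ht i) x)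
  have hK : ∀ i, ∫ x, |derivSmoothLevelWeight m u₁ u₂ (s i) (t i) x| ≤ 2 := fun i => by
    refine (integral_mono (hInti i) hInt
      (abs_derivSmoothLevelWeight_le m u₁ u₂ (hs i) (ht i))).trans ?_
    rw [integral_add (integrable_deriv_smoothTransition_mul hm _)
      (integrable_deriv_smoothTransition_mul hm _), integral_deriv_smoothTransition_mul hm,
      integral_deriv_smoothTransition_mul hm]
    norm_num
  have hz : ∀ i, ∀ x < u₁, |derivSmoothLevelWeight m u₁ u₂ (s i) (t i) x| = 0 := fun i x hx => by
    have hmp : (0 : ℝ) < m := by exact_mod_cast Nat.pos_of_ne_zero hm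
    have h1 : (m : ℝ) * (x - u₁) < 0 := mul_neg_of_pos_of_neg hmp (by linarith)
    have h2 : (m : ℝ) * (x - u₂) < 0 := mul_neg_of_pos_of_neg hmp (by linarith)
    simp [derivSmoothLevelWeight, deriv_smoothTransition_of_neg h1,
      deriv_smoothTransition_of_neg h2]
  refine abs_integral_prod_sub_integral_prod_le hXm hYm hG hX hY hXY
    (fun i => hasDerivAt_smoothLevelWeight m u₁ u₂ (s i) (t i)) hmeas
    (fun i => abs_smoothLevelWeight_le_one m hu (hs i) (ht i)) hbd
    (fun i j => 2 ^ 2 * bivariateBound (w i j) u₁) fun θ i j hij => ?_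
  have hsc := sin_sq_add_cos_sq θ
  have hcov : ∀ i j, cov[fun ω => sin θ * X i ω + cos θ * Y i ω,
      fun ω => sin θ * X j ω + cos θ * Y j ω; P] =
      sin θ ^ 2 * cov[X i, X j; P] + cos θ ^ 2 * cov[Y i, Y j; P] := by
    intro i j
    rw [covariance_comm, covariance_fun_add_right_of_memLp 
        (show MemLp (fun ω => sin θ * X j ω + cos θ * Y j ω) 2 P from
          ((hX2 j).const_mul _).add ((hY2 j).const_mul _))
        ((hX2 i).const_mul _) ((hY2 i).const_mul _),
      covariance_comm, covariance_fun_add_right_of_memLp ((hX2 i).const_mul _) ((hX2 j).const_mul _)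
        ((hY2 j).const_mul _), covariance_comm _ (fun ω => cos θ * Y i ω),
      covariance_fun_add_right_of_memLp ((hY2 i).const_mul _) ((hX2 j).const_mul _)
        ((hY2 j).const_mul _)]
    simp only [covariance_const_mul_left, covariance_const_mul_right, hXY,
      covariance_comm (Y i) (X j)]
    ring
  have hpair : ∀ i j, HasGaussianLaw (fun ω => (sin θ * X i ω + cos θ * Y i ω,
      sin θ * X j ω + cos θ * Y j ω)) P := by
    intro i j
    have := hG.map (ContinuousLinearMap.prod
      (sin θ • ((ContinuousLinearMap.proj i).comp
        (ContinuousLinearMap.fst ℝ (ι → ℝ) (ι → ℝ))) + cos θ • ((ContinuousLinearMap.proj i).comp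
        (ContinuousLinearMap.snd ℝ (ι → ℝ) (ι → ℝ))))
      (sin θ • ((ContinuousLinearMap.proj j).comp
        (ContinuousLinearMap.fst ℝ (ι → ℝ) (ι → ℝ))) + cos θ • ((ContinuousLinearMap.proj j).comp
        (ContinuousLinearMap.snd ℝ (ι → ℝ) (ι → ℝ)))))
    exact this.congr (ae_of_all _ fun ω => by simp)
  have hVm : ∀ i, Measurable (fun ω => sin θ * X i ω + cos θ * Y i ω) := fun i =>
    ((hXm i).const_mul _).add ((hYm i).const_mul _)
  have hVlaw : ∀ i, P.map (fun ω => sin θ * X i ω + cos θ * Y i ω) = gaussianReal 0 1 := by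
    intro i
    rw [(hpair i i).fst.map_eq_gaussianReal, ← covariance_self (hVm i).aemeasurable, hcov,
      covariance_self_of_map_eq_gaussianReal (hXm i) (hX i),
      covariance_self_of_map_eq_gaussianReal (hYm i) (hY i),
      integral_add (((hX2 i).integrable one_le_two).const_mul _)
        (((hY2 i).integrable one_le_two).const_mul _), integral_const_mul, integral_const_mul,
      integral_eq_zero_of_map_eq_gaussianReal (hXm i) (hX i),
      integral_eq_zero_of_map_eq_gaussianReal (hYm i) (hY i)]
    simp [hsc]
  refine integral_mul_le_bivariateBound (hVm i) (hVm j) (hpair i j) (hVlaw i) (hVlaw j)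
    ?_ (hw i j) hu0 (hmeas i).abs (hmeas j).abs (fun _ => abs_nonneg _) (fun _ => abs_nonneg _)
    (hbd i) (hbd j) (hz i) (hz j) (hInti i) (hInti j) (hK i) (hK j)
  rw [hcov]
  refine (abs_add_le _ _).trans ?_
  rw [abs_mul, abs_mul, abs_of_nonneg (sq_nonneg (sin θ)), abs_of_nonneg (sq_nonneg (cos θ))]
  calc _ ≤ sin θ ^ 2 * w i j + cos θ ^ 2 * w i j := by
        gcongr
        · exact hwX i j hij
        · exact hwY i j hij
    _ = w i j := by rw [← add_mul, hsc, one_mul]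

end

theorem hasGaussianLaw_of_forall_sum {Ω ι : Type*} [MeasurableSpace Ω] {P : Measure Ω}
    [Fintype ι] {X : ι → Ω → ℝ} (hX : ∀ i, Measurable (X i))
    (h : ∀ c : ι → ℝ, ∃ v : ℝ≥0, P.map (fun ω => ∑ i, c i * X i ω) = gaussianReal 0 v) :
    HasGaussianLaw (fun ω i => X i ω) P where
  isGaussian_map := by
    refine isGaussian_of_map_eq_gaussianReal fun L => ?_
    obtain ⟨v, hv⟩ := h fun i => L (Pi.single i 1)
    refine ⟨0, v, ?_⟩
    rw [Measure.map_map L.continuous.measurable (measurable_pi_lambda _ hX), ← hv]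
    congr 1
    ext ω
    have := LinearMap.pi_apply_eq_sum_univ (L : (ι → ℝ) →ₗ[ℝ] ℝ) (fun i => X i ω)
    simp only [Function.comp_apply]
    refine this.trans (Finset.sum_congr rfl fun i _ => ?_)
    rw [smul_eq_mul, mul_comm]
    congr 1
    change L _ = L _
    congr 1
    ext j
    simp [Pi.single_apply, eq_comm]

theorem tendsto_zero_of_tendsto_mul_log {r : ℕ → ℝ} {γ : ℝ}
    (hr : Tendsto (fun n : ℕ => r n * Real.log n) atTop (nhds γ)) :
    Tendsto r atTop (nhds 0) := by
  have hlog : Tendsto (fun n : ℕ => Real.log n) atTop atTop :=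
    Real.tendsto_log_atTop.comp tendsto_natCast_atTop_atTop
  refine (hr.div_atTop hlog).congr' ?_
  filter_upwards [hlog.eventually_gt_atTop 0] with n hn
  exact mul_div_cancel_right₀ _ hn.ne'

theorem exists_lt_one_forall_abs_le {r : ℕ → ℝ} (h0 : Tendsto r atTop (nhds 0))
    (h1 : ∀ k, 1 ≤ k → |r k| < 1) : ∃ δ, 0 < δ ∧ δ < 1 ∧ ∀ k, 1 ≤ k → |r k| ≤ δ := by
  have habs : Tendsto (fun k => |r k|) atTop (nhds 0) := by simpa using h0.abs
  obtain ⟨N, hN⟩ := eventually_atTop.1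
    (habs.eventually_le_const (show (0 : ℝ) < 1 / 2 by norm_num))
  suffices H : ∀ M, ∃ δ : ℝ, 0 < δ ∧ δ < 1 ∧ ∀ k, 1 ≤ k → k < M → |r k| ≤ δ by
    obtain ⟨δ, hδ0, hδ1, hδ⟩ := H N
    refine ⟨max δ (1 / 2), by positivity, max_lt hδ1 (by norm_num), fun k hk => ?_⟩
    rcases lt_or_ge k N with h | h
    · exact (hδ k hk h).trans (le_max_left _ _)
    · exact (hN k h).trans (le_max_right _ _)
  intro M
  induction M with
  | zero => exact ⟨1 / 2, by norm_num, by norm_num, fun k _ hk => absurd hk (Nat.not_lt_zero _)⟩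
  | succ M ih =>
    obtain ⟨δ, hδ0, hδ1, hδ⟩ := ih
    rcases Nat.eq_zero_or_pos M with rfl | hM
    · exact ⟨δ, hδ0, hδ1, fun k hk hk' => by omega⟩
    refine ⟨max δ |r M|, by positivity, max_lt hδ1 (h1 M hM), fun k hk hk' => ?_⟩
    rcases (Nat.lt_succ_iff.1 hk').lt_or_eq with h | rfl
    · exact (hδ k hk h).trans (le_max_left _ _)
    · exact le_max_right _ _

section Stationary

variable {Ω : Type*} [MeasurableSpace Ω] {P : Measure Ω} {X : ℕ → Ω → ℝ}

theorem memLp_two_of_map_eq_gaussianReal {Y : Ω → ℝ} (hY : Measurable Y) {m : ℝ} {v : ℝ≥0}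
    (h : P.map Y = gaussianReal m v) : MemLp Y 2 P := by
  have : MemLp id 2 (P.map Y) := h ▸ memLp_id_gaussianReal 2
  exact (memLp_map_measure_iff measurable_id.aestronglyMeasurable hY.aemeasurable).1 this

theorem integral_mul_add_eq_of_stationary (hX : ∀ n, Measurable (X n))
    (hstat : ∀ (m k : ℕ), P.map (fun ω => fun i : Fin m => X (i.1 + 1 + k) ω) =
      P.map (fun ω => fun i : Fin m => X (i.1 + 1) ω)) {i : ℕ} (hi : 1 ≤ i) (d : ℕ) :
    ∫ ω, X i ω * X (i + d) ω ∂P = ∫ ω, X 1 ω * X (d + 1) ω ∂P := by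
  have key : ∀ k : ℕ, ∫ ω, X (0 + 1 + k) ω * X (d + 1 + k) ω ∂P =
      ∫ p : Fin (d + 1) → ℝ, p 0 * p (Fin.last d)
        ∂(P.map (fun ω => fun i : Fin (d + 1) => X (i.1 + 1 + k) ω)) := fun k => by
    have hm : Measurable fun p : Fin (d + 1) → ℝ => p 0 * p (Fin.last d) :=
      (measurable_pi_apply _).mul (measurable_pi_apply _)
    rw [integral_map (measurable_pi_lambda _ fun i => hX _).aemeasurable
      hm.aestronglyMeasurable]
    rfl
  have h := key (i - 1)
  rw [hstat, ← hstat _ 0, ← key 0] at h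
  have e1 : 0 + 1 + (i - 1) = i := by omega
  have e2 : d + 1 + (i - 1) = i + d := by omega
  rw [e1, e2] at h
  simpa using h

theorem covariance_eq_of_stationary [IsProbabilityMeasure P] (hX : ∀ n, Measurable (X n))
    (hstd : ∀ n, P.map (X n) = gaussianReal 0 1)
    (hstat : ∀ (m k : ℕ), P.map (fun ω => fun i : Fin m => X (i.1 + 1 + k) ω) =
      P.map (fun ω => fun i : Fin m => X (i.1 + 1) ω)) {i j : ℕ} (hi : 1 ≤ i) (hj : 1 ≤ j) :
    cov[X i, X j; P] = ∫ ω, X 1 ω * X (Nat.dist i j + 1) ω ∂P := by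
  have h2 := fun n => memLp_two_of_map_eq_gaussianReal (hX n) (hstd n)
  have h0 := fun n => integral_eq_zero_of_map_eq_gaussianReal (hX n) (hstd n)
  have h : ∀ i j, cov[X i, X j; P] = ∫ ω, X i ω * X j ω ∂P := fun i j => by
    rw [covariance_eq_sub (h2 i) (h2 j)]
    simp [h0]
  rw [h]
  rcases le_total i j with hij | hij
  · obtain ⟨d, rfl⟩ := Nat.exists_eq_add_of_le hij
    rw [Nat.dist_eq_sub_of_le hij, integral_mul_add_eq_of_stationary hX hstat hi]
    simp
  · obtain ⟨d, rfl⟩ := Nat.exists_eq_add_of_le hij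
    simp_rw [mul_comm (X (j + d) _)]
    rw [Nat.dist_eq_sub_of_le_right hij, integral_mul_add_eq_of_stationary hX hstat hj]
    simp

theorem abs_integral_mul_lt_one_of_stationary [IsProbabilityMeasure P]
    (hX : ∀ n, Measurable (X n)) (hstd : ∀ n, P.map (X n) = gaussianReal 0 1)
    (hstat : ∀ (m k : ℕ), P.map (fun ω => fun i : Fin m => X (i.1 + 1 + k) ω) =
      P.map (fun ω => fun i : Fin m => X (i.1 + 1) ω))
    (h0 : Tendsto (fun n : ℕ => ∫ ω, X 1 ω * X (n + 1) ω ∂P) atTop (nhds 0))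
    {k : ℕ} (hk : 1 ≤ k) : |∫ ω, X 1 ω * X (k + 1) ω ∂P| < 1 := by
  have h2 := fun n => memLp_two_of_map_eq_gaussianReal (hX n) (hstd n)
  have hmean := fun n => integral_eq_zero_of_map_eq_gaussianReal (hX n) (hstd n)
  have hInt : ∀ i j, Integrable (fun ω => X i ω * X j ω) P := fun i j =>
    (h2 i).integrable_mul (h2 j)
  have hsq : ∀ i, ∫ ω, X i ω * X i ω ∂P = 1 := fun i => by
    have := covariance_self_of_map_eq_gaussianReal (hX i) (hstd i)
    rw [covariance_eq_sub (h2 i) (h2 i)] at this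
    simpa [hmean] using this
  set s := ∫ ω, X 1 ω * X (k + 1) ω ∂P with hs
  have hquad : ∀ c : ℝ, ∀ j, 1 ≤ j →
      ∫ ω, (X (j + k) ω - c * X j ω) ^ 2 ∂P = 1 - 2 * c * s + c ^ 2 := fun c j hj => by
    have : ∀ ω, (X (j + k) ω - c * X j ω) ^ 2 = X (j + k) ω * X (j + k) ω -
        2 * c * (X j ω * X (j + k) ω) + c ^ 2 * (X j ω * X j ω) := fun ω => by ring
    simp_rw [this]
    rw [integral_add ?_ ((hInt _ _).const_mul _),
      integral_sub (hInt _ _) ((hInt _ _).const_mul _), integral_const_mul, integral_const_mul,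
      hsq, hsq, integral_mul_add_eq_of_stationary hX hstat hj]
    · simp [hs]
    · exact (hInt _ _).sub ((hInt _ _).const_mul _)
  have hnn : ∀ c : ℝ, 0 ≤ 1 - 2 * c * s + c ^ 2 := fun c => by
    rw [← hquad c 1 le_rfl]
    exact integral_nonneg fun ω => sq_nonneg _
  have hle : |s| ≤ 1 := abs_le.2 ⟨by linarith [hnn (-1)], by linarith [hnn 1]⟩
  refine hle.lt_of_ne fun habs => ?_
  have hs2 : s ^ 2 = 1 := by rw [← sq_abs, habs, one_pow]
  have hae : ∀ j, 1 ≤ j → (fun ω => X (j + k) ω) =ᵐ[P] fun ω => s * X j ω := fun j hj => by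
    have hz := hquad s j hj
    have hi : Integrable (fun ω => (X (j + k) ω - s * X j ω) ^ 2) P :=
      ((h2 _).sub ((h2 _).const_mul s)).integrable_sq
    rw [show 1 - 2 * s * s + s ^ 2 = 0 by nlinarith, integral_eq_zero_iff_of_nonneg
      (fun ω => sq_nonneg _) hi] at hz
    filter_upwards [hz] with ω hω
    exact sub_eq_zero.1 (pow_eq_zero_iff two_ne_zero |>.1 hω)
  have hpow : ∀ m : ℕ, ∫ ω, X 1 ω * X (m * k + 1) ω ∂P = s ^ m := fun m => by
    induction m with
    | zero => simpa using hsq 1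
    | succ m ih =>
      have : (m + 1) * k + 1 = m * k + 1 + k := by ring
      rw [this, integral_congr_ae (g := fun ω => s * (X 1 ω * X (m * k + 1) ω)),
        integral_const_mul, ih, pow_succ']
      filter_upwards [hae (m * k + 1) (Nat.le_add_left _ _)] with ω hω
      rw [hω]
      ring
  have hlim := (h0.comp (tendsto_id.atTop_mul_const' hk)).abs
  simp only [Function.comp_def, id] at hlim
  simp_rw [hpow, abs_pow, habs, one_pow, abs_zero] at hlim
  exact one_ne_zero (tendsto_nhds_unique tendsto_const_nhds hlim)

end Stationary

theorem tendsto_log_natCast_atTop : Tendsto (fun n : ℕ => Real.log n) atTop atTop :=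
  Real.tendsto_log_atTop.comp tendsto_natCast_atTop_atTop

theorem eventually_log_natCast_pos : ∀ᶠ n : ℕ in atTop, 0 < Real.log n :=
  tendsto_log_natCast_atTop.eventually_gt_atTop 0

theorem un_eq {n : ℕ} (hn : 0 < Real.log n) (x : ℝ) :
    un n x = √(2 * Real.log n) *
      (1 + (x - Real.log (4 * π) / 2 - Real.log (Real.log n) / 2) / (2 * Real.log n)) := by
  unfold un
  have h : √(2 * Real.log n) ^ 2 = 2 * Real.log n := Real.sq_sqrt (by positivity)
  have h0 : √(2 * Real.log n) ≠ 0 := by positivity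
  conv_rhs => enter [2, 2, 2]; rw [← h]
  field_simp
  ring

theorem un_mono (n : ℕ) {x y : ℝ} (h : x ≤ y) : un n x ≤ un n y := by
  unfold un
  gcongr

theorem tendsto_log_log_div_log :
    Tendsto (fun n : ℕ => Real.log (Real.log n) / Real.log n) atTop (nhds 0) := by
  have h := (Real.isLittleO_log_id_atTop.tendsto_div_nhds_zero).comp tendsto_log_natCast_atTop
  exact h

theorem tendsto_sq_log_log_div_log :
    Tendsto (fun n : ℕ => Real.log (Real.log n) ^ 2 / Real.log n) atTop (nhds 0) := by
  have h := ((Real.isLittleO_pow_log_id_atTop (n := 2)).tendsto_div_nhds_zero).comp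
    tendsto_log_natCast_atTop
  exact h

theorem tendsto_un_div_sqrt (x : ℝ) :
    Tendsto (fun n : ℕ => un n x / √(2 * Real.log n)) atTop (nhds 1) := by
  have h1 : Tendsto (fun n : ℕ => (x - Real.log (4 * π) / 2) / Real.log n) atTop (nhds 0) :=
    tendsto_const_nhds.div_atTop tendsto_log_natCast_atTop
  have h2 := ((h1.div_const 2).sub (tendsto_log_log_div_log.div_const 4)).const_add 1
  simp only [zero_div, sub_zero, add_zero] at h2
  refine h2.congr' ?_
  filter_upwards [eventually_log_natCast_pos] with n hn
  rw [un_eq hn, mul_div_cancel_left₀ _ (by positivity)]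
  field_simp
  ring

theorem tendsto_un_sq_div_log (x : ℝ) :
    Tendsto (fun n : ℕ => un n x ^ 2 / (2 * Real.log n)) atTop (nhds 1) := by
  have h := (tendsto_un_div_sqrt x).pow 2
  rw [one_pow] at h
  refine h.congr' ?_
  filter_upwards [eventually_log_natCast_pos] with n hn
  rw [div_pow, Real.sq_sqrt (by positivity)]

theorem eventually_un_pos (x : ℝ) : ∀ᶠ n : ℕ in atTop, 0 < un n x := by
  filter_upwards [(tendsto_un_div_sqrt x).eventually_const_lt zero_lt_one,
    eventually_log_natCast_pos] with n h1 h2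
  exact (div_pos_iff_of_pos_right (by positivity)).1 h1

theorem tendsto_un_sq_div_two_sub (x : ℝ) :
    Tendsto (fun n : ℕ => un n x ^ 2 / 2 - (Real.log n - Real.log (Real.log n) / 2)) atTop
      (nhds (x - Real.log (4 * π) / 2)) := by
  set b := x - Real.log (4 * π) / 2 with hb
  have h1 : Tendsto (fun n : ℕ => b ^ 2 / Real.log n) atTop (nhds 0) :=
    tendsto_const_nhds.div_atTop tendsto_log_natCast_atTop
  have h2 := (((h1.div_const 4).sub ((tendsto_log_log_div_log.const_mul b).div_const 4)).add
    (tendsto_sq_log_log_div_log.div_const 16)).const_add b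
  simp only [zero_div, sub_zero, add_zero, mul_zero] at h2
  refine h2.congr' ?_
  filter_upwards [eventually_log_natCast_pos] with n hn
  rw [un_eq hn, mul_pow, Real.sq_sqrt (by positivity), ← hb]
  field_simp
  ring

theorem exp_neg_un_sq_le (x : ℝ) : ∃ C, 0 < C ∧ ∀ᶠ n : ℕ in atTop,
    rexp (-un n x ^ 2) ≤ C * Real.log n / (n : ℝ) ^ 2 := by
  refine ⟨rexp (-2 * (x - Real.log (4 * π) / 2 - 1)), Real.exp_pos _, ?_⟩
  filter_upwards [(tendsto_un_sq_div_two_sub x).eventually_const_le (sub_one_lt _),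
    eventually_log_natCast_pos, eventually_gt_atTop 0] with n h1 h2 h3
  have hn : (0 : ℝ) < n := by exact_mod_cast h3
  have e : Real.log n / (n : ℝ) ^ 2 = rexp (Real.log (Real.log n) - 2 * Real.log n) := by
    rw [Real.exp_sub, Real.exp_log h2, mul_comm 2, Real.exp_mul, Real.exp_log hn]
    norm_num
  rw [mul_div_assoc, e, ← Real.exp_add]
  exact Real.exp_le_exp.2 (by linarith)

theorem sum_Ico_log_sub_log_le (n : ℕ) :
    ∑ k ∈ Finset.Ico 1 n, (Real.log n - Real.log k) ≤ n := by
  rcases Nat.eq_zero_or_pos n with rfl | hn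
  · simp
  have h1 : ∑ k ∈ Finset.Ico 1 n, (Real.log n - Real.log k) =
      ∑ k ∈ Finset.Ico 1 (n + 1), (Real.log n - Real.log k) := by
    rw [Finset.sum_Ico_succ_top hn, sub_self, add_zero]
  have h2 : ∑ k ∈ Finset.Ico 1 (n + 1), Real.log k = Real.log (Nat.factorial n) := by
    rw [← Finset.prod_Ico_id_eq_factorial, Nat.cast_prod, Real.log_prod]
    intro k hk
    have := (Finset.mem_Ico.1 hk).1
    positivity
  rw [h1, Finset.sum_sub_distrib, h2, Finset.sum_const, Nat.card_Ico, nsmul_eq_mul]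
  have h3 := Stirling.le_log_factorial_stirling hn.ne'
  have h4 : 0 ≤ Real.log n := Real.log_natCast_nonneg n
  have h5 : 0 ≤ Real.log (2 * π) := Real.log_nonneg (by nlinarith [Real.pi_gt_three])
  simp only [Nat.add_sub_cancel]
  linarith

theorem card_filter_log_le (n : ℕ) (c : ℝ) :
    (((Finset.Ico 1 n).filter fun k : ℕ => Real.log k ≤ c).card : ℝ) ≤ rexp c := by
  have hsub : ((Finset.Ico 1 n).filter fun k : ℕ => Real.log k ≤ c) ⊆
      Finset.Ico 1 (⌊rexp c⌋₊ + 1) := fun k hk => by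
    obtain ⟨h1, h2⟩ := Finset.mem_filter.1 hk
    have hk0 := (Finset.mem_Ico.1 h1).1
    refine Finset.mem_Ico.2 ⟨hk0, Nat.lt_succ_of_le (Nat.le_floor ?_)⟩
    exact (Real.log_le_iff_le_exp (by positivity)).1 h2
  refine (Nat.cast_le.2 (Finset.card_le_card hsub)).trans ?_
  rw [Nat.card_Ico, Nat.add_sub_cancel]
  exact Nat.floor_le (Real.exp_pos c).le

theorem tendsto_log_div_mul_sum_abs_sub {r : ℕ → ℝ} {γ : ℝ} (hγ : 0 ≤ γ)
    (hr : Tendsto (fun n : ℕ => r n * Real.log n) atTop (nhds γ)) {α : ℝ} (hα : 0 < α) :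
    Tendsto (fun n : ℕ => Real.log n / n *
      ∑ k ∈ (Finset.Ico 1 n).filter (fun k : ℕ => α * Real.log n < Real.log k),
        |r k - γ / Real.log n|) atTop (nhds 0) := by
  have h0 : Tendsto (fun n => |r n * Real.log n - γ|) atTop (nhds 0) := by
    simpa using (hr.sub_const γ).abs
  have h1 : Tendsto (fun n : ℕ => γ / α / Real.log n) atTop (nhds 0) :=
    tendsto_const_nhds.div_atTop tendsto_log_natCast_atTop
  have h2 := (h0.cesaro.const_mul α⁻¹).add h1
  rw [mul_zero, add_zero] at h2
  refine squeeze_zero' (Eventually.of_forall fun n => by positivity) ?_ h2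
  filter_upwards [eventually_log_natCast_pos, eventually_gt_atTop 0] with n hL hn
  have hn' : (0 : ℝ) < n := by exact_mod_cast hn
  set L := Real.log n
  have hpt : ∀ k ∈ (Finset.Ico 1 n).filter (fun k : ℕ => α * L < Real.log k),
      L * |r k - γ / L| ≤ α⁻¹ * |r k * Real.log k - γ| + γ / (α * L) * (L - Real.log k) := by
    intro k hk
    obtain ⟨hk1, hk2⟩ := Finset.mem_filter.1 hk
    obtain ⟨hk3, hk4⟩ := Finset.mem_Ico.1 hk1
    have hαL : 0 < α * L := by positivity
    have hl : 0 < Real.log k := hαL.trans hk2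
    have hkL : Real.log k ≤ L := Real.log_le_log (by positivity) (by exact_mod_cast hk4.le)
    have e : L * (r k - γ / L) = L / Real.log k * (r k * Real.log k - γ) +
        γ / Real.log k * (L - Real.log k) := by field_simp; ring
    have hα' : L / Real.log k ≤ α⁻¹ := by
      rw [div_le_iff₀ hl, ← div_eq_inv_mul, le_div_iff₀ hα]; linarith
    calc L * |r k - γ / L| = |L * (r k - γ / L)| := by rw [abs_mul, abs_of_pos hL]
      _ ≤ L / Real.log k * |r k * Real.log k - γ| + γ / Real.log k * (L - Real.log k) := by
          rw [e]
          refine (abs_add_le _ _).trans (le_of_eq ?_)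
          rw [abs_mul, abs_of_pos (div_pos hL hl),
            abs_of_nonneg (mul_nonneg (div_nonneg hγ hl.le) (sub_nonneg.2 hkL))]
      _ ≤ _ := by
          have : 0 ≤ L - Real.log k := sub_nonneg.2 hkL
          gcongr
  have hmono : ∀ k, 0 ≤ α⁻¹ * |r k * Real.log k - γ| := fun k => by positivity
  have hs1 : ∑ k ∈ (Finset.Ico 1 n).filter (fun k : ℕ => α * L < Real.log k),
      α⁻¹ * |r k * Real.log k - γ| ≤ ∑ k ∈ Finset.range n, α⁻¹ * |r k * Real.log k - γ| :=
    Finset.sum_le_sum_of_subset_of_nonneg (fun k hk =>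
      Finset.mem_range.2 (Finset.mem_Ico.1 (Finset.mem_filter.1 hk).1).2) fun k _ _ => hmono k
  have hs2 : ∑ k ∈ (Finset.Ico 1 n).filter (fun k : ℕ => α * L < Real.log k),
      γ / (α * L) * (L - Real.log k) ≤ γ / (α * L) * n := by
    refine le_trans ?_ (mul_le_mul_of_nonneg_left (sum_Ico_log_sub_log_le n) (by positivity))
    rw [Finset.mul_sum]
    refine Finset.sum_le_sum_of_subset_of_nonneg (Finset.filter_subset _ _) fun k hk _ => ?_
    obtain ⟨hk3, hk4⟩ := Finset.mem_Ico.1 hk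
    have : Real.log k ≤ L := Real.log_le_log (by positivity) (by exact_mod_cast hk4.le)
    have : 0 ≤ L - Real.log k := sub_nonneg.2 this
    positivity
  have hs := (Finset.sum_le_sum hpt).trans
    (Finset.sum_add_distrib.trans_le (add_le_add hs1 hs2))
  rw [← Finset.mul_sum, ← Finset.mul_sum] at hs
  rw [div_mul_eq_mul_div, div_le_iff₀ hn']
  refine hs.trans (le_of_eq ?_)
  field_simp

theorem bivariateBound_le {δ : ℝ} (hδ1 : δ < 1) {w u : ℝ} (hw : 0 ≤ w) (hwδ : w ≤ δ) :
    bivariateBound w u ≤ (2 * π)⁻¹ * (√(1 - δ ^ 2))⁻¹ * rexp (-u ^ 2 / (1 + w)) := by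
  unfold bivariateBound
  have h : w ^ 2 ≤ δ ^ 2 := pow_le_pow_left₀ hw hwδ 2
  have h1 : 0 < 1 - δ ^ 2 := by nlinarith
  gcongr

theorem tendsto_sum_abs_sub_mul_bivariateBound {r : ℕ → ℝ} {γ δ : ℝ} (hγ : 0 ≤ γ)
    (hr : Tendsto (fun n : ℕ => r n * Real.log n) atTop (nhds γ)) (hδ0 : 0 < δ) (hδ1 : δ < 1)
    (hδ : ∀ k, 1 ≤ k → |r k| ≤ δ) (x : ℝ) :
    Tendsto (fun n : ℕ => (n : ℝ) * ∑ k ∈ Finset.Ico 1 n, |r k - γ / Real.log n| *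
      bivariateBound (max |r k| (γ / Real.log n)) (un n x)) atTop (nhds 0) := by
  obtain ⟨κ, hκ0, hκ⟩ : ∃ κ : ℝ, 0 < κ ∧ (1 + κ) * (1 + δ) = 2 :=
    ⟨(1 - δ) / (1 + δ), by apply div_pos <;> linarith, by field_simp; ring⟩
  have hκ1 : κ ≤ 1 := by nlinarith
  set α := κ / 4 with hα
  have hα0 : 0 < α := by positivity
  obtain ⟨M, hM0, hM⟩ : ∃ M : ℝ, γ ≤ M ∧ ∀ k : ℕ, |r k * Real.log k| ≤ M := by
    obtain ⟨M, hM⟩ := hr.abs.bddAbove_range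
    refine ⟨max γ M, le_max_left _ _, fun k => (hM ⟨k, rfl⟩).trans (le_max_right _ _)⟩
  obtain ⟨C, hC0, hC⟩ := exp_neg_un_sq_le x
  set K := (2 * π)⁻¹ * (√(1 - δ ^ 2))⁻¹ with hK
  have hK0 : 0 ≤ K := by positivity
  have hlim1 : Tendsto (fun n : ℕ => K * 2 * rexp (-(α * Real.log n))) atTop (nhds 0) := by
    have h := (tendsto_log_natCast_atTop.const_mul_atTop hα0)
    simpa using (Real.tendsto_exp_neg_atTop_nhds_zero.comp h).const_mul (K * 2)
  have hlim2 := (tendsto_log_div_mul_sum_abs_sub hγ hr hα0).const_mul (K * C * rexp (4 * M / α))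
  have hlim := hlim1.add hlim2
  rw [mul_zero, add_zero] at hlim
  have hρ : Tendsto (fun n : ℕ => γ / Real.log n) atTop (nhds 0) :=
    tendsto_const_nhds.div_atTop tendsto_log_natCast_atTop
  refine squeeze_zero' (Eventually.of_forall fun n => mul_nonneg (Nat.cast_nonneg n)
    (Finset.sum_nonneg fun k _ => mul_nonneg (abs_nonneg _) (bivariateBound_nonneg _ _))) ?_ hlim
  filter_upwards [hC, eventually_log_natCast_pos, eventually_gt_atTop 0,
    hρ.eventually_le_const hδ0,
    (tendsto_un_sq_div_log x).eventually_const_le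
      (show (1 + κ / 2) / (1 + κ) < 1 by rw [div_lt_one (by positivity)]; linarith),
    (tendsto_un_sq_div_log x).eventually_le_const (show (1 : ℝ) < 2 by norm_num)]
    with n hCn hL hn hρδ hlow hup
  have hn' : (0 : ℝ) < n := by exact_mod_cast hn
  set L := Real.log n with hLdef
  set u := un n x
  have hlow' : (1 + κ / 2) * L ≤ u ^ 2 / (1 + δ) := by
    rw [le_div_iff₀ (by positivity)]
    rw [div_le_div_iff₀ (by positivity) (by positivity)] at hlow
    have h1δ : (0 : ℝ) < 1 + δ := by positivity
    nlinarith
  have hup' : u ^ 2 ≤ 4 * L := by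
    rw [div_le_iff₀ (by positivity)] at hup
    linarith
  have hρ0 : 0 ≤ γ / L := by positivity
  have hpt1 : ∀ k ∈ (Finset.Ico 1 n).filter (fun k : ℕ => Real.log k ≤ α * L),
      |r k - γ / L| * bivariateBound (max |r k| (γ / L)) u ≤
        2 * (K * rexp (-((1 + κ / 2) * L))) := by
    intro k hk
    obtain ⟨hk1, hk2⟩ := Finset.mem_filter.1 hk
    have hrk := hδ k (Finset.mem_Ico.1 hk1).1
    have hw0 : 0 ≤ max |r k| (γ / L) := (abs_nonneg _).trans (le_max_left _ _)
    have hwδ : max |r k| (γ / L) ≤ δ := max_le hrk hρδ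
    have hA : |r k - γ / L| ≤ 2 := by
      rw [abs_le] at hrk ⊢
      constructor <;> linarith [hrk.1, hrk.2]
    refine mul_le_mul hA ((bivariateBound_le hδ1 hw0 hwδ).trans ?_) (bivariateBound_nonneg _ _)
      zero_le_two
    refine mul_le_mul_of_nonneg_left (Real.exp_le_exp.2 ?_) hK0
    rw [neg_div]
    refine neg_le_neg (hlow'.trans ?_)
    gcongr
  have hpt2 : ∀ k ∈ (Finset.Ico 1 n).filter (fun k : ℕ => ¬ Real.log k ≤ α * L),
      |r k - γ / L| * bivariateBound (max |r k| (γ / L)) u ≤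
        |r k - γ / L| * (K * (C * L / (n : ℝ) ^ 2 * rexp (4 * M / α))) := by
    intro k hk
    obtain ⟨hk1, hk2⟩ := Finset.mem_filter.1 hk
    have hrk := hδ k (Finset.mem_Ico.1 hk1).1
    have hw0 : 0 ≤ max |r k| (γ / L) := (abs_nonneg _).trans (le_max_left _ _)
    have hwδ : max |r k| (γ / L) ≤ δ := max_le hrk hρδ
    have hαL : 0 < α * L := by positivity
    have hl : 0 < Real.log k := hαL.trans (not_le.1 hk2)
    have hMk := hM k
    rw [abs_mul, abs_of_pos hl, ← le_div_iff₀ hl] at hMk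
    have hMn : 0 ≤ M := hγ.trans hM0
    have hwM : max |r k| (γ / L) ≤ M / (α * L) := by
      refine max_le (hMk.trans ?_) ?_
      · exact div_le_div_of_nonneg_left hMn hαL (not_le.1 hk2).le
      · have : α * L ≤ L := by rw [hα]; nlinarith
        gcongr
    set w := max |r k| (γ / L)
    refine mul_le_mul_of_nonneg_left ((bivariateBound_le hδ1 hw0 hwδ).trans
      (mul_le_mul_of_nonneg_left ?_ hK0)) (abs_nonneg _)
    refine le_trans ?_ (mul_le_mul_of_nonneg_right hCn (Real.exp_pos _).le)
    rw [← Real.exp_add]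
    refine Real.exp_le_exp.2 ?_
    have h1 : u ^ 2 * w ≤ 4 * M / α := by
      calc u ^ 2 * w ≤ 4 * L * (M / (α * L)) := by gcongr
        _ = 4 * M / α := by field_simp
    have h2 : -u ^ 2 / (1 + w) ≤ -u ^ 2 + u ^ 2 * w := by
      rw [div_le_iff₀ (by positivity)]
      nlinarith [mul_nonneg (sq_nonneg u) (sq_nonneg w)]
    linarith
  rw [← Finset.sum_filter_add_sum_filter_not _ (fun k : ℕ => Real.log k ≤ α * L), mul_add]
  refine add_le_add ?_ ?_
  · have h := Finset.sum_le_card_nsmul _ _ _ hpt1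
    rw [nsmul_eq_mul] at h
    refine (mul_le_mul_of_nonneg_left (h.trans (mul_le_mul_of_nonneg_right
      (card_filter_log_le n (α * L)) (by positivity))) hn'.le).trans (le_of_eq ?_)
    have hnL : (n : ℝ) = rexp L := (Real.exp_log hn').symm
    calc (n : ℝ) * (rexp (α * L) * (2 * (K * rexp (-((1 + κ / 2) * L)))))
        = K * 2 * (rexp L * rexp (α * L) * rexp (-((1 + κ / 2) * L))) := by rw [hnL]; ring
      _ = K * 2 * rexp (-(α * L)) := by
          rw [← Real.exp_add, ← Real.exp_add]
          congr 2
          rw [hα]; ring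
  · refine (mul_le_mul_of_nonneg_left (Finset.sum_le_sum hpt2) hn'.le).trans (le_of_eq ?_)
    rw [← Finset.sum_mul]
    simp only [not_le]
    field_simp

section EquicorrelatedSequence

theorem map_comp_fst_prod {α β E : Type*} [MeasurableSpace α] [MeasurableSpace β]
    [MeasurableSpace E] (μ : Measure α) (ν : Measure β) [IsProbabilityMeasure ν]
    {f : α → E} (hf : Measurable f) : (μ.prod ν).map (fun q => f q.1) = μ.map f := by
  conv_rhs => rw [← (measurePreserving_fst (μ := μ) (ν := ν)).map_eq]
  rw [Measure.map_map hf measurable_fst]; rfl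

theorem map_comp_snd_prod {α β E : Type*} [MeasurableSpace α] [MeasurableSpace β]
    [MeasurableSpace E] (μ : Measure α) (ν : Measure β) [SFinite ν] [IsProbabilityMeasure μ]
    {f : β → E} (hf : Measurable f) : (μ.prod ν).map (fun q => f q.2) = ν.map f := by
  conv_rhs => rw [← (measurePreserving_snd (μ := μ) (ν := ν)).map_eq]
  rw [Measure.map_map hf measurable_snd]; rfl

variable {ι : Type*}

/-- Standard Gaussian variables with common correlation `ρ`, driven by a common factor. -/
noncomputable def equicorrelated (ρ : ℝ) (i : ι) (p : ℝ × (ι → ℝ)) : ℝ :=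
  √(1 - ρ) * p.2 i + √ρ * p.1

theorem measurable_equicorrelated (ρ : ℝ) (i : ι) : Measurable (equicorrelated ρ i) := by
  unfold equicorrelated; fun_prop

variable [Fintype ι]

/-- The law of a standard Gaussian common factor together with independent standard Gaussian
variables indexed by `ι`. -/
noncomputable def factorMeasure (ι : Type*) [Fintype ι] : Measure (ℝ × (ι → ℝ)) :=
  (gaussianReal 0 1).prod (Measure.pi fun _ => gaussianReal 0 1)

instance : IsProbabilityMeasure (factorMeasure ι) := by
  unfold factorMeasure; infer_instance

theorem isGaussian_factorMeasure : IsGaussian (factorMeasure ι) := by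
  have h1 : ∀ i : ι, HasGaussianLaw (fun p : ι → ℝ => p i)
      (Measure.pi fun _ : ι => gaussianReal 0 1) := fun i =>
    ⟨by rw [(measurePreserving_eval _ i).map_eq]; infer_instance⟩
  have h2 := (iIndepFun.hasGaussianLaw h1
    (iIndepFun_pi (X := fun _ => id) fun _ => aemeasurable_id)).isGaussian_map
  have h3 : IsGaussian (Measure.pi fun _ : ι => gaussianReal 0 1) := by
    have e : (fun ω : ι → ℝ => fun i => ω i) = id := rfl
    rwa [e, Measure.map_id] at h2
  unfold factorMeasure
  infer_instance

theorem hasGaussianLaw_equicorrelated (ρ : ℝ) :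
    HasGaussianLaw (fun p (i : ι) => equicorrelated ρ i p) (factorMeasure ι) := by
  have := isGaussian_factorMeasure (ι := ι)
  let L : ℝ × (ι → ℝ) →L[ℝ] (ι → ℝ) := ContinuousLinearMap.pi fun i =>
    √(1 - ρ) • ((ContinuousLinearMap.proj i).comp (ContinuousLinearMap.snd ℝ ℝ (ι → ℝ))) +
      √ρ • ContinuousLinearMap.fst ℝ ℝ (ι → ℝ)
  exact (IsGaussian.hasGaussianLaw_id (μ := factorMeasure ι)).map L

theorem map_fst_factorMeasure : (factorMeasure ι).map Prod.fst = gaussianReal 0 1 :=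
  measurePreserving_fst.map_eq

theorem map_snd_eval_factorMeasure (i : ι) :
    (factorMeasure ι).map (fun p => p.2 i) = gaussianReal 0 1 :=
  ((measurePreserving_eval (fun _ : ι => gaussianReal 0 1) i).comp
    (measurePreserving_snd (μ := gaussianReal 0 1))).map_eq

theorem indepFun_snd_eval_factorMeasure {i j : ι} (hij : i ≠ j) :
    IndepFun (fun p : ℝ × (ι → ℝ) => p.2 i) (fun p => p.2 j) (factorMeasure ι) := by
  have h := (iIndepFun_pi (μ := fun _ : ι => gaussianReal 0 1) (X := fun _ => id)
    fun _ => aemeasurable_id).indepFun hij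
  rw [indepFun_iff_measure_inter_preimage_eq_mul] at h ⊢
  have hpre : ∀ A : Set (ι → ℝ), MeasurableSet A → factorMeasure ι (Prod.snd ⁻¹' A) =
      Measure.pi (fun _ => gaussianReal 0 1) A := fun A hA =>
    (measurePreserving_snd (μ := gaussianReal 0 1)
      (ν := Measure.pi fun _ : ι => gaussianReal 0 1)).measure_preimage hA.nullMeasurableSet
  intro s t hs ht
  have hi : MeasurableSet ((fun a : ι → ℝ => a i) ⁻¹' s) := measurable_pi_apply i hs
  have hj : MeasurableSet ((fun a : ι → ℝ => a j) ⁻¹' t) := measurable_pi_apply j ht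
  have := h s t hs ht
  simp only [id] at this
  rw [← hpre _ (hi.inter hj), ← hpre _ hi, ← hpre _ hj] at this
  exact this

theorem covariance_equicorrelated {ρ : ℝ} (hρ0 : 0 ≤ ρ) (hρ1 : ρ ≤ 1) (i j : ι) :
    cov[equicorrelated ρ i, equicorrelated ρ j; factorMeasure ι] = if i = j then 1 else ρ := by
  have hm : ∀ i : ι, Measurable fun p : ℝ × (ι → ℝ) => p.2 i := fun i => by fun_prop
  have h2 := fun i : ι => memLp_two_of_map_eq_gaussianReal (hm i) (map_snd_eval_factorMeasure i)
  have h1 := memLp_two_of_map_eq_gaussianReal measurable_fst (map_fst_factorMeasure (ι := ι))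
  have hz : cov[Prod.fst, Prod.fst; factorMeasure ι] = 1 := by
    simpa using covariance_self_of_map_eq_gaussianReal measurable_fst
      (map_fst_factorMeasure (ι := ι))
  have hza : ∀ i : ι, cov[Prod.fst, fun p : ℝ × (ι → ℝ) => p.2 i; factorMeasure ι] = 0 := fun i =>
    (indepFun_prod (X := id) (Y := fun a : ι → ℝ => a i) measurable_id
      (measurable_pi_apply i)).covariance_eq_zero h1 (h2 i)
  have haz : ∀ i : ι, cov[fun p : ℝ × (ι → ℝ) => p.2 i, Prod.fst; factorMeasure ι] = 0 :=
      fun i => by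
    rw [covariance_comm, hza]
  have haa : cov[fun p : ℝ × (ι → ℝ) => p.2 i, fun p => p.2 j; factorMeasure ι] =
      if i = j then 1 else 0 := by
    split_ifs with hij
    · subst hij
      simpa using covariance_self_of_map_eq_gaussianReal (hm i) (map_snd_eval_factorMeasure i)
    · exact (indepFun_snd_eval_factorMeasure hij).covariance_eq_zero (h2 i) (h2 j)
  have key : cov[(fun p => √(1 - ρ) * p.2 i) + fun p => √ρ * p.1,
      (fun p => √(1 - ρ) * p.2 j) + fun p => √ρ * p.1; factorMeasure ι] =
      if i = j then 1 else ρ := by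
    rw [covariance_add_left ((h2 i).const_mul _) (h1.const_mul _)
        (((h2 j).const_mul _).add (h1.const_mul _)),
      covariance_add_right ((h2 i).const_mul _) ((h2 j).const_mul _) (h1.const_mul _),
      covariance_add_right (h1.const_mul _) ((h2 j).const_mul _) (h1.const_mul _)]
    simp only [covariance_const_mul_left, covariance_const_mul_right]
    rw [haa, hza, haz, hz]
    have e1 := Real.mul_self_sqrt hρ0
    have e2 := Real.mul_self_sqrt (sub_nonneg.2 hρ1)
    split_ifs
    · linear_combination e1 + e2
    · linear_combination e1
  exact key

theorem map_equicorrelated {ρ : ℝ} (hρ0 : 0 ≤ ρ) (hρ1 : ρ ≤ 1) (i : ι) :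
    (factorMeasure ι).map (equicorrelated ρ i) = gaussianReal 0 1 := by
  have h := ((hasGaussianLaw_equicorrelated (ι := ι) ρ).eval i).map_eq_gaussianReal
  have hm : ∀ i : ι, Measurable fun p : ℝ × (ι → ℝ) => p.2 i := fun i => by fun_prop
  have h2 := fun i : ι => memLp_two_of_map_eq_gaussianReal (hm i) (map_snd_eval_factorMeasure i)
  have h1 := memLp_two_of_map_eq_gaussianReal measurable_fst (map_fst_factorMeasure (ι := ι))
  have hmean : ∫ p, equicorrelated ρ i p ∂(factorMeasure ι) = 0 := by
    unfold equicorrelated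
    rw [integral_add (((h2 i).const_mul _).integrable one_le_two)
      ((h1.const_mul _).integrable one_le_two), integral_const_mul, integral_const_mul,
      integral_eq_zero_of_map_eq_gaussianReal (hm i) (map_snd_eval_factorMeasure i),
      integral_eq_zero_of_map_eq_gaussianReal measurable_fst (map_fst_factorMeasure (ι := ι))]
    simp
  have hvar : Var[equicorrelated ρ i; factorMeasure ι] = 1 := by
    rw [← covariance_self (measurable_equicorrelated ρ i).aemeasurable,
      covariance_equicorrelated hρ0 hρ1, if_pos rfl]
  change (factorMeasure ι).map (equicorrelated ρ i) = _ at h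
  rw [h]
  change gaussianReal (∫ p, equicorrelated ρ i p ∂(factorMeasure ι))
    (Var[equicorrelated ρ i; factorMeasure ι]).toNNReal = _
  rw [hmean, hvar, Real.toNNReal_one]

theorem integral_prod_equicorrelated (ρ : ℝ) {φ : ι → ℝ → ℝ} (hφ : ∀ i, Measurable (φ i))
    (hφ1 : ∀ i x, |φ i x| ≤ 1) :
    ∫ p, ∏ i, φ i (equicorrelated ρ i p) ∂(factorMeasure ι) =
      ∫ z, ∏ i, ∫ a, φ i (√(1 - ρ) * a + √ρ * z) ∂(gaussianReal 0 1) ∂(gaussianReal 0 1) := by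
  have hm : Measurable fun p => ∏ i, φ i (equicorrelated ρ i p) :=
    Finset.measurable_prod _ fun i _ => (hφ i).comp (measurable_equicorrelated ρ i)
  have hi : Integrable (fun p => ∏ i, φ i (equicorrelated ρ i p)) (factorMeasure ι) :=
    Integrable.of_bound hm.aestronglyMeasurable 1 (Eventually.of_forall fun p => by
      rw [Real.norm_eq_abs]; exact abs_prod_le_one _ _ fun i => hφ1 i _)
  unfold factorMeasure at hi ⊢
  rw [integral_prod _ hi]
  refine integral_congr_ae (Eventually.of_forall fun z => ?_)
  exact integral_fintype_prod_eq_prod (fun i a => φ i (√(1 - ρ) * a + √ρ * z))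

theorem abs_integral_prod_levelWeight_sub_integral_le {Ω : Type*} [MeasurableSpace Ω]
    {P : Measure Ω} [IsProbabilityMeasure P]
    {X : ι → Ω → ℝ} (hXm : ∀ i, Measurable (X i)) (hG : HasGaussianLaw (fun ω i => X i ω) P)
    (hX : ∀ i, P.map (X i) = gaussianReal 0 1) {ρ : ℝ} (hρ0 : 0 ≤ ρ) (hρ1 : ρ ≤ 1)
    {u₁ u₂ : ℝ} (hu0 : 0 ≤ u₁) (hu : u₁ ≤ u₂)
    {s t : ι → ℝ} (hs : ∀ i, s i ∈ Set.Icc (0 : ℝ) 1) (ht : ∀ i, t i ∈ Set.Icc (0 : ℝ) 1)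
    {w : ι → ι → ℝ} (hw : ∀ i j, w i j < 1)
    (hwX : ∀ i j, i ≠ j → |cov[X i, X j; P]| ≤ w i j) (hwρ : ∀ i j, i ≠ j → ρ ≤ w i j) :
    |∫ ω, ∏ i, levelWeight u₁ u₂ (s i) (t i) (X i ω) ∂P -
      ∫ z, ∏ i, ∫ a, levelWeight u₁ u₂ (s i) (t i) (√(1 - ρ) * a + √ρ * z)
        ∂(gaussianReal 0 1) ∂(gaussianReal 0 1)| ≤
      (∑ i, ∑ j, (if i = j then 0 else |cov[X i, X j; P] - ρ|) *
        (2 ^ 2 * bivariateBound (w i j) u₁)) * (π / 2) := by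
  set Q := P.prod (factorMeasure ι) with hQ
  have hfst : Q.map Prod.fst = P := measurePreserving_fst.map_eq
  have hsnd : Q.map Prod.snd = factorMeasure ι := measurePreserving_snd.map_eq
  have hYm := measurable_equicorrelated (ι := ι) ρ
  have hXG : HasGaussianLaw (fun q : Ω × (ℝ × (ι → ℝ)) => fun i => X i q.1) Q :=
    ⟨by rw [map_comp_fst_prod _ _ (f := fun ω i => X i ω) (measurable_pi_lambda _ hXm)]
        exact hG.isGaussian_map⟩
  have hYG : HasGaussianLaw (fun q : Ω × (ℝ × (ι → ℝ)) => fun i => equicorrelated ρ i q.2) Q :=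
    ⟨by rw [map_comp_snd_prod _ _ (f := fun p i => equicorrelated ρ i p)
          (measurable_pi_lambda _ hYm)]
        exact (hasGaussianLaw_equicorrelated ρ).isGaussian_map⟩
  have hind : IndepFun (fun q : Ω × (ℝ × (ι → ℝ)) => fun i => X i q.1)
      (fun q => fun i => equicorrelated ρ i q.2) Q :=
    indepFun_prod (X := fun ω i => X i ω) (Y := fun p i => equicorrelated ρ i p)
      (measurable_pi_lambda _ hXm) (measurable_pi_lambda _ hYm)
  have hXY : ∀ i j, cov[fun q => X i q.1, fun q => equicorrelated ρ j q.2; Q] = 0 := fun i j =>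
    (indepFun_prod (X := X i) (Y := equicorrelated ρ j) (hXm i) (hYm j)).covariance_eq_zero
      (hXG.eval i).memLp_two (hYG.eval j).memLp_two
  have hcX : ∀ i j, cov[fun q => X i q.1, fun q => X j q.1; Q] = cov[X i, X j; P] := fun i j => by
    conv_rhs => rw [← hfst]
    rw [covariance_map_fun (hXm i).aestronglyMeasurable (hXm j).aestronglyMeasurable
      measurable_fst.aemeasurable]
  have hcY : ∀ i j, cov[fun q => equicorrelated ρ i q.2, fun q => equicorrelated ρ j q.2; Q] =
      if i = j then 1 else ρ := fun i j => by
    rw [← covariance_equicorrelated hρ0 hρ1, ← hsnd,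
      covariance_map_fun (hYm i).aestronglyMeasurable (hYm j).aestronglyMeasurable
        measurable_snd.aemeasurable]
  have key := abs_integral_prod_levelWeight_sub_le (P := Q) (X := fun i q => X i q.1)
    (Y := fun i q => equicorrelated ρ i q.2) (fun i => (hXm i).comp measurable_fst)
    (fun i => (hYm i).comp measurable_snd) (IndepFun.hasGaussianLaw hXG hYG hind)
    (fun i => (map_comp_fst_prod _ _ (hXm i)).trans (hX i))
    (fun i => (map_comp_snd_prod _ _ (hYm i)).trans (map_equicorrelated hρ0 hρ1 i))
    hXY hu0 hu hs ht hw
    (fun i j hij => (congrArg abs (hcX i j)).trans_le (hwX i j hij))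
    (fun i j hij => by
      rw [hcY, if_neg hij, abs_of_nonneg hρ0]; exact hwρ i j hij)
  have hmeasL := fun i : ι => measurable_levelWeight u₁ u₂ (s i) (t i)
  have e1 : ∫ q, ∏ i, levelWeight u₁ u₂ (s i) (t i) (X i q.1) ∂Q =
      ∫ ω, ∏ i, levelWeight u₁ u₂ (s i) (t i) (X i ω) ∂P := by
    conv_rhs => rw [← hfst]
    have hm : Measurable fun ω => ∏ i, levelWeight u₁ u₂ (s i) (t i) (X i ω) :=
      Finset.measurable_prod _ fun i _ => (hmeasL i).comp (hXm i)
    rw [integral_map measurable_fst.aemeasurable hm.aestronglyMeasurable]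
  have e2 : ∫ q, ∏ i, levelWeight u₁ u₂ (s i) (t i) (equicorrelated ρ i q.2) ∂Q =
      ∫ z, ∏ i, ∫ a, levelWeight u₁ u₂ (s i) (t i) (√(1 - ρ) * a + √ρ * z)
        ∂(gaussianReal 0 1) ∂(gaussianReal 0 1) := by
    have hm : Measurable fun p => ∏ i, levelWeight u₁ u₂ (s i) (t i) (equicorrelated ρ i p) :=
      Finset.measurable_prod _ fun i _ => (hmeasL i).comp (hYm i)
    rw [← integral_prod_equicorrelated ρ hmeasL fun i x =>
        abs_levelWeight_le_one (hs i) (ht i) _ _ x,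
      ← hsnd, integral_map measurable_snd.aemeasurable hm.aestronglyMeasurable]
  rw [e1, e2] at key
  refine key.trans (le_of_eq ?_)
  congr 1
  refine Finset.sum_congr rfl fun i _ => Finset.sum_congr rfl fun j _ => ?_
  rw [hcX, hcY]
  split_ifs with hij
  · subst hij
    have := covariance_self_of_map_eq_gaussianReal (hXm i) (hX i)
    simp [this]
  · rfl

end EquicorrelatedSequence

theorem sum_comp_le_sum_of_injOn {α β : Type*} {s : Finset α} {t : Finset β} {φ : α → β}
    (hφ : Set.InjOn φ s) (hst : ∀ a ∈ s, φ a ∈ t) {F : β → ℝ} (hF : ∀ b, 0 ≤ F b) :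
    ∑ a ∈ s, F (φ a) ≤ ∑ b ∈ t, F b := by
  rw [← Finset.sum_image (f := F) hφ]
  exact Finset.sum_le_sum_of_subset_of_nonneg (Finset.image_subset_iff.2 hst) fun b _ _ => hF b

theorem sum_sum_dist_le {F : ℕ → ℝ} (hF : ∀ k, 0 ≤ F k) (n : ℕ) :
    ∑ i ∈ Finset.Icc 1 n, ∑ j ∈ Finset.Icc 1 n, (if i = j then 0 else F (Nat.dist i j)) ≤
      2 * (n * ∑ k ∈ Finset.Ico 1 n, F k) := by
  have hi : ∀ i ∈ Finset.Icc 1 n,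
      ∑ j ∈ Finset.Icc 1 n, (if i = j then 0 else F (Nat.dist i j)) ≤
        2 * ∑ k ∈ Finset.Ico 1 n, F k := by
    intro i hi
    obtain ⟨hi1, hi2⟩ := Finset.mem_Icc.1 hi
    have hsplit : ∀ j, (if i = j then 0 else F (Nat.dist i j)) =
        (if j < i then F (i - j) else 0) + (if i < j then F (j - i) else 0) := fun j => by
      rcases lt_trichotomy i j with h | h | h
      · simp [h.ne, h, h.not_gt, Nat.dist_eq_sub_of_le h.le]
      · simp [h]
      · simp [h.ne', h, h.not_gt, Nat.dist_eq_sub_of_le_right h.le]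
    simp_rw [hsplit]
    rw [Finset.sum_add_distrib, ← Finset.sum_filter, ← Finset.sum_filter, two_mul]
    refine add_le_add (sum_comp_le_sum_of_injOn (φ := fun j => i - j) ?_ ?_ hF)
      (sum_comp_le_sum_of_injOn (φ := fun j => j - i) ?_ ?_ hF)
    · intro a ha b hb hab
      simp only [Finset.coe_filter, Finset.mem_Icc, Set.mem_ofPred_eq] at ha hb hab
      omega
    · intro a ha
      simp only [Finset.mem_filter, Finset.mem_Icc, Finset.mem_Ico] at ha ⊢
      omega
    · intro a ha b hb hab
      simp only [Finset.coe_filter, Finset.mem_Icc, Set.mem_ofPred_eq] at ha hb hab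
      omega
    · intro a ha
      simp only [Finset.mem_filter, Finset.mem_Icc, Finset.mem_Ico] at ha ⊢
      omega
  refine (Finset.sum_le_card_nsmul _ _ _ hi).trans (le_of_eq ?_)
  rw [Nat.card_Icc, nsmul_eq_mul, Nat.add_sub_cancel]
  ring

/-- Uniformly over the weights, the stationary Gaussian sequence may be replaced in expectations
of products by a conditionally independent sequence with common correlation `γ / log n`. -/
theorem exists_tendsto_zero_abs_integral_prod_levelWeight_le
    {Ω : Type*} [MeasurableSpace Ω] {P : Measure Ω} [IsProbabilityMeasure P]
    {X : ℕ → Ω → ℝ} {γ : ℝ} (hγ : 0 ≤ γ) (hXmeas : ∀ n, Measurable (X n))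
    (hGauss : ∀ (m : ℕ) (idx : Fin m → ℕ) (c : Fin m → ℝ), ∃ v : ℝ≥0,
      P.map (fun ω => ∑ i, c i * X (idx i) ω) = gaussianReal 0 v)
    (hstd : ∀ n, P.map (X n) = gaussianReal 0 1)
    (hstat : ∀ (m k : ℕ), P.map (fun ω => fun i : Fin m => X (i.1 + 1 + k) ω) =
      P.map (fun ω => fun i : Fin m => X (i.1 + 1) ω))
    (hr : Tendsto (fun n : ℕ => (∫ ω, X 1 ω * X (n + 1) ω ∂P) * Real.log n)
      atTop (nhds γ)) {x y : ℝ} (hxy : x ≤ y) :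
    ∃ Δ : ℕ → ℝ, Tendsto Δ atTop (nhds 0) ∧ ∀ᶠ n : ℕ in atTop, ∀ s t : ℕ → ℝ,
      (∀ j, s j ∈ Set.Icc (0 : ℝ) 1) → (∀ j, t j ∈ Set.Icc (0 : ℝ) 1) →
      |∫ ω, ∏ j ∈ Finset.Icc 1 n, levelWeight (un n x) (un n y) (s j) (t j) (X j ω) ∂P -
        ∫ z, ∏ j ∈ Finset.Icc 1 n, ∫ a, levelWeight (un n x) (un n y) (s j) (t j)
          (√(1 - γ / Real.log n) * a + √(γ / Real.log n) * z)
          ∂(gaussianReal 0 1) ∂(gaussianReal 0 1)| ≤ Δ n := by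
  set r : ℕ → ℝ := fun k => ∫ ω, X 1 ω * X (k + 1) ω ∂P with hrdef
  have hr0 := tendsto_zero_of_tendsto_mul_log hr
  obtain ⟨δ, hδ0, hδ1, hδ⟩ := exists_lt_one_forall_abs_le hr0 fun k hk =>
    abs_integral_mul_lt_one_of_stationary hXmeas hstd hstat hr0 hk
  have hlim := (tendsto_sum_abs_sub_mul_bivariateBound hγ hr hδ0 hδ1 hδ x).const_mul
    (2 * 4 * (π / 2))
  rw [mul_zero] at hlim
  refine ⟨_, hlim, ?_⟩
  have hρ : Tendsto (fun n : ℕ => γ / Real.log n) atTop (nhds 0) :=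
    tendsto_const_nhds.div_atTop tendsto_log_natCast_atTop
  filter_upwards [eventually_log_natCast_pos, hρ.eventually_le_const hδ0, eventually_un_pos x]
    with n hL hρδ hu s t hs ht
  set ρ := γ / Real.log n
  have hρ0 : 0 ≤ ρ := by positivity
  have hcov : ∀ i j : Finset.Icc 1 n, cov[X i, X j; P] = r (Nat.dist i j) := fun i j =>
    covariance_eq_of_stationary hXmeas hstd hstat (Finset.mem_Icc.1 i.2).1 (Finset.mem_Icc.1 j.2).1
  have hdist : ∀ i j : Finset.Icc 1 n, i ≠ j → 1 ≤ Nat.dist i j := fun i j hij =>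
    Nat.dist_pos_of_ne fun h => hij (Subtype.ext h)
  have hGL : HasGaussianLaw (fun ω (i : Finset.Icc 1 n) => X i ω) P := by
    refine hasGaussianLaw_of_forall_sum (fun i => hXmeas i) fun c => ?_
    let e := Fintype.equivFin (Finset.Icc 1 n)
    obtain ⟨v, hv⟩ := hGauss _ (fun i => (e.symm i : ℕ)) (fun i => c (e.symm i))
    refine ⟨v, hv ▸ ?_⟩
    congr 1
    ext ω
    exact (e.symm.sum_comp fun i => c i * X i ω).symm
  have key := abs_integral_prod_levelWeight_sub_integral_le (ι := Finset.Icc 1 n)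
    (X := fun i => X i) (fun i => hXmeas i) hGL (fun i => hstd i) hρ0 (hρδ.trans hδ1.le) hu.le
    (un_mono n hxy) (s := fun i => s i) (t := fun i => t i) (fun i => hs i) (fun i => ht i)
    (w := fun i j => if i = j then 0 else max |r (Nat.dist i j)| ρ)
    (fun i j => by
      split_ifs with h
      · exact zero_lt_one
      · exact max_lt ((hδ _ (hdist i j h)).trans_lt hδ1) (hρδ.trans_lt hδ1))
    (fun i j hij => by
      rw [if_neg hij, hcov]; exact le_max_left _ _)
    (fun i j hij => by
      rw [if_neg hij]; exact le_max_right _ _)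
  have e1 : ∀ f : ℕ → ℝ, ∏ i : Finset.Icc 1 n, f i = ∏ j ∈ Finset.Icc 1 n, f j := fun f =>
    Finset.prod_coe_sort (Finset.Icc 1 n) f
  have e2 : ∀ f : ℕ → ℝ, ∑ i : Finset.Icc 1 n, f i = ∑ j ∈ Finset.Icc 1 n, f j := fun f =>
    Finset.sum_coe_sort (Finset.Icc 1 n) f
  set F : ℕ → ℝ := fun k => |r k - ρ| * (2 ^ 2 * bivariateBound (max |r k| ρ) (un n x)) with hF
  have hF0 : ∀ k, 0 ≤ F k := fun k =>
    mul_nonneg (abs_nonneg _) (mul_nonneg (by norm_num) (bivariateBound_nonneg _ _))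
  have e4 : ∑ i : Finset.Icc 1 n, ∑ j : Finset.Icc 1 n,
      (if (i : ℕ) = j then 0 else F (Nat.dist i j)) =
      ∑ i ∈ Finset.Icc 1 n, ∑ j ∈ Finset.Icc 1 n, (if i = j then 0 else F (Nat.dist i j)) := by
    rw [← e2 fun i => ∑ j ∈ Finset.Icc 1 n, (if i = j then 0 else F (Nat.dist i j))]
    exact Finset.sum_congr rfl fun i _ => e2 fun j => if (i : ℕ) = j then 0 else F (Nat.dist i j)
  have e5 : ∀ ω, ∏ i : Finset.Icc 1 n, levelWeight (un n x) (un n y) (s i) (t i) (X i ω) =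
      ∏ j ∈ Finset.Icc 1 n, levelWeight (un n x) (un n y) (s j) (t j) (X j ω) := fun ω =>
    e1 fun j => levelWeight (un n x) (un n y) (s j) (t j) (X j ω)
  have e6 : ∀ z, ∏ i : Finset.Icc 1 n, ∫ a, levelWeight (un n x) (un n y) (s i) (t i)
        (√(1 - ρ) * a + √ρ * z) ∂(gaussianReal 0 1) =
      ∏ j ∈ Finset.Icc 1 n, ∫ a, levelWeight (un n x) (un n y) (s j) (t j)
        (√(1 - ρ) * a + √ρ * z) ∂(gaussianReal 0 1) := fun z =>
    e1 fun j => ∫ a, levelWeight (un n x) (un n y) (s j) (t j)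
        (√(1 - ρ) * a + √ρ * z) ∂(gaussianReal 0 1)
  simp_rw [e5, e6] at key
  refine key.trans (le_of_eq_of_le (b := (∑ i : Finset.Icc 1 n, ∑ j : Finset.Icc 1 n,
      (if (i : ℕ) = j then 0 else F (Nat.dist i j))) * (π / 2)) ?_ ?_)
  · congr 1
    refine Finset.sum_congr rfl fun i _ => Finset.sum_congr rfl fun j _ => ?_
    by_cases hij : i = j
    · simp [hij]
    · rw [if_neg hij, if_neg hij, if_neg fun h => hij (Subtype.ext h), hcov]
  rw [e4]
  refine ((mul_le_mul_of_nonneg_right (sum_sum_dist_le hF0 n) (by positivity)).trans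
    (le_of_eq ?_))
  have e7 : ∑ k ∈ Finset.Ico 1 n, F k =
      4 * ∑ k ∈ Finset.Ico 1 n, |r k - ρ| * bivariateBound (max |r k| ρ) (un n x) := by
    rw [Finset.mul_sum]
    refine Finset.sum_congr rfl fun k _ => ?_
    simp only [hF]
    ring
  rw [e7]
  ring

theorem gaussianReal_real_Ioi (v : ℝ) :
    (gaussianReal 0 1).real (Set.Ioi v) = ∫ t in Set.Ioi v, gaussianPDFReal 0 1 t := by
  rw [measureReal_def, gaussianReal_apply_eq_integral 0 one_ne_zero, ENNReal.toReal_ofReal]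
  exact integral_nonneg fun t => gaussianPDFReal_nonneg 0 1 t

theorem gaussianPDFReal_std_le_one (t : ℝ) : gaussianPDFReal 0 1 t ≤ 1 := by
  rw [gaussianPDFReal_def]
  have h1 : (√(2 * π * (1 : ℝ≥0)))⁻¹ ≤ 1 := by
    apply inv_le_one_of_one_le₀
    rw [Real.one_le_sqrt]
    simp only [NNReal.coe_one, mul_one]
    linarith [Real.pi_gt_three]
  have h2 : Real.exp (-(t - 0) ^ 2 / (2 * (1 : ℝ≥0))) ≤ 1 := by
    rw [Real.exp_le_one_iff]
    simp only [NNReal.coe_one, mul_one]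
    have := sq_nonneg (t - 0)
    linarith
  exact mul_le_one₀ h1 (Real.exp_pos _).le h2

theorem hasDerivAt_neg_gaussianPDFReal_std_div {t : ℝ} (ht : 0 < t) :
    HasDerivAt (fun t => -(gaussianPDFReal 0 1 t / t))
      (gaussianPDFReal 0 1 t * (1 + 1 / t ^ 2)) t := by
  have h := ((hasDerivAt_gaussianPDFReal_std t).div (hasDerivAt_id t) ht.ne').neg
  refine h.congr_deriv ?_
  simp only [id]
  field_simp
  ring

theorem tendsto_neg_gaussianPDFReal_std_div :
    Tendsto (fun t => -(gaussianPDFReal 0 1 t / t)) atTop (nhds 0) := by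
  suffices h : Tendsto (fun t => gaussianPDFReal 0 1 t / t) atTop (nhds 0) by simpa using h.neg
  refine squeeze_zero' ?_ ?_ tendsto_inv_atTop_zero
  · filter_upwards [eventually_gt_atTop 0] with t ht
    exact div_nonneg (gaussianPDFReal_nonneg 0 1 t) ht.le
  · filter_upwards [eventually_gt_atTop 0] with t ht
    rw [inv_eq_one_div]
    exact div_le_div_of_nonneg_right (gaussianPDFReal_std_le_one t) ht.le

theorem integral_Ioi_gaussianPDFReal_std_mul {v : ℝ} (hv : 0 < v) :
    IntegrableOn (fun t => gaussianPDFReal 0 1 t * (1 + 1 / t ^ 2)) (Set.Ioi v) ∧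
      ∫ t in Set.Ioi v, gaussianPDFReal 0 1 t * (1 + 1 / t ^ 2) = gaussianPDFReal 0 1 v / v := by
  have h1 : ∀ t ∈ Set.Ici v, HasDerivAt (fun t => -(gaussianPDFReal 0 1 t / t))
      (gaussianPDFReal 0 1 t * (1 + 1 / t ^ 2)) t := fun t ht =>
    hasDerivAt_neg_gaussianPDFReal_std_div (hv.trans_le ht)
  have h2 : ∀ t ∈ Set.Ioi v, 0 ≤ gaussianPDFReal 0 1 t * (1 + 1 / t ^ 2) := fun t _ =>
    mul_nonneg (gaussianPDFReal_nonneg 0 1 t) (by positivity)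
  refine ⟨integrableOn_Ioi_deriv_of_nonneg' h1 h2 tendsto_neg_gaussianPDFReal_std_div, ?_⟩
  rw [integral_Ioi_of_hasDerivAt_of_nonneg' h1 h2 tendsto_neg_gaussianPDFReal_std_div]
  ring

theorem gaussianReal_real_Ioi_le {v : ℝ} (hv : 0 < v) :
    (gaussianReal 0 1).real (Set.Ioi v) ≤ gaussianPDFReal 0 1 v / v := by
  obtain ⟨h1, h2⟩ := integral_Ioi_gaussianPDFReal_std_mul hv
  rw [gaussianReal_real_Ioi, ← h2]
  refine setIntegral_mono_on (integrable_gaussianPDFReal 0 1).integrableOn h1 measurableSet_Ioi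
    fun t _ => le_mul_of_one_le_right (gaussianPDFReal_nonneg 0 1 t) ?_
  have : 0 ≤ 1 / t ^ 2 := by positivity
  linarith

theorem le_gaussianReal_real_Ioi {v : ℝ} (hv : 0 < v) :
    gaussianPDFReal 0 1 v / v / (1 + 1 / v ^ 2) ≤ (gaussianReal 0 1).real (Set.Ioi v) := by
  obtain ⟨h1, h2⟩ := integral_Ioi_gaussianPDFReal_std_mul hv
  rw [div_le_iff₀ (by positivity), gaussianReal_real_Ioi, ← h2, ← integral_mul_const]
  refine setIntegral_mono_on h1 ((integrable_gaussianPDFReal 0 1).mul_const _).integrableOn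
    measurableSet_Ioi fun t ht => mul_le_mul_of_nonneg_left ?_ (gaussianPDFReal_nonneg 0 1 t)
  have : v < t := ht
  gcongr

theorem tendsto_natCast_mul_gaussianReal_real_Ioi {v : ℕ → ℝ} {A : ℝ}
    (h1 : Tendsto (fun n : ℕ => v n / √(2 * Real.log n)) atTop (nhds 1))
    (h2 : Tendsto (fun n : ℕ => v n ^ 2 / 2 - (Real.log n - Real.log (Real.log n) / 2))
      atTop (nhds A)) :
    Tendsto (fun n : ℕ => n * (gaussianReal 0 1).real (Set.Ioi (v n))) atTop
      (nhds (Real.exp (-A) / √(4 * π))) := by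
  have hL := eventually_log_natCast_pos
  have hsq : Tendsto (fun n : ℕ => √(2 * Real.log n)) atTop atTop :=
    Real.tendsto_sqrt_atTop.comp (tendsto_log_natCast_atTop.const_mul_atTop two_pos)
  have hv : Tendsto v atTop atTop := by
    refine (Tendsto.atTop_mul_pos one_pos hsq h1).congr' ?_
    filter_upwards [hL] with n hn
    have : √(2 * Real.log n) ≠ 0 := by positivity
    field_simp
  have hp : Tendsto (fun n : ℕ => n * (gaussianPDFReal 0 1 (v n) / v n)) atTop
      (nhds (Real.exp (-A) / √(4 * π))) := by
    have h3 : Tendsto (fun n : ℕ =>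
        Real.exp (-(v n ^ 2 / 2 - (Real.log n - Real.log (Real.log n) / 2))) / √(4 * π) *
          (v n / √(2 * Real.log n))⁻¹) atTop (nhds (Real.exp (-A) / √(4 * π) * 1⁻¹)) :=
      (((Real.continuous_exp.tendsto _).comp h2.neg).div_const _).mul (h1.inv₀ one_ne_zero)
    rw [inv_one, mul_one] at h3
    refine h3.congr' ?_
    filter_upwards [hL, hv.eventually_gt_atTop 0, eventually_gt_atTop 0] with n hn hvn hn0
    have hn0' : (0 : ℝ) < n := by exact_mod_cast hn0
    have e1 : Real.exp (-(v n ^ 2 / 2 - (Real.log n - Real.log (Real.log n) / 2))) =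
        Real.exp (-(v n ^ 2 / 2)) * n / √(Real.log n) := by
      rw [show -(v n ^ 2 / 2 - (Real.log n - Real.log (Real.log n) / 2)) =
        -(v n ^ 2 / 2) + Real.log n - Real.log (Real.log n) / 2 by ring, Real.exp_sub,
        Real.exp_add, Real.exp_log hn0', ← Real.log_sqrt hn.le, Real.exp_log (by positivity)]
    have e2 : √(2 * Real.log n) = √2 * √(Real.log n) := Real.sqrt_mul (by norm_num) _
    have e3 : √(4 * π) = √2 * √(2 * π) := by
      rw [← Real.sqrt_mul (by norm_num)]; congr 1; ring
    rw [e1, e2, e3, gaussianPDFReal_def]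
    simp only [NNReal.coe_one, mul_one, sub_zero]
    have hs2 : √2 ^ 2 = 2 := Real.sq_sqrt (by norm_num)
    have hsl : √(Real.log n) ≠ 0 := by positivity
    rw [neg_div]
    field_simp
  have hq : Tendsto (fun n : ℕ => n * (gaussianPDFReal 0 1 (v n) / v n) / (1 + 1 / v n ^ 2)) atTop
      (nhds (Real.exp (-A) / √(4 * π))) := by
    have h4 : Tendsto (fun n : ℕ => 1 + 1 / v n ^ 2) atTop (nhds (1 + 0)) := by
      refine tendsto_const_nhds.add ?_
      simp only [one_div]
      exact tendsto_inv_atTop_zero.comp ((tendsto_pow_atTop two_ne_zero).comp hv)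
    rw [add_zero] at h4
    rw [← div_one (Real.exp (-A) / √(4 * π))]
    exact hp.div h4 one_ne_zero
  refine tendsto_of_tendsto_of_tendsto_of_le_of_le' hq hp ?_ ?_
  · filter_upwards [hv.eventually_gt_atTop 0] with n hvn
    rw [mul_div_assoc]
    exact mul_le_mul_of_nonneg_left (le_gaussianReal_real_Ioi hvn) n.cast_nonneg
  · filter_upwards [hv.eventually_gt_atTop 0] with n hvn
    exact mul_le_mul_of_nonneg_left (gaussianReal_real_Ioi_le hvn) n.cast_nonneg

/-- The level at which a standard Gaussian variable has to exceed `un n x` after being mixed with a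
common factor `z` at correlation `γ / log n`. -/
noncomputable def shiftedLevel (γ z : ℝ) (n : ℕ) (x : ℝ) : ℝ :=
  (un n x - √(γ / Real.log n) * z) / √(1 - γ / Real.log n)

theorem tendsto_div_log_natCast (γ : ℝ) :
    Tendsto (fun n : ℕ => γ / Real.log n) atTop (nhds 0) :=
  tendsto_log_natCast_atTop.const_div_atTop γ

theorem tendsto_natCast_mul_gaussianReal_real_Ioi_shiftedLevel {γ : ℝ} (hγ : 0 ≤ γ) (x z : ℝ) :
    Tendsto (fun n : ℕ => n * (gaussianReal 0 1).real (Set.Ioi (shiftedLevel γ z n x))) atTop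
      (nhds (g γ x z)) := by
  have hL := eventually_log_natCast_pos
  have hρ := tendsto_div_log_natCast γ
  have hsqρ : Tendsto (fun n : ℕ => √(γ / Real.log n)) atTop (nhds 0) := by
    simpa using hρ.sqrt
  have h1ρ : Tendsto (fun n : ℕ => 1 - γ / Real.log n) atTop (nhds 1) := by
    simpa using hρ.const_sub 1
  have hs1ρ : Tendsto (fun n : ℕ => √(1 - γ / Real.log n)) atTop (nhds 1) := by
    simpa using h1ρ.sqrt
  have hsinv : Tendsto (fun n : ℕ => (√(2 * Real.log n))⁻¹) atTop (nhds 0) :=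
    tendsto_inv_atTop_zero.comp
      (Real.tendsto_sqrt_atTop.comp (tendsto_log_natCast_atTop.const_mul_atTop two_pos))
  have hA : Real.exp (-(x - Real.log (4 * π) / 2 + (γ - √(2 * γ) * z))) / √(4 * π) = g γ x z := by
    rw [g, div_eq_iff (by positivity), ← Real.exp_log (show 0 < √(4 * π) by positivity),
      ← Real.exp_add, Real.log_sqrt (by positivity)]
    congr 1
    ring
  rw [← hA]
  apply tendsto_natCast_mul_gaussianReal_real_Ioi
  · have h := ((tendsto_un_div_sqrt x).sub ((hsqρ.mul_const z).mul hsinv)).div hs1ρ one_ne_zero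
    simp only [zero_mul, sub_zero, div_one] at h
    refine h.congr fun n => ?_
    simp only [shiftedLevel, Pi.div_apply]
    ring
  · have hmain : Tendsto (fun n : ℕ => (1 - γ / Real.log n)⁻¹ *
        ((un n x ^ 2 / (2 * Real.log n)) * γ
        - un n x / √(2 * Real.log n) * √(2 * γ) * z + (√(γ / Real.log n)) ^ 2 * z ^ 2 / 2)) atTop
        (nhds (1⁻¹ * (1 * γ - 1 * √(2 * γ) * z + 0 ^ 2 * z ^ 2 / 2))) := by
      refine (h1ρ.inv₀ one_ne_zero).mul ((((tendsto_un_sq_div_log x).mul_const γ).sub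
        (((tendsto_un_div_sqrt x).mul_const _).mul_const z)).add ?_)
      exact ((hsqρ.pow 2).mul_const _).div_const 2
    have h := (tendsto_un_sq_div_two_sub x).add hmain
    rw [show x - Real.log (4 * π) / 2 + 1⁻¹ * (1 * γ - 1 * √(2 * γ) * z + 0 ^ 2 * z ^ 2 / 2) =
      x - Real.log (4 * π) / 2 + (γ - √(2 * γ) * z) by ring] at h
    refine h.congr' ?_
    filter_upwards [hL, h1ρ.eventually_const_lt one_pos] with n hn h1n
    have e1 : √(2 * γ) / √(2 * Real.log n) = √(γ / Real.log n) := by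
      rw [← Real.sqrt_div (by positivity)]
      congr 1
      field_simp
    have e2 : un n x / √(2 * Real.log n) * √(2 * γ) = un n x * √(γ / Real.log n) := by
      rw [← e1]; ring
    have e3 : un n x ^ 2 / (2 * Real.log n) * γ = un n x ^ 2 / 2 * (γ / Real.log n) := by
      field_simp
    unfold shiftedLevel
    rw [e2, e3, div_pow, Real.sq_sqrt h1n.le]
    generalize γ / Real.log n = ρ at h1n
    field_simp
    ring

theorem integral_levelWeight_eq {s t σ τ u₁ u₂ : ℝ} (hσ : 0 < σ) (hu : u₁ ≤ u₂) :
    ∫ a, levelWeight u₁ u₂ s t (σ * a + τ) ∂(gaussianReal 0 1) =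
      1 - ((1 - s) * (gaussianReal 0 1).real (Set.Ioi ((u₁ - τ) / σ)) +
        (s - t) * (gaussianReal 0 1).real (Set.Ioi ((u₂ - τ) / σ))) := by
  have h : ∀ a, levelWeight u₁ u₂ s t (σ * a + τ) =
      1 - ((1 - s) * (Set.Ioi ((u₁ - τ) / σ)).indicator (fun _ => (1 : ℝ)) a +
        (s - t) * (Set.Ioi ((u₂ - τ) / σ)).indicator (fun _ => (1 : ℝ)) a) := by
    intro a
    have k1 : ∀ u, (u - τ) / σ < a ↔ u < σ * a + τ := fun u => by
      rw [div_lt_iff₀ hσ, mul_comm a σ, sub_lt_iff_lt_add]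
    simp only [levelWeight, Set.indicator_apply, Set.mem_Ioi, k1]
    split_ifs <;> first | ring1 | (exfalso; linarith)
  have hi : ∀ c v, Integrable (fun a => c * (Set.Ioi v).indicator (fun _ => (1 : ℝ)) a)
      (gaussianReal 0 1) := fun c v =>
    ((integrable_const (1 : ℝ)).indicator measurableSet_Ioi).const_mul c
  simp_rw [h]
  have hadd : Integrable (fun a => (1 - s) * (Set.Ioi ((u₁ - τ) / σ)).indicator (fun _ => (1 : ℝ)) a
      + (s - t) * (Set.Ioi ((u₂ - τ) / σ)).indicator (fun _ => (1 : ℝ)) a) (gaussianReal 0 1) :=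
    (hi _ _).add (hi _ _)
  rw [integral_sub (integrable_const _) hadd, integral_add (hi _ _) (hi _ _),
    integral_const_mul, integral_const_mul, integral_indicator_const _ measurableSet_Ioi,
    integral_indicator_const _ measurableSet_Ioi]
  simp

theorem tendsto_natCast_mul_one_sub_integral_levelWeight {γ : ℝ} (hγ : 0 ≤ γ) {x y : ℝ}
    (hxy : x ≤ y) (s t z : ℝ) :
    Tendsto (fun n : ℕ => n * (1 - ∫ a, levelWeight (un n x) (un n y) s t
      (√(1 - γ / Real.log n) * a + √(γ / Real.log n) * z) ∂(gaussianReal 0 1))) atTop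
      (nhds ((1 - s) * g γ x z + (s - t) * g γ y z)) := by
  have h := ((tendsto_natCast_mul_gaussianReal_real_Ioi_shiftedLevel hγ x z).const_mul (1 - s)).add
    ((tendsto_natCast_mul_gaussianReal_real_Ioi_shiftedLevel hγ y z).const_mul (s - t))
  refine h.congr' ?_
  have h1ρ : Tendsto (fun n : ℕ => 1 - γ / Real.log n) atTop (nhds 1) := by
    simpa using (tendsto_div_log_natCast γ).const_sub 1
  filter_upwards [h1ρ.eventually_const_lt one_pos] with n hn
  rw [integral_levelWeight_eq (Real.sqrt_pos.2 hn) (un_mono n hxy)]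
  unfold shiftedLevel
  ring

open scoped Pointwise in
theorem mem_inv_smul_span_basisFun_iff {n : ℕ} (hn : 0 < n) (v : Unit → ℝ) :
    v ∈ (n : ℝ)⁻¹ • (Submodule.span ℤ (Set.range (Pi.basisFun ℝ Unit)) : Set (Unit → ℝ)) ↔
      ∃ k : ℤ, (k : ℝ) = n * v () := by
  rw [Set.mem_inv_smul_set_iff₀ (by positivity), SetLike.mem_coe,
    Module.Basis.mem_span_iff_repr_mem]
  simpa using ⟨fun h => h (), fun h _ => h⟩

/-- Normalized counting of the grid points `j / n` in a Borel subset of `(0, 1]` with null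
boundary. -/
theorem tendsto_card_grid_div {B : Set ℝ} (hBmeas : MeasurableSet B) (hBsub : B ⊆ Set.Ioc 0 1)
    (hBfrontier : volume (frontier B) = 0) :
    Tendsto (fun n : ℕ => (∑ j ∈ Finset.Icc 1 n, B.indicator (fun _ => (1 : ℝ)) ((j : ℝ) / n)) / n)
      atTop (nhds (volume.real B)) := by
  set h : (Unit → ℝ) ≃ₜ ℝ := Homeomorph.funUnique Unit ℝ with hh
  have hmp : MeasurePreserving h volume volume := volume_preserving_funUnique Unit ℝ
  have hs1 : Bornology.IsBounded (h ⁻¹' B) := by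
    refine (Metric.isBounded_Icc (0 : Unit → ℝ) 1).subset fun v hv => ?_
    have := hBsub hv
    exact ⟨fun _ => this.1.le, fun _ => this.2⟩
  have hs2 : MeasurableSet (h ⁻¹' B) := h.continuous.measurable hBmeas
  have hs3 : volume (frontier (h ⁻¹' B)) = 0 := by
    rw [← h.preimage_frontier, hmp.measure_preimage isClosed_frontier.nullMeasurableSet, hBfrontier]
  have key := tendsto_card_div_pow_atTop_volume (h ⁻¹' B) hs1 hs2 hs3
  rw [measureReal_def, hmp.measure_preimage hBmeas.nullMeasurableSet, ← measureReal_def] at key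
  refine key.congr' ?_
  filter_upwards [eventually_gt_atTop 0] with n hn
  have hn' : (0 : ℝ) < n := by exact_mod_cast hn
  rw [Fintype.card_unit, pow_one]
  congr 1
  simp only [Set.indicator_apply, Finset.sum_boole, Nat.cast_inj]
  rw [Nat.card_coe_set_eq, ← Set.ncard_coe_finset]
  symm
  refine Set.ncard_congr (fun j _ => fun _ => (j : ℝ) / n) ?_ ?_ ?_
  · intro j hj
    rw [Finset.mem_coe, Finset.mem_filter] at hj
    refine ⟨hj.2, (mem_inv_smul_span_basisFun_iff hn _).2 ⟨j, ?_⟩⟩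
    push_cast
    field_simp
  · intro i j _ _ hij
    have := congrFun hij ()
    field_simp at this
    exact_mod_cast this
  · rintro v ⟨hv, hvL⟩
    obtain ⟨k, hk⟩ := (mem_inv_smul_span_basisFun_iff hn v).1 hvL
    have hv' : v () ∈ B := hv
    have h01 := hBsub hv'
    have hk0 : 0 < k := by
      have : (0 : ℝ) < k := by rw [hk]; exact mul_pos hn' h01.1
      exact_mod_cast this
    have hkn : k ≤ n := by
      have : (k : ℝ) ≤ n := by rw [hk]; exact mul_le_of_le_one_right hn'.le h01.2
      exact_mod_cast this
    lift k to ℕ using hk0.le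
    have hkv : (k : ℝ) / n = v () := by
      rw [div_eq_iff hn'.ne', mul_comm]; exact_mod_cast hk
    refine ⟨k, ?_, ?_⟩
    · rw [Finset.mem_coe, Finset.mem_filter, Finset.mem_Icc, hkv]
      exact ⟨⟨by omega, by omega⟩, hv'⟩
    · funext u
      exact hkv

section EmpiricalMeasure

variable {Ω : Type*} {e : ℕ → Ω → ℝ} {lam : Ω → ℝ}

/-- The signed normalized sum of the deviations `e j - lam` over the grid points `j / n ∈ E`. -/
noncomputable def gridDeviation (e : ℕ → Ω → ℝ) (lam : Ω → ℝ) (E : Set ℝ) (n : ℕ) (ω : Ω) : ℝ :=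
  (∑ j ∈ Finset.Icc 1 n, E.indicator (fun _ => (1 : ℝ)) ((j : ℝ) / n) * (e j ω - lam ω)) / n

theorem gridDeviation_union (E F : Set ℝ) (n : ℕ) (ω : Ω) :
    gridDeviation e lam (E ∪ F) n ω = gridDeviation e lam E n ω + gridDeviation e lam F n ω -
      gridDeviation e lam (E ∩ F) n ω := by
  unfold gridDeviation
  rw [← add_div, ← sub_div, ← Finset.sum_add_distrib, ← Finset.sum_sub_distrib]
  congr 1
  refine Finset.sum_congr rfl fun j _ => ?_
  have := Set.indicator_union_add_inter_apply (fun _ => (1 : ℝ)) E F ((j : ℝ) / n)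
  linear_combination (e j ω - lam ω) * this

theorem abs_gridDeviation_le {ω : Ω} (h : ∀ j, |e j ω - lam ω| ≤ 1) (E : Set ℝ) (n : ℕ) :
    |gridDeviation e lam E n ω| ≤
      (∑ j ∈ Finset.Icc 1 n, E.indicator (fun _ => (1 : ℝ)) ((j : ℝ) / n)) / n := by
  unfold gridDeviation
  rw [abs_div, Nat.abs_cast]
  gcongr
  refine (Finset.abs_sum_le_sum_abs _ _).trans (Finset.sum_le_sum fun j _ => ?_)
  rw [abs_mul]
  by_cases hj : (j : ℝ) / n ∈ E
  · simpa [hj] using h j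
  · simp [hj]

theorem gridDeviation_Iic_of_nonpos {b : ℝ} (hb : b ≤ 0) (n : ℕ) (ω : Ω) :
    gridDeviation e lam (Set.Iic b) n ω = 0 := by
  unfold gridDeviation
  rw [Finset.sum_eq_zero, zero_div]
  intro j hj
  rw [Finset.mem_Icc] at hj
  have : (0 : ℝ) < (j : ℝ) / n :=
    div_pos (by exact_mod_cast hj.1) (by exact_mod_cast hj.1.trans hj.2)
  rw [Set.indicator_of_notMem (by simpa using hb.trans_lt this), zero_mul]

theorem abs_gridDeviation_Iic_le {b : ℝ} (hb : 0 < b) (n : ℕ) (ω : Ω) :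
    |gridDeviation e lam (Set.Iic b) n ω| ≤
      |(∑ k ∈ Finset.Icc 1 (min n ⌊b * n⌋₊), e k ω) / (min n ⌊b * n⌋₊ : ℕ) - lam ω| := by
  unfold gridDeviation
  rcases Nat.eq_zero_or_pos n with rfl | hn
  · simp
  have hn' : (0 : ℝ) < n := by exact_mod_cast hn
  have hsum : ∑ j ∈ Finset.Icc 1 n,
      (Set.Iic b).indicator (fun _ => (1 : ℝ)) ((j : ℝ) / n) * (e j ω - lam ω) =
      ∑ j ∈ Finset.Icc 1 (min n ⌊b * n⌋₊), (e j ω - lam ω) := by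
    simp only [Set.indicator_apply, ite_mul, one_mul, zero_mul]
    rw [← Finset.sum_filter]
    refine Finset.sum_congr ?_ fun _ _ => rfl
    ext j
    simp only [Finset.mem_filter, Finset.mem_Icc, Set.mem_Iic, le_min_iff]
    rw [div_le_iff₀ hn', Nat.le_floor_iff (by positivity), and_assoc]
  rw [hsum]
  have hmn : min n ⌊b * n⌋₊ ≤ n := min_le_left _ _
  generalize min n ⌊b * n⌋₊ = m at hmn
  rcases Nat.eq_zero_or_pos m with rfl | hm
  · simp
  have hm' : (0 : ℝ) < m := by exact_mod_cast hm
  have hmn' : (m : ℝ) ≤ n := by exact_mod_cast hmn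
  have e1 : (∑ j ∈ Finset.Icc 1 m, (e j ω - lam ω)) / n =
      m / n * ((∑ k ∈ Finset.Icc 1 m, e k ω) / m - lam ω) := by
    rw [Finset.sum_sub_distrib, Finset.sum_const, Nat.card_Icc, Nat.add_sub_cancel, nsmul_eq_mul]
    field_simp
  rw [e1, abs_mul, abs_of_nonneg (by positivity)]
  exact mul_le_of_le_one_left (abs_nonneg _) ((div_le_one hn').2 hmn')

theorem gridDeviation_Ioc_eq (a b : ℝ) (n : ℕ) (ω : Ω) :
    gridDeviation e lam (Set.Ioc a b) n ω = gridDeviation e lam (Set.Iic b) n ω +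
      gridDeviation e lam ∅ n ω - gridDeviation e lam (Set.Iic (min a b)) n ω := by
  have h := gridDeviation_union (e := e) (lam := lam) (Set.Ioc a b) (Set.Iic (min a b)) n ω
  have h1 : Set.Ioc a b ∪ Set.Iic (min a b) = Set.Iic b := by
    ext t
    simp only [Set.mem_union, Set.mem_Ioc, Set.mem_Iic, le_min_iff]
    grind
  have h2 : Set.Ioc a b ∩ Set.Iic (min a b) = ∅ := by
    ext t
    simp only [Set.mem_inter_iff, Set.mem_Ioc, Set.mem_Iic, le_min_iff, Set.mem_empty_iff_false]
    grind
  rw [h1, h2] at h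
  have h0 : gridDeviation e lam ∅ n ω = 0 := by simp [gridDeviation]
  linarith

variable [MeasurableSpace Ω] {P : Measure Ω}

theorem measurable_gridDeviation (he : ∀ j, Measurable (e j)) (hlam : Measurable lam) (E : Set ℝ)
    (n : ℕ) : Measurable (gridDeviation e lam E n) := by
  unfold gridDeviation
  fun_prop

/-- The deviations over the grid points of `E` vanish in `L¹`. -/
def GridDeviationTendsto (P : Measure Ω) (e : ℕ → Ω → ℝ) (lam : Ω → ℝ) (E : Set ℝ) : Prop :=
  Tendsto (fun n => ∫ ω, |gridDeviation e lam E n ω| ∂P) atTop (nhds 0)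

theorem gridDeviationTendsto_empty : GridDeviationTendsto P e lam ∅ := by
  unfold GridDeviationTendsto gridDeviation
  simp

variable [IsProbabilityMeasure P]

theorem integrable_gridDeviation (he : ∀ j, Measurable (e j)) (hlam : Measurable lam)
    (hb : ∀ᵐ ω ∂P, ∀ j, |e j ω - lam ω| ≤ 1) (E : Set ℝ) (n : ℕ) :
    Integrable (gridDeviation e lam E n) P := by
  refine Integrable.of_bound (measurable_gridDeviation he hlam E n).aestronglyMeasurable
    ((∑ j ∈ Finset.Icc 1 n, E.indicator (fun _ => (1 : ℝ)) ((j : ℝ) / n)) / n) ?_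
  filter_upwards [hb] with ω hω
  exact abs_gridDeviation_le hω E n

theorem integral_abs_gridDeviation_le (hb : ∀ᵐ ω ∂P, ∀ j, |e j ω - lam ω| ≤ 1) (E : Set ℝ)
    (n : ℕ) :
    ∫ ω, |gridDeviation e lam E n ω| ∂P ≤
      (∑ j ∈ Finset.Icc 1 n, E.indicator (fun _ => (1 : ℝ)) ((j : ℝ) / n)) / n := by
  have h := integral_mono_of_nonneg (ae_of_all P fun ω => abs_nonneg (gridDeviation e lam E n ω))
    (integrable_const _) (hb.mono fun ω hω => abs_gridDeviation_le hω E n)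
  simpa using h

theorem GridDeviationTendsto.of_eq (he : ∀ j, Measurable (e j)) (hlam : Measurable lam)
    (hb : ∀ᵐ ω ∂P, ∀ j, |e j ω - lam ω| ≤ 1) {E F G H : Set ℝ}
    (h : ∀ n ω, gridDeviation e lam H n ω = gridDeviation e lam E n ω + gridDeviation e lam F n ω -
      gridDeviation e lam G n ω) (hE : GridDeviationTendsto P e lam E)
    (hF : GridDeviationTendsto P e lam F) (hG : GridDeviationTendsto P e lam G) :
    GridDeviationTendsto P e lam H := by
  have hlim := (hE.add hF).add hG
  rw [add_zero, add_zero] at hlim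
  refine squeeze_zero (fun n => integral_nonneg fun ω => abs_nonneg _) (fun n => ?_) hlim
  have i := fun E => (integrable_gridDeviation he hlam hb E n).abs
  have iEF : Integrable (fun ω => |gridDeviation e lam E n ω| + |gridDeviation e lam F n ω|) P :=
    (i E).add (i F)
  rw [← integral_add (i E) (i F), ← integral_add iEF (i G)]
  refine integral_mono (i H) (iEF.add (i G)) fun ω => ?_
  simp only [h n ω]
  exact (abs_sub _ _).trans (add_le_add (abs_add_le _ _) le_rfl)

theorem gridDeviationTendsto_Iic (he : ∀ j, Measurable (e j)) (hlam : Measurable lam)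
    (hb : ∀ᵐ ω ∂P, ∀ j, |e j ω - lam ω| ≤ 1)
    (hD : Tendsto (fun n : ℕ => ∫ ω, |(∑ k ∈ Finset.Icc 1 n, e k ω) / n - lam ω| ∂P) atTop (nhds 0))
    (hDi : ∀ n : ℕ, Integrable (fun ω => (∑ k ∈ Finset.Icc 1 n, e k ω) / n - lam ω) P) (b : ℝ) :
    GridDeviationTendsto P e lam (Set.Iic b) := by
  rcases le_or_gt b 0 with hb0 | hb0
  · simp only [GridDeviationTendsto, gridDeviation_Iic_of_nonpos hb0, abs_zero, integral_zero]
    exact tendsto_const_nhds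
  have hm : Tendsto (fun n : ℕ => min n ⌊b * n⌋₊) atTop atTop :=
    tendsto_atTop.2 fun m => (eventually_ge_atTop m).and
      ((tendsto_nat_floor_atTop.comp
        (tendsto_natCast_atTop_atTop.const_mul_atTop hb0)).eventually_ge_atTop m) |>.mono
      fun n hn => le_min hn.1 hn.2
  refine squeeze_zero (fun n => integral_nonneg fun ω => abs_nonneg _) (fun n => ?_) (hD.comp hm)
  exact integral_mono (integrable_gridDeviation he hlam hb _ n).abs (hDi _).abs
    fun ω => abs_gridDeviation_Iic_le hb0 n ω

theorem gridDeviationTendsto_biUnion_Ioc (he : ∀ j, Measurable (e j)) (hlam : Measurable lam)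
    (hb : ∀ᵐ ω ∂P, ∀ j, |e j ω - lam ω| ≤ 1)
    (h : ∀ b, GridDeviationTendsto P e lam (Set.Iic b)) {κ : Type*} (s : Finset κ) (c d : κ → ℝ)
    (a b : ℝ) :
    GridDeviationTendsto P e lam ((⋃ i ∈ s, Set.Ioc (c i) (d i)) ∩ Set.Ioc a b) := by
  have hIoc : ∀ a b, GridDeviationTendsto P e lam (Set.Ioc a b) := fun a b =>
    GridDeviationTendsto.of_eq he hlam hb (gridDeviation_Ioc_eq a b) (h b)
      gridDeviationTendsto_empty (h _)
  induction s using Finset.induction_on generalizing a b with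
  | empty => simpa using gridDeviationTendsto_empty
  | insert i s hi ih =>
    rw [Finset.set_biUnion_insert, Set.union_inter_distrib_right]
    refine GridDeviationTendsto.of_eq he hlam hb (fun n ω => gridDeviation_union _ _ n ω) ?_
      (ih a b) ?_
    · rw [Set.Ioc_inter_Ioc]
      exact hIoc _ _
    · have : Set.Ioc (c i) (d i) ∩ Set.Ioc a b ∩ ((⋃ i ∈ s, Set.Ioc (c i) (d i)) ∩ Set.Ioc a b) =
          (⋃ i ∈ s, Set.Ioc (c i) (d i)) ∩ Set.Ioc (max (c i) a) (min (d i) b) := by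
        rw [← Set.Ioc_inter_Ioc]
        ext t
        simp only [Set.mem_inter_iff]
        tauto
      rw [this]
      exact ih _ _

/-- A Borel set with null boundary is approximated from inside by finite unions of intervals. -/
theorem exists_biUnion_Ioc_subset {B : Set ℝ} (hBfrontier : volume (frontier B) = 0)
    (hBfin : volume B ≠ ∞) {δ : ℝ} (hδ : 0 < δ) :
    ∃ (s : Finset ℝ) (c d : ℝ → ℝ), (⋃ i ∈ s, Set.Ioc (c i) (d i)) ⊆ B ∧
      volume.real (B \ ⋃ i ∈ s, Set.Ioc (c i) (d i)) < δ := by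
  have hInt : volume (interior B) = volume B := by
    refine le_antisymm (measure_mono interior_subset) ?_
    calc volume B ≤ volume (interior B ∪ frontier B) := measure_mono <| by
          rw [← closure_eq_interior_union_frontier]; exact subset_closure
      _ ≤ volume (interior B) + volume (frontier B) := measure_union_le _ _
      _ = volume (interior B) := by rw [hBfrontier, add_zero]
  obtain ⟨K, hKB, hK, hvol⟩ := isOpen_interior.measurableSet.exists_isCompact_sdiff_lt
    (hInt ▸ hBfin) (ENNReal.ofReal_pos.2 hδ).ne'
  have hnhds : ∀ t ∈ K, ∃ c d, t ∈ Set.Ioo c d ∧ Set.Ioc c d ⊆ B := by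
    intro t ht
    obtain ⟨r, hr, hrB⟩ := Metric.isOpen_iff.1 isOpen_interior t (hKB ht)
    refine ⟨t - r / 2, t + r / 2, ⟨by linarith, by linarith⟩, fun u hu => interior_subset (hrB ?_)⟩
    rw [Metric.mem_ball, Real.dist_eq, abs_lt]
    constructor <;> linarith [hu.1, hu.2]
  choose! c d hcd hcdB using hnhds
  obtain ⟨s, hsK, hs⟩ := hK.elim_nhds_subcover (fun t => Set.Ioo (c t) (d t))
    fun t ht => Ioo_mem_nhds (hcd t ht).1 (hcd t ht).2
  refine ⟨s, c, d, Set.iUnion₂_subset fun i hi => hcdB i (hsK i hi), ?_⟩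
  have hsub : B \ ⋃ i ∈ s, Set.Ioc (c i) (d i) ⊆ (interior B \ K) ∪ frontier B := by
    rintro t ⟨ht, htn⟩
    by_cases hti : t ∈ interior B
    · exact Or.inl ⟨hti, fun htK => htn (Set.biUnion_mono (fun _ h => h)
        (fun _ _ => Set.Ioo_subset_Ioc_self) (hs htK))⟩
    · exact Or.inr ⟨subset_closure ht, hti⟩
  have : volume (B \ ⋃ i ∈ s, Set.Ioc (c i) (d i)) < ENNReal.ofReal δ := by
    refine (measure_mono hsub).trans_lt ((measure_union_le _ _).trans_lt ?_)
    rwa [hBfrontier, add_zero]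
  exact (ENNReal.toReal_lt_of_lt_ofReal this)

theorem gridDeviationTendsto_of_frontier (he : ∀ j, Measurable (e j)) (hlam : Measurable lam)
    (hb : ∀ᵐ ω ∂P, ∀ j, |e j ω - lam ω| ≤ 1)
    (h : ∀ b, GridDeviationTendsto P e lam (Set.Iic b)) {B : Set ℝ} (hBmeas : MeasurableSet B)
    (hBsub : B ⊆ Set.Ioc 0 1) (hBfrontier : volume (frontier B) = 0) :
    GridDeviationTendsto P e lam B := by
  have hBfin : volume B ≠ ∞ := measure_ne_top_of_subset hBsub measure_Ioc_lt_top.ne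
  refine tendsto_order.2 ⟨fun a ha => Eventually.of_forall fun n =>
    ha.trans_le (integral_nonneg fun ω => abs_nonneg _), fun δ hδ => ?_⟩
  obtain ⟨s, c, d, hsB, hsδ⟩ := exists_biUnion_Ioc_subset hBfrontier hBfin (half_pos hδ)
  set E := ⋃ i ∈ s, Set.Ioc (c i) (d i) with hE
  have hEmeas : MeasurableSet E := Finset.measurableSet_biUnion _ fun _ _ => measurableSet_Ioc
  have hEfr : volume (frontier E) = 0 := by
    refine measure_mono_null (t := ⋃ i ∈ s, frontier (Set.Ioc (c i) (d i))) ?_ ?_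
    · rw [hE]
      clear hE hEmeas hsδ hsB E
      induction s using Finset.induction_on with
      | empty => simp
      | insert i s hi ih =>
        rw [Finset.set_biUnion_insert, Finset.set_biUnion_insert]
        refine (frontier_union_subset _ _).trans (Set.union_subset_union ?_ ?_)
        · exact Set.inter_subset_left
        · exact Set.inter_subset_right.trans ih
    · refine (measure_biUnion_null_iff s.countable_toSet).2 fun i _ => ?_
      exact (convex_Ioc (c i) (d i)).addHaar_frontier volume
  have hdiff : volume (frontier (B \ E)) = 0 := by
    rw [Set.sdiff_eq]
    refine measure_mono_null (frontier_inter_subset _ _) (measure_union_null ?_ ?_)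
    · exact measure_mono_null Set.inter_subset_left hBfrontier
    · rw [frontier_compl]
      exact measure_mono_null Set.inter_subset_right hEfr
  have h1 : Tendsto (fun n => ∫ ω, |gridDeviation e lam E n ω| ∂P) atTop (nhds 0) := by
    have := gridDeviationTendsto_biUnion_Ioc he hlam hb h s c d 0 1
    rwa [← hE, Set.inter_eq_left.2 (hsB.trans hBsub)] at this
  have h2 := tendsto_card_grid_div (hBmeas.diff hEmeas) (Set.sdiff_subset.trans hBsub) hdiff
  filter_upwards [h1.eventually_lt_const (half_pos hδ), h2.eventually_lt_const hsδ] with n hn1 hn2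
  have i := fun E => (integrable_gridDeviation he hlam hb E n).abs
  calc ∫ ω, |gridDeviation e lam B n ω| ∂P
      ≤ ∫ ω, (|gridDeviation e lam E n ω| + |gridDeviation e lam (B \ E) n ω|) ∂P := by
        refine integral_mono (i B) ((i E).add (i (B \ E))) fun ω => ?_
        have hu := gridDeviation_union (e := e) (lam := lam) E (B \ E) n ω
        rw [Set.union_sdiff_cancel hsB, Set.inter_sdiff_self] at hu
        have h0 : gridDeviation e lam ∅ n ω = 0 := by simp [gridDeviation]
        simp only [hu, h0, sub_zero]
        exact abs_add_le _ _
    _ = ∫ ω, |gridDeviation e lam E n ω| ∂P + ∫ ω, |gridDeviation e lam (B \ E) n ω| ∂P :=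
        integral_add (i E) (i _)
    _ < δ := by linarith [integral_abs_gridDeviation_le hb (B \ E) n]

end EmpiricalMeasure

/-- Convergence in probability implies `L¹` convergence when the differences are bounded by `1`. -/
theorem tendsto_integral_abs_sub_of_tendstoInMeasure {Ω : Type*} [MeasurableSpace Ω]
    {P : Measure Ω} [IsProbabilityMeasure P] {f : ℕ → Ω → ℝ} {h : Ω → ℝ}
    (hf : ∀ n, Measurable (f n)) (hh : Measurable h) (hb : ∀ n, ∀ᵐ ω ∂P, |f n ω - h ω| ≤ 1)
    (hlim : TendstoInMeasure P f atTop h) :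
    Tendsto (fun n => ∫ ω, |f n ω - h ω| ∂P) atTop (nhds 0) := by
  refine tendsto_order.2 ⟨fun a ha => Eventually.of_forall fun n =>
    ha.trans_le (integral_nonneg fun ω => abs_nonneg _), fun δ hδ => ?_⟩
  have hδ2 := half_pos hδ
  have h1 := hlim (ENNReal.ofReal (δ / 2)) (ENNReal.ofReal_pos.2 hδ2)
  have h2 := (ENNReal.tendsto_toReal ENNReal.zero_ne_top).comp h1
  rw [ENNReal.toReal_zero] at h2
  filter_upwards [h2.eventually_lt_const hδ2] with n hn
  set A : Set Ω := {ω | ENNReal.ofReal (δ / 2) ≤ edist (f n ω) (h ω)} with hA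
  have hAiff : ∀ ω, ω ∈ A ↔ δ / 2 ≤ |f n ω - h ω| := fun ω => by
    rw [hA, Set.mem_ofPred_eq, edist_dist, ENNReal.ofReal_le_ofReal_iff dist_nonneg, Real.dist_eq]
  have hAm : MeasurableSet A := by
    have : A = {ω | δ / 2 ≤ |f n ω - h ω|} := Set.ext hAiff
    rw [this]
    exact measurableSet_le measurable_const ((hf n).sub hh).abs
  have hInt : Integrable (fun ω => |f n ω - h ω|) P :=
    (Integrable.of_bound ((hf n).sub hh).aestronglyMeasurable 1 (hb n)).abs
  have hInt2 : Integrable (fun ω => δ / 2 + A.indicator (fun _ => (1 : ℝ)) ω) P :=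
    (integrable_const _).add ((integrable_const _).indicator hAm)
  calc ∫ ω, |f n ω - h ω| ∂P
      ≤ ∫ ω, (δ / 2 + A.indicator (fun _ => (1 : ℝ)) ω) ∂P := by
        refine integral_mono_ae hInt hInt2 ?_
        filter_upwards [hb n] with ω hω
        by_cases hωA : ω ∈ A
        · simp only [hωA, Set.indicator_of_mem]; linarith
        · have := (not_le.1 ((hAiff ω).not.1 hωA)).le
          simpa only [hωA, not_false_eq_true, Set.indicator_of_notMem, add_zero] using this
    _ = δ / 2 + P.real A := by
        rw [integral_add (integrable_const _) ((integrable_const _).indicator hAm),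
          integral_indicator_const _ hAm]
        simp
    _ < δ := by
        have : P.real A < δ / 2 := hn
        linarith

section

variable {Ω : Type*} [MeasurableSpace Ω] {P : Measure Ω} [IsProbabilityMeasure P]
  {e : ℕ → Ω → ℝ} {lam : Ω → ℝ}

theorem tendsto_integral_abs_grid_sub (he : ∀ j, Measurable (e j)) (hlam : Measurable lam)
    (hb : ∀ᵐ ω ∂P, ∀ j, |e j ω - lam ω| ≤ 1) (hlam1 : ∀ᵐ ω ∂P, |lam ω| ≤ 1) {B : Set ℝ}
    (hBmeas : MeasurableSet B) (hBsub : B ⊆ Set.Ioc 0 1) (hBfrontier : volume (frontier B) = 0)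
    (h : GridDeviationTendsto P e lam B) :
    Tendsto (fun n : ℕ => ∫ ω, |(∑ j ∈ Finset.Icc 1 n,
      B.indicator (fun _ => (1 : ℝ)) ((j : ℝ) / n) * e j ω) / n - lam ω * volume.real B| ∂P)
      atTop (nhds 0) := by
  have hC := ((tendsto_card_grid_div hBmeas hBsub hBfrontier).sub_const (volume.real B)).abs
  rw [sub_self, abs_zero] at hC
  have hlim := h.add hC
  rw [add_zero] at hlim
  refine squeeze_zero (fun n => integral_nonneg fun ω => abs_nonneg _) (fun n => ?_) hlim
  set C := (∑ j ∈ Finset.Icc 1 n, B.indicator (fun _ => (1 : ℝ)) ((j : ℝ) / n)) / n with hCdef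
  have i := (integrable_gridDeviation he hlam hb B n).abs
  have key : ∀ ω, (∑ j ∈ Finset.Icc 1 n,
      B.indicator (fun _ => (1 : ℝ)) ((j : ℝ) / n) * e j ω) / n - lam ω * volume.real B =
      gridDeviation e lam B n ω + lam ω * (C - volume.real B) := by
    intro ω
    have : (∑ j ∈ Finset.Icc 1 n, B.indicator (fun _ => (1 : ℝ)) ((j : ℝ) / n) * e j ω) / n =
        gridDeviation e lam B n ω + lam ω * C := by
      rw [gridDeviation, hCdef, mul_div_assoc', ← add_div, Finset.mul_sum,
        ← Finset.sum_add_distrib]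
      congr 1
      exact Finset.sum_congr rfl fun j _ => by ring
    rw [this]
    ring
  have hmono := integral_mono_of_nonneg (μ := P)
    (f := fun ω => |gridDeviation e lam B n ω + lam ω * (C - volume.real B)|)
    (g := fun ω => |gridDeviation e lam B n ω| + |C - volume.real B|)
    (ae_of_all P fun ω => abs_nonneg _) (i.add (integrable_const _)) (by
      filter_upwards [hlam1] with ω hω
      refine (abs_add_le _ _).trans (add_le_add le_rfl ?_)
      rw [abs_mul]
      exact mul_le_of_le_one_left (abs_nonneg _) hω)
  simp only [key]
  refine hmono.trans_eq ?_
  rw [integral_add i (integrable_const _)]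
  simp

/-- If a random `{0,1}`-sequence has asymptotic frequency `lam`, then within a Borel set of times
with null boundary the normalized numbers of ones and of zeros converge in `L¹`. -/
theorem tendsto_integral_abs_count_sub {ε : ℕ → Ω → Bool} (hε : ∀ n, Measurable (ε n))
    (hlam : Measurable lam) (hlam01 : ∀ᵐ ω ∂P, lam ω ∈ Set.Icc (0 : ℝ) 1)
    (hS : TendstoInMeasure P
      (fun n ω => (∑ k ∈ Finset.Icc 1 n, (if ε k ω then (1 : ℝ) else 0)) / n) atTop lam)
    {B : Set ℝ} (hBmeas : MeasurableSet B) (hBsub : B ⊆ Set.Ioc 0 1)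
    (hBfrontier : volume (frontier B) = 0) :
    Tendsto (fun n : ℕ => ∫ ω, |(((Finset.Icc 1 n).filter
      (fun j : ℕ => (j : ℝ) / n ∈ B ∧ ε j ω = true)).card : ℝ) / n - lam ω * volume.real B| ∂P)
      atTop (nhds 0) ∧
    Tendsto (fun n : ℕ => ∫ ω, |(((Finset.Icc 1 n).filter
      (fun j : ℕ => (j : ℝ) / n ∈ B ∧ ε j ω = false)).card : ℝ) / n
        - (1 - lam ω) * volume.real B| ∂P)
      atTop (nhds 0) := by
  set e : ℕ → Ω → ℝ := fun j ω => if ε j ω then (1 : ℝ) else 0 with he_def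
  have he : ∀ j, Measurable (e j) := fun j =>
    Measurable.ite (hε j (measurableSet_singleton true)) measurable_const measurable_const
  have he01 : ∀ j ω, e j ω ∈ Set.Icc (0 : ℝ) 1 := fun j ω => by
    simp only [he_def]; split_ifs <;> simp
  have hb : ∀ᵐ ω ∂P, ∀ j, |e j ω - lam ω| ≤ 1 := by
    filter_upwards [hlam01] with ω hω j
    have := he01 j ω
    rw [abs_le]
    constructor <;> linarith [this.1, this.2, hω.1, hω.2]
  have hb' : ∀ᵐ ω ∂P, ∀ j, |(1 - e j ω) - (1 - lam ω)| ≤ 1 := by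
    filter_upwards [hb] with ω hω j
    rw [show (1 - e j ω) - (1 - lam ω) = -(e j ω - lam ω) by ring, abs_neg]
    exact hω j
  have hfm : ∀ n : ℕ, Measurable (fun ω => (∑ k ∈ Finset.Icc 1 n, e k ω) / n) := fun n => by
    fun_prop
  have hfb : ∀ n : ℕ, ∀ᵐ ω ∂P, |(∑ k ∈ Finset.Icc 1 n, e k ω) / n - lam ω| ≤ 1 := by
    intro n
    filter_upwards [hlam01] with ω hω
    have h0 : 0 ≤ (∑ k ∈ Finset.Icc 1 n, e k ω) / n :=
      div_nonneg (Finset.sum_nonneg fun j _ => (he01 j ω).1) n.cast_nonneg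
    have h1 : (∑ k ∈ Finset.Icc 1 n, e k ω) / n ≤ 1 := by
      refine div_le_one_of_le₀ ?_ n.cast_nonneg
      refine (Finset.sum_le_sum fun j _ => (he01 j ω).2).trans ?_
      simp
    rw [abs_le]
    constructor <;> linarith [hω.1, hω.2]
  have hD := tendsto_integral_abs_sub_of_tendstoInMeasure hfm hlam hfb hS
  have hIic := gridDeviationTendsto_Iic he hlam hb hD fun n =>
    Integrable.of_bound ((hfm n).sub hlam).aestronglyMeasurable 1 (hfb n)
  have hT := gridDeviationTendsto_of_frontier he hlam hb hIic hBmeas hBsub hBfrontier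
  have hT' : GridDeviationTendsto P (fun j ω => 1 - e j ω) (fun ω => 1 - lam ω) B := by
    refine hT.congr fun n => integral_congr_ae (ae_of_all P fun ω => ?_)
    have : gridDeviation (fun j ω => 1 - e j ω) (fun ω => 1 - lam ω) B n ω =
        -gridDeviation e lam B n ω := by
      unfold gridDeviation
      rw [← neg_div, ← Finset.sum_neg_distrib]
      congr 1
      exact Finset.sum_congr rfl fun j _ => by ring
    simp only [this, abs_neg]
  have hlam1 : ∀ᵐ ω ∂P, |lam ω| ≤ 1 := hlam01.mono fun ω hω => abs_le.2 ⟨by linarith [hω.1], hω.2⟩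
  have hlam1' : ∀ᵐ ω ∂P, |1 - lam ω| ≤ 1 := hlam01.mono fun ω hω =>
    abs_le.2 ⟨by linarith [hω.2], by linarith [hω.1]⟩
  refine ⟨(tendsto_integral_abs_grid_sub he hlam hb hlam1 hBmeas hBsub hBfrontier hT).congr
      fun n => ?_,
    (tendsto_integral_abs_grid_sub (fun j => (he j).const_sub 1) (hlam.const_sub 1) hb' hlam1'
      hBmeas hBsub hBfrontier hT').congr fun n => ?_⟩
  all_goals
    refine integral_congr_ae (ae_of_all P fun ω => ?_)
    beta_reduce
    congr 3
    rw [← Finset.sum_boole]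
    refine Finset.sum_congr rfl fun j _ => ?_
    by_cases hj : (j : ℝ) / n ∈ B <;> cases hε' : ε j ω <;> simp [he_def, hj, hε']

end

theorem tendsto_coeff_of_tendsto_of_remainder_le {G : ℕ → ℝ → ℝ} {G' : ℝ → ℝ} {c : ℕ → ℕ → ℝ}
    {c' : ℕ → ℝ}
    (hG : ∀ n k, ∀ t ∈ Set.Ioc (0 : ℝ) 1,
      |G n t - ∑ i ∈ Finset.range (k + 1), c n i * t ^ i| ≤ t ^ (k + 1))
    (hG' : ∀ k, ∀ t ∈ Set.Ioc (0 : ℝ) 1,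
      |G' t - ∑ i ∈ Finset.range (k + 1), c' i * t ^ i| ≤ t ^ (k + 1))
    (hlim : ∀ t ∈ Set.Ioc (0 : ℝ) 1, Tendsto (fun n => G n t) atTop (nhds (G' t))) (k : ℕ) :
    Tendsto (fun n => c n k) atTop (nhds (c' k)) := by
  induction k using Nat.strong_induction_on with
  | _ k ih =>
    refine Metric.tendsto_nhds.2 fun δ hδ => ?_
    obtain ⟨t, ht, htδ⟩ : ∃ t ∈ Set.Ioc (0 : ℝ) 1, 2 * t < δ / 2 + δ / 4 := by
      refine ⟨min 1 (δ / 4), ⟨lt_min one_pos (by linarith), min_le_left _ _⟩, ?_⟩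
      linarith [min_le_right 1 (δ / 4)]
    have htk : 0 < t ^ k := pow_pos ht.1 k
    have hsum : Tendsto (fun n => (G n t - G' t) - ∑ i ∈ Finset.range k, (c n i - c' i) * t ^ i)
        atTop (nhds 0) := by
      rw [← sub_zero (0 : ℝ)]
      refine Tendsto.sub (by simpa using (hlim t ht).sub_const (G' t)) ?_
      rw [← Finset.sum_const_zero (s := Finset.range k)]
      refine tendsto_finsetSum _ fun i hi => ?_
      simpa using ((ih i (Finset.mem_range.1 hi)).sub_const (c' i)).mul_const (t ^ i)
    have habs := hsum.abs
    rw [abs_zero] at habs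
    filter_upwards [habs.eventually_lt_const (show 0 < t ^ k * (δ / 4) by positivity)] with n hn
    have h1 := hG n k t ht
    have h2 := hG' k t ht
    rw [Finset.sum_range_succ] at h1 h2
    have h3 : t ^ k * (c n k - c' k) =
        ((G n t - G' t) - ∑ i ∈ Finset.range k, (c n i - c' i) * t ^ i)
        - (G n t - (∑ i ∈ Finset.range k, c n i * t ^ i + c n k * t ^ k))
        + (G' t - (∑ i ∈ Finset.range k, c' i * t ^ i + c' k * t ^ k)) := by
      simp only [sub_mul, Finset.sum_sub_distrib]
      ring
    have h4 : |t ^ k * (c n k - c' k)| ≤ t ^ k * (δ / 4) + t ^ (k + 1) + t ^ (k + 1) := by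
      rw [h3]
      exact (abs_add_le _ _).trans
        (add_le_add ((abs_sub _ _).trans (add_le_add hn.le h1)) h2)
    rw [abs_mul, abs_of_pos htk] at h4
    rw [Real.dist_eq]
    have h5 : t ^ k * |c n k - c' k| ≤ t ^ k * (δ / 4 + 2 * t) := by
      refine h4.trans_eq ?_
      ring
    have := le_of_mul_le_mul_left h5 htk
    linarith

theorem abs_tsum_mul_pow_sub_sum_le {q : ℕ → ℝ} (hq0 : ∀ i, 0 ≤ q i) (hq : HasSum q 1) {F t : ℝ}
    (ht : t ∈ Set.Icc (0 : ℝ) 1) (hF : HasSum (fun i => q i * t ^ i) F) (k : ℕ) :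
    |F - ∑ i ∈ Finset.range k, q i * t ^ i| ≤ t ^ k := by
  have h1 := (hasSum_nat_add_iff' k).2 hq
  have h2 := (hasSum_nat_add_iff' k).2 hF
  have h0 : 0 ≤ F - ∑ i ∈ Finset.range k, q i * t ^ i :=
    h2.nonneg fun i => mul_nonneg (hq0 _) (pow_nonneg ht.1 _)
  rw [abs_of_nonneg h0]
  have h3 := hasSum_le (fun i => ?_) h2 (h1.mul_right (t ^ k))
  · refine h3.trans (mul_le_of_le_one_left (pow_nonneg ht.1 k) ?_)
    have : 0 ≤ ∑ i ∈ Finset.range k, q i := Finset.sum_nonneg fun i _ => hq0 i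
    linarith
  · exact mul_le_mul_of_nonneg_left (pow_le_pow_of_le_one ht.1 ht.2 (Nat.le_add_left k i)) (hq0 _)

/-- The Poisson weights as real numbers. -/
noncomputable def poissonWeight (k : ℕ) (μ : ℝ) : ℝ := Real.exp (-μ) * μ ^ k / (Nat.factorial k)

theorem measurable_poissonWeight (k : ℕ) : Measurable (poissonWeight k) := by
  unfold poissonWeight
  fun_prop

theorem poissonWeight_nonneg (k : ℕ) {μ : ℝ} (hμ : 0 ≤ μ) : 0 ≤ poissonWeight k μ := by
  unfold poissonWeight
  positivity

theorem hasSum_poissonWeight_mul_pow (μ t : ℝ) :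
    HasSum (fun i => poissonWeight i μ * t ^ i) (Real.exp (-(μ * (1 - t)))) := by
  have h := (NormedSpace.expSeries_div_hasSum_exp (μ * t)).mul_left (Real.exp (-μ))
  rw [← Real.exp_eq_exp_ℝ, ← Real.exp_add] at h
  convert! h using 2
  · unfold poissonWeight
    rw [mul_pow]
    ring
  · ring

theorem hasSum_poissonWeight (μ : ℝ) : HasSum (fun i => poissonWeight i μ) 1 := by
  simpa using hasSum_poissonWeight_mul_pow μ 1

theorem poissonWeight_mem_Icc (k : ℕ) {μ : ℝ} (hμ : 0 ≤ μ) :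
    poissonWeight k μ ∈ Set.Icc (0 : ℝ) 1 :=
  ⟨poissonWeight_nonneg k hμ,
    le_hasSum (hasSum_poissonWeight μ) k fun i _ => poissonWeight_nonneg i hμ⟩

theorem abs_pow_sub_sum_le (N k : ℕ) {t : ℝ} (ht : t ∈ Set.Icc (0 : ℝ) 1) :
    |t ^ N - ∑ i ∈ Finset.range k, (if N = i then (1 : ℝ) else 0) * t ^ i| ≤ t ^ k := by
  refine abs_tsum_mul_pow_sub_sum_le (q := fun i => if N = i then (1 : ℝ) else 0)
    (fun i => by split_ifs <;> simp) ?_ ht ?_ k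
  · simpa [eq_comm] using hasSum_ite_eq N (1 : ℝ)
  · have h : (fun i => (if N = i then (1 : ℝ) else 0) * t ^ i) =
        fun i => if i = N then t ^ N else 0 := by
      funext i
      by_cases hi : i = N
      · simp [hi]
      · simp [hi, Ne.symm hi]
    rw [h]
    exact hasSum_ite_eq N _

theorem abs_integral_mul_sub_sum_le {Ω : Type*} [MeasurableSpace Ω] {P : Measure Ω}
    [IsProbabilityMeasure P] {R F : Ω → ℝ} {q : ℕ → Ω → ℝ} (hR : Measurable R)
    (hR01 : ∀ ω, R ω ∈ Set.Icc (0 : ℝ) 1) (hF : Measurable F) (hF01 : ∀ ω, F ω ∈ Set.Icc (0 : ℝ) 1)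
    (hq : ∀ i, Measurable (q i)) (hq01 : ∀ i ω, q i ω ∈ Set.Icc (0 : ℝ) 1) {t : ℝ} {k : ℕ}
    (h : ∀ ω, |F ω - ∑ i ∈ Finset.range k, q i ω * t ^ i| ≤ t ^ k) :
    |∫ ω, R ω * F ω ∂P - ∑ i ∈ Finset.range k, (∫ ω, R ω * q i ω ∂P) * t ^ i| ≤ t ^ k := by
  have hInt : ∀ G : Ω → ℝ, Measurable G → (∀ ω, G ω ∈ Set.Icc (0 : ℝ) 1) →
      Integrable (fun ω => R ω * G ω) P := fun G hG hG01 => by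
    refine Integrable.of_bound (hR.mul hG).aestronglyMeasurable 1 (ae_of_all P fun ω => ?_)
    rw [Real.norm_eq_abs, abs_of_nonneg (mul_nonneg (hR01 ω).1 (hG01 ω).1)]
    exact mul_le_one₀ (hR01 ω).2 (hG01 ω).1 (hG01 ω).2
  simp_rw [← integral_mul_const]
  rw [← integral_finsetSum _ fun i _ => (hInt _ (hq i) (hq01 i)).mul_const _,
    ← integral_sub (hInt F hF hF01)
      (integrable_finsetSum _ fun i _ => (hInt _ (hq i) (hq01 i)).mul_const _)]
  rw [← mul_one (t ^ k), ← probReal_univ (μ := P), ← Real.norm_eq_abs]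
  refine norm_integral_le_of_norm_le_const (ae_of_all P fun ω => ?_)
  have : R ω * F ω - ∑ i ∈ Finset.range k, R ω * q i ω * t ^ i =
      R ω * (F ω - ∑ i ∈ Finset.range k, q i ω * t ^ i) := by
    rw [mul_sub, Finset.mul_sum]
    simp only [mul_assoc]
  rw [Real.norm_eq_abs, this, abs_mul, abs_of_nonneg (hR01 ω).1]
  exact (mul_le_of_le_one_left (abs_nonneg _) (hR01 ω).2).trans (h ω)

/-- Convergence of weighted probability generating functions to those of a mixed Poisson law implies
convergence of the weighted point probabilities. -/
theorem tendsto_integral_mul_ite_of_tendsto_pgf {Ω Ω' : Type*} [MeasurableSpace Ω]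
    [MeasurableSpace Ω'] {P : Measure Ω} [IsProbabilityMeasure P] {P' : Measure Ω'}
    [IsProbabilityMeasure P'] {R : ℕ → Ω → ℝ} {N : ℕ → Ω → ℕ} {R' μ : Ω' → ℝ}
    (hR : ∀ n, Measurable (R n)) (hR01 : ∀ n ω, R n ω ∈ Set.Icc (0 : ℝ) 1)
    (hN : ∀ n, Measurable (N n)) (hR' : Measurable R') (hR'01 : ∀ ω, R' ω ∈ Set.Icc (0 : ℝ) 1)
    (hμ : Measurable μ) (hμ0 : ∀ ω, 0 ≤ μ ω)
    (h : ∀ t ∈ Set.Ioc (0 : ℝ) 1, Tendsto (fun n => ∫ ω, R n ω * t ^ N n ω ∂P) atTop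
      (nhds (∫ ω, R' ω * Real.exp (-(μ ω * (1 - t))) ∂P'))) (k : ℕ) :
    Tendsto (fun n => ∫ ω, R n ω * (if N n ω = k then (1 : ℝ) else 0) ∂P) atTop
      (nhds (∫ ω, R' ω * poissonWeight k (μ ω) ∂P')) := by
  refine tendsto_coeff_of_tendsto_of_remainder_le
    (c := fun n k => ∫ ω, R n ω * (if N n ω = k then (1 : ℝ) else 0) ∂P)
    (c' := fun k => ∫ ω, R' ω * poissonWeight k (μ ω) ∂P') (fun n k t ht => ?_)
    (fun k t ht => ?_) h k
  · refine abs_integral_mul_sub_sum_le (hR n) (hR01 n) ?_ (fun ω => ⟨pow_nonneg ht.1.le _,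
      pow_le_one₀ ht.1.le ht.2⟩) (fun i => ?_) (fun i ω => by split_ifs <;> simp)
      fun ω => abs_pow_sub_sum_le _ _ ⟨ht.1.le, ht.2⟩
    · exact (measurable_from_nat (f := fun m => t ^ m)).comp (hN n)
    · exact Measurable.ite (hN n (measurableSet_singleton i)) measurable_const measurable_const
  · refine abs_integral_mul_sub_sum_le hR' hR'01 (by fun_prop) (fun ω => ⟨(Real.exp_pos _).le, ?_⟩)
      (fun i => (measurable_poissonWeight i).comp hμ) (fun i ω => poissonWeight_mem_Icc i (hμ0 ω))
      fun ω => abs_tsum_mul_pow_sub_sum_le (fun i => poissonWeight_nonneg i (hμ0 ω))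
        (hasSum_poissonWeight _) ⟨ht.1.le, ht.2⟩ (hasSum_poissonWeight_mul_pow _ t) _
    rw [Real.exp_le_one_iff]
    have := mul_nonneg (hμ0 ω) (sub_nonneg.2 ht.2)
    linarith

/-- Joint version for four counting variables. -/
theorem tendsto_measureReal_of_tendsto_pgf {Ω Ω' : Type*} [MeasurableSpace Ω]
    [MeasurableSpace Ω'] {P : Measure Ω} [IsProbabilityMeasure P] {P' : Measure Ω'}
    [IsProbabilityMeasure P'] {N : Fin 4 → ℕ → Ω → ℕ} {μ : Fin 4 → Ω' → ℝ}
    (hN : ∀ i n, Measurable (N i n)) (hμ : ∀ i, Measurable (μ i)) (hμ0 : ∀ i ω, 0 ≤ μ i ω)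
    (h : ∀ t : Fin 4 → ℝ, (∀ i, t i ∈ Set.Ioc (0 : ℝ) 1) →
      Tendsto (fun n => ∫ ω, ∏ i, t i ^ N i n ω ∂P) atTop
        (nhds (∫ ω, ∏ i, Real.exp (-(μ i ω * (1 - t i))) ∂P'))) (k : Fin 4 → ℕ) :
    Tendsto (fun n => P.real {ω | ∀ i, N i n ω = k i}) atTop
      (nhds (∫ ω, ∏ i, poissonWeight (k i) (μ i ω) ∂P')) := by
  have mpow : ∀ (t : ℝ) i n, Measurable fun ω => t ^ N i n ω := fun t i n =>
    (measurable_from_nat (f := fun m => t ^ m)).comp (hN i n)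
  have mite : ∀ i n, Measurable fun ω => if N i n ω = k i then (1 : ℝ) else 0 := fun i n =>
    Measurable.ite (hN i n (measurableSet_singleton (k i))) measurable_const measurable_const
  have mexp : ∀ (t : ℝ) i, Measurable fun ω => Real.exp (-(μ i ω * (1 - t))) := fun t i => by
    have := hμ i
    fun_prop
  have mw : ∀ i, Measurable fun ω => poissonWeight (k i) (μ i ω) := fun i =>
    (measurable_poissonWeight _).comp (hμ i)
  have bpow : ∀ t ∈ Set.Ioc (0 : ℝ) 1, ∀ m : ℕ, t ^ m ∈ Set.Icc (0 : ℝ) 1 := fun t ht m =>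
    ⟨pow_nonneg ht.1.le _, pow_le_one₀ ht.1.le ht.2⟩
  have bite : ∀ i n ω, (if N i n ω = k i then (1 : ℝ) else 0) ∈ Set.Icc (0 : ℝ) 1 := fun i n ω => by
    split_ifs <;> simp
  have bexp : ∀ t ∈ Set.Ioc (0 : ℝ) 1, ∀ i ω,
      Real.exp (-(μ i ω * (1 - t))) ∈ Set.Icc (0 : ℝ) 1 := fun t ht i ω => by
    refine ⟨(Real.exp_pos _).le, Real.exp_le_one_iff.2 ?_⟩
    have := mul_nonneg (hμ0 i ω) (sub_nonneg.2 ht.2)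
    linarith
  have bw : ∀ i ω, poissonWeight (k i) (μ i ω) ∈ Set.Icc (0 : ℝ) 1 := fun i ω =>
    poissonWeight_mem_Icc _ (hμ0 i ω)
  have bmul : ∀ {a b : ℝ}, a ∈ Set.Icc (0 : ℝ) 1 → b ∈ Set.Icc (0 : ℝ) 1 →
      a * b ∈ Set.Icc (0 : ℝ) 1 := fun ha hb =>
    ⟨mul_nonneg ha.1 hb.1, mul_le_one₀ ha.2 hb.1 hb.2⟩
  have s0 : ∀ t₁ ∈ Set.Ioc (0 : ℝ) 1, ∀ t₂ ∈ Set.Ioc (0 : ℝ) 1, ∀ t₃ ∈ Set.Ioc (0 : ℝ) 1,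
      ∀ t₀ ∈ Set.Ioc (0 : ℝ) 1,
      Tendsto (fun n => ∫ ω, t₁ ^ N 1 n ω * t₂ ^ N 2 n ω * t₃ ^ N 3 n ω * t₀ ^ N 0 n ω ∂P) atTop
        (nhds (∫ ω, Real.exp (-(μ 1 ω * (1 - t₁))) * Real.exp (-(μ 2 ω * (1 - t₂))) *
          Real.exp (-(μ 3 ω * (1 - t₃))) * Real.exp (-(μ 0 ω * (1 - t₀))) ∂P')) := by
    intro t₁ h₁ t₂ h₂ t₃ h₃ t₀ h₀
    have := h ![t₀, t₁, t₂, t₃] (fun i => by fin_cases i <;> assumption)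
    simp only [Fin.prod_univ_four] at this
    convert! this using 1
    · funext n
      congr 1
      funext ω
      simp only [Matrix.cons_val]
      ring
    · congr 2
      funext ω
      simp only [Matrix.cons_val]
      ring
  have s1 : ∀ t₁ ∈ Set.Ioc (0 : ℝ) 1, ∀ t₂ ∈ Set.Ioc (0 : ℝ) 1, ∀ t₃ ∈ Set.Ioc (0 : ℝ) 1,
      Tendsto (fun n => ∫ ω, t₁ ^ N 1 n ω * t₂ ^ N 2 n ω * t₃ ^ N 3 n ω *
        (if N 0 n ω = k 0 then (1 : ℝ) else 0) ∂P) atTop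
        (nhds (∫ ω, Real.exp (-(μ 1 ω * (1 - t₁))) * Real.exp (-(μ 2 ω * (1 - t₂))) *
          Real.exp (-(μ 3 ω * (1 - t₃))) * poissonWeight (k 0) (μ 0 ω) ∂P')) := by
    intro t₁ h₁ t₂ h₂ t₃ h₃
    exact tendsto_integral_mul_ite_of_tendsto_pgf
      (fun n => ((mpow _ _ _).mul (mpow _ _ _)).mul (mpow _ _ _))
      (fun n ω => bmul (bmul (bpow _ h₁ _) (bpow _ h₂ _)) (bpow _ h₃ _)) (hN 0)
      (((mexp _ _).mul (mexp _ _)).mul (mexp _ _))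
      (fun ω => bmul (bmul (bexp _ h₁ _ _) (bexp _ h₂ _ _)) (bexp _ h₃ _ _)) (hμ 0) (hμ0 0)
      (s0 t₁ h₁ t₂ h₂ t₃ h₃) (k 0)
  have s2 : ∀ t₂ ∈ Set.Ioc (0 : ℝ) 1, ∀ t₃ ∈ Set.Ioc (0 : ℝ) 1,
      Tendsto (fun n => ∫ ω, t₂ ^ N 2 n ω * t₃ ^ N 3 n ω * (if N 0 n ω = k 0 then (1 : ℝ) else 0) *
        (if N 1 n ω = k 1 then (1 : ℝ) else 0) ∂P) atTop
        (nhds (∫ ω, Real.exp (-(μ 2 ω * (1 - t₂))) *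
          Real.exp (-(μ 3 ω * (1 - t₃))) * poissonWeight (k 0) (μ 0 ω) *
          poissonWeight (k 1) (μ 1 ω) ∂P')) := by
    intro t₂ h₂ t₃ h₃
    refine tendsto_integral_mul_ite_of_tendsto_pgf
      (fun n => ((mpow _ _ _).mul (mpow _ _ _)).mul (mite 0 n))
      (fun n ω => bmul (bmul (bpow _ h₂ _) (bpow _ h₃ _)) (bite 0 n ω)) (hN 1)
      (((mexp _ _).mul (mexp _ _)).mul (mw 0))
      (fun ω => bmul (bmul (bexp _ h₂ _ _) (bexp _ h₃ _ _)) (bw 0 ω)) (hμ 1) (hμ0 1)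
      (fun t ht => ?_) (k 1)
    convert! s1 t ht t₂ h₂ t₃ h₃ using 1
    · funext n; congr 1; funext ω; simp only [Pi.mul_apply]; ring
    · congr 2; funext ω; simp only [Pi.mul_apply]; ring
  have s3 : ∀ t₃ ∈ Set.Ioc (0 : ℝ) 1,
      Tendsto (fun n => ∫ ω, t₃ ^ N 3 n ω * (if N 0 n ω = k 0 then (1 : ℝ) else 0) *
        (if N 1 n ω = k 1 then (1 : ℝ) else 0) * (if N 2 n ω = k 2 then (1 : ℝ) else 0) ∂P) atTop
        (nhds (∫ ω, Real.exp (-(μ 3 ω * (1 - t₃))) * poissonWeight (k 0) (μ 0 ω) *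
          poissonWeight (k 1) (μ 1 ω) * poissonWeight (k 2) (μ 2 ω) ∂P')) := by
    intro t₃ h₃
    refine tendsto_integral_mul_ite_of_tendsto_pgf
      (fun n => ((mpow _ _ _).mul (mite 0 n)).mul (mite 1 n))
      (fun n ω => bmul (bmul (bpow _ h₃ _) (bite 0 n ω)) (bite 1 n ω)) (hN 2)
      (((mexp _ _).mul (mw 0)).mul (mw 1))
      (fun ω => bmul (bmul (bexp _ h₃ _ _) (bw 0 ω)) (bw 1 ω)) (hμ 2) (hμ0 2)
      (fun t ht => ?_) (k 2)
    convert! s2 t ht t₃ h₃ using 1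
    · funext n; congr 1; funext ω; simp only [Pi.mul_apply]; ring
    · congr 2; funext ω; simp only [Pi.mul_apply]; ring
  have s4 : Tendsto (fun n => ∫ ω, (if N 0 n ω = k 0 then (1 : ℝ) else 0) *
        (if N 1 n ω = k 1 then (1 : ℝ) else 0) * (if N 2 n ω = k 2 then (1 : ℝ) else 0) *
        (if N 3 n ω = k 3 then (1 : ℝ) else 0) ∂P) atTop
        (nhds (∫ ω, poissonWeight (k 0) (μ 0 ω) *
          poissonWeight (k 1) (μ 1 ω) * poissonWeight (k 2) (μ 2 ω) *
          poissonWeight (k 3) (μ 3 ω) ∂P')) := by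
    refine tendsto_integral_mul_ite_of_tendsto_pgf
      (fun n => ((mite 0 n).mul (mite 1 n)).mul (mite 2 n))
      (fun n ω => bmul (bmul (bite 0 n ω) (bite 1 n ω)) (bite 2 n ω)) (hN 3)
      (((mw 0).mul (mw 1)).mul (mw 2))
      (fun ω => bmul (bmul (bw 0 ω) (bw 1 ω)) (bw 2 ω)) (hμ 3) (hμ0 3)
      (fun t ht => ?_) (k 3)
    convert! s3 t ht using 1
    · funext n; congr 1; funext ω; simp only [Pi.mul_apply]; ring
    · congr 2; funext ω; simp only [Pi.mul_apply]; ring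
  simp only [Fin.prod_univ_four]
  refine s4.congr fun n => ?_
  have hm : MeasurableSet {ω | ∀ i, N i n ω = k i} := by
    rw [Set.ofPred_forall]
    exact MeasurableSet.iInter fun i => hN i n (measurableSet_singleton (k i))
  have hind := integral_indicator_const (μ := P) (1 : ℝ) hm
  rw [smul_eq_mul, mul_one] at hind
  rw [← hind]
  congr 1
  funext ω
  simp only [Set.indicator_apply, Set.mem_ofPred_eq, Fin.forall_fin_succ]
  by_cases h0 : N 0 n ω = k 0 <;> by_cases h1 : N 1 n ω = k 1 <;> by_cases h2 : N 2 n ω = k 2 <;>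
    by_cases h3 : N 3 n ω = k 3 <;> simp [Fin.succ, *]

theorem abs_exp_neg_sub_exp_neg_le {a b : ℝ} (ha : 0 ≤ a) (hb : 0 ≤ b) :
    |Real.exp (-a) - Real.exp (-b)| ≤ |a - b| := by
  wlog hab : a ≤ b generalizing a b
  · rw [abs_sub_comm, abs_sub_comm a]
    exact this hb ha (le_of_not_ge hab)
  rw [abs_of_nonneg (sub_nonneg.2 (Real.exp_le_exp.2 (neg_le_neg hab))),
    abs_of_nonpos (sub_nonpos.2 hab)]
  have h1 : Real.exp (-b) = Real.exp (-a) * Real.exp (-(b - a)) := by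
    rw [← Real.exp_add]; congr 1; ring
  have h2 := Real.add_one_le_exp (-(b - a))
  have h3 : Real.exp (-a) ≤ 1 := Real.exp_le_one_iff.2 (by linarith)
  have h4 := Real.exp_pos (-a)
  rw [h1]
  nlinarith [Real.exp_pos (-(b - a))]

theorem tendsto_neg_natCast_mul_log {K : ℕ → ℝ} {c : ℝ}
    (h : Tendsto (fun n : ℕ => (n : ℝ) * (1 - K n)) atTop (nhds c)) :
    Tendsto (fun n : ℕ => -((n : ℝ) * Real.log (K n))) atTop (nhds c) := by
  have h1 : Tendsto (fun n : ℕ => (n : ℝ) * (K n - 1)) atTop (nhds (-c)) := by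
    refine h.neg.congr fun n => ?_
    ring
  have h2 := (Real.tendsto_nat_mul_log_one_add_of_tendsto h1).neg
  rw [neg_neg] at h2
  refine h2.congr fun n => ?_
  rw [add_sub_cancel]

theorem eventually_pos_of_tendsto_natCast_mul_one_sub {K : ℕ → ℝ} {c : ℝ}
    (h : Tendsto (fun n : ℕ => (n : ℝ) * (1 - K n)) atTop (nhds c)) : ∀ᶠ n in atTop, 0 < K n := by
  have h1 : Tendsto (fun n : ℕ => ((n : ℝ) * (1 - K n)) * (n : ℝ)⁻¹) atTop (nhds (c * 0)) :=
    h.mul tendsto_inv_atTop_nhds_zero_nat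
  rw [mul_zero] at h1
  filter_upwards [h1.eventually_lt_const one_pos, eventually_gt_atTop 0] with n hn hn0
  have hn0' : (n : ℝ) ≠ 0 := by positivity
  rw [mul_assoc, mul_comm (1 - K n), ← mul_assoc, mul_inv_cancel₀ hn0'] at hn
  linarith

section

variable {Ω : Type*} [MeasurableSpace Ω] {P : Measure Ω} [IsProbabilityMeasure P]

theorem integrable_of_measurable_of_abs_le_one {f : Ω → ℝ} (hf : Measurable f)
    (hb : ∀ ω, |f ω| ≤ 1) : Integrable f P :=
  Integrable.of_bound hf.aestronglyMeasurable 1 (Eventually.of_forall hb)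

theorem tendsto_integral_pow_mul_pow {K K' : ℕ → ℝ} {c c' : ℝ}
    (hK : ∀ n, K n ∈ Set.Icc (0 : ℝ) 1) (hK' : ∀ n, K' n ∈ Set.Icc (0 : ℝ) 1)
    (hc : Tendsto (fun n : ℕ => (n : ℝ) * (1 - K n)) atTop (nhds c))
    (hc' : Tendsto (fun n : ℕ => (n : ℝ) * (1 - K' n)) atTop (nhds c'))
    {M M' : ℕ → Ω → ℕ} (hM : ∀ n, Measurable (M n)) (hM' : ∀ n, Measurable (M' n))
    (hMn : ∀ n ω, M n ω ≤ n) (hMn' : ∀ n ω, M' n ω ≤ n) {A A' : Ω → ℝ} (hA : Measurable A)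
    (hA' : Measurable A')
    (hA01 : ∀ ω, A ω ∈ Set.Icc (0 : ℝ) 1) (hA01' : ∀ ω, A' ω ∈ Set.Icc (0 : ℝ) 1)
    (h : Tendsto (fun n : ℕ => ∫ ω, |(M n ω : ℝ) / n - A ω| ∂P) atTop (nhds 0))
    (h' : Tendsto (fun n : ℕ => ∫ ω, |(M' n ω : ℝ) / n - A' ω| ∂P) atTop (nhds 0)) :
    Tendsto (fun n => ∫ ω, K n ^ M n ω * K' n ^ M' n ω ∂P) atTop
      (nhds (∫ ω, Real.exp (-(A ω * c + A' ω * c')) ∂P)) := by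
  have hl := tendsto_neg_natCast_mul_log hc
  have hl' := tendsto_neg_natCast_mul_log hc'
  set l : ℕ → ℝ := fun n => -((n : ℝ) * Real.log (K n)) with hl_def
  set l' : ℕ → ℝ := fun n => -((n : ℝ) * Real.log (K' n)) with hl_def'
  have hl0 : ∀ n, 0 ≤ l n := fun n => by
    have := Real.log_nonpos (hK n).1 (hK n).2
    have := mul_nonpos_of_nonneg_of_nonpos (Nat.cast_nonneg (α := ℝ) n) this
    simp only [hl_def]; linarith
  have hl0' : ∀ n, 0 ≤ l' n := fun n => by
    have := Real.log_nonpos (hK' n).1 (hK' n).2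
    have := mul_nonpos_of_nonneg_of_nonpos (Nat.cast_nonneg (α := ℝ) n) this
    simp only [hl_def']; linarith
  have hc0 : 0 ≤ c := ge_of_tendsto' hl hl0
  have hc0' : 0 ≤ c' := ge_of_tendsto' hl' hl0'
  have hdiv : ∀ n m : ℕ, m ≤ n → (m : ℝ) / n ∈ Set.Icc (0 : ℝ) 1 := fun n m hmn =>
    ⟨by positivity, div_le_one_of_le₀ (by exact_mod_cast hmn) (by positivity)⟩
  have hmD : ∀ n, Measurable fun ω => |(M n ω : ℝ) / n - A ω| := fun n =>
    (((measurable_from_nat.comp (hM n)).div_const _).sub hA).abs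
  have hmD' : ∀ n, Measurable fun ω => |(M' n ω : ℝ) / n - A' ω| := fun n =>
    (((measurable_from_nat.comp (hM' n)).div_const _).sub hA').abs
  have hiD : ∀ n, Integrable (fun ω => |(M n ω : ℝ) / n - A ω|) P := fun n =>
    integrable_of_measurable_of_abs_le_one (hmD n) fun ω => by
      rw [abs_abs]
      have := hdiv n _ (hMn n ω)
      exact abs_le.2 ⟨by linarith [this.1, (hA01 ω).2], by linarith [this.2, (hA01 ω).1]⟩
  have hiD' : ∀ n, Integrable (fun ω => |(M' n ω : ℝ) / n - A' ω|) P := fun n =>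
    integrable_of_measurable_of_abs_le_one (hmD' n) fun ω => by
      rw [abs_abs]
      have := hdiv n _ (hMn' n ω)
      exact abs_le.2 ⟨by linarith [this.1, (hA01' ω).2], by linarith [this.2, (hA01' ω).1]⟩
  have hbound : Tendsto (fun n => ((∫ ω, |(M n ω : ℝ) / n - A ω| ∂P) * l n + |l n - c|) +
      ((∫ ω, |(M' n ω : ℝ) / n - A' ω| ∂P) * l' n + |l' n - c'|)) atTop (nhds 0) := by
    have h1 := (h.mul hl).add (hl.sub_const c).abs
    have h2 := (h'.mul hl').add (hl'.sub_const c').abs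
    simpa using h1.add h2
  rw [tendsto_iff_norm_sub_tendsto_zero]
  refine squeeze_zero' (Eventually.of_forall fun n => norm_nonneg _) ?_ hbound
  filter_upwards [eventually_pos_of_tendsto_natCast_mul_one_sub hc,
    eventually_pos_of_tendsto_natCast_mul_one_sub hc', eventually_gt_atTop 0] with n hKn hKn' hn
  have hpow : ∀ {k : ℝ} (m : ℕ), 0 < k →
      k ^ m = Real.exp (-((m : ℝ) / n * -((n : ℝ) * Real.log k))) := by
    intro k m hk
    have hn' : (n : ℝ) ≠ 0 := by positivity
    rw [← Real.rpow_natCast, Real.rpow_def_of_pos hk]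
    congr 1
    field_simp
  have hmK : Measurable fun ω => K n ^ M n ω * K' n ^ M' n ω :=
    (measurable_from_nat.comp (hM n)).mul (measurable_from_nat.comp (hM' n))
  have hmE : Measurable fun ω => Real.exp (-(A ω * c + A' ω * c')) :=
    (((hA.mul_const c).add (hA'.mul_const c')).neg).exp
  have hiK : Integrable (fun ω => K n ^ M n ω * K' n ^ M' n ω) P :=
    integrable_of_measurable_of_abs_le_one hmK fun ω => by
      rw [abs_mul, abs_of_nonneg (pow_nonneg hKn.le _), abs_of_nonneg (pow_nonneg hKn'.le _)]
      exact mul_le_one₀ (pow_le_one₀ (hK n).1 (hK n).2) (pow_nonneg hKn'.le _)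
        (pow_le_one₀ (hK' n).1 (hK' n).2)
  have hiE : Integrable (fun ω => Real.exp (-(A ω * c + A' ω * c'))) P :=
    integrable_of_measurable_of_abs_le_one hmE fun ω => by
      rw [abs_of_pos (Real.exp_pos _)]
      have := mul_nonneg (hA01 ω).1 hc0
      have := mul_nonneg (hA01' ω).1 hc0'
      exact Real.exp_le_one_iff.2 (by linarith)
  have hi1 : Integrable (fun ω => |(M n ω : ℝ) / n - A ω| * l n + |l n - c|) P :=
    ((hiD n).mul_const _).add (integrable_const _)
  have hi2 : Integrable (fun ω => |(M' n ω : ℝ) / n - A' ω| * l' n + |l' n - c'|) P :=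
    ((hiD' n).mul_const _).add (integrable_const _)
  rw [← integral_sub hiK hiE]
  have hInt : ∫ ω, ((|(M n ω : ℝ) / n - A ω| * l n + |l n - c|) +
      (|(M' n ω : ℝ) / n - A' ω| * l' n + |l' n - c'|)) ∂P =
      ((∫ ω, |(M n ω : ℝ) / n - A ω| ∂P) * l n + |l n - c|) +
      ((∫ ω, |(M' n ω : ℝ) / n - A' ω| ∂P) * l' n + |l' n - c'|) := by
    rw [integral_add hi1 hi2, integral_add ((hiD n).mul_const _) (integrable_const _),
      integral_add ((hiD' n).mul_const _) (integrable_const _)]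
    simp [integral_mul_const]
  rw [← hInt]
  refine norm_integral_le_of_norm_le (hi1.add hi2) (Eventually.of_forall fun ω => ?_)
  rw [Real.norm_eq_abs, hpow (M n ω) hKn, hpow (M' n ω) hKn', ← Real.exp_add, ← neg_add]
  have hMd := hdiv n _ (hMn n ω)
  have hMd' := hdiv n _ (hMn' n ω)
  change |Real.exp (-((M n ω : ℝ) / n * l n + (M' n ω : ℝ) / n * l' n)) - _| ≤ _
  refine (abs_exp_neg_sub_exp_neg_le
    (add_nonneg (mul_nonneg hMd.1 (hl0 n)) (mul_nonneg hMd'.1 (hl0' n)))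
    (add_nonneg (mul_nonneg (hA01 ω).1 hc0) (mul_nonneg (hA01' ω).1 hc0'))).trans ?_
  have hsplit : ∀ {d a l c : ℝ}, a ∈ Set.Icc (0 : ℝ) 1 → 0 ≤ l →
      |d * l - a * c| ≤ |d - a| * l + |l - c| := by
    intro d a l c ha hl
    calc |d * l - a * c| = |(d - a) * l + a * (l - c)| := by ring_nf
      _ ≤ |(d - a) * l| + |a * (l - c)| := abs_add_le _ _
      _ ≤ |d - a| * l + |l - c| := by
        rw [abs_mul, abs_mul, abs_of_nonneg hl, abs_of_nonneg ha.1]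
        exact add_le_add le_rfl (mul_le_of_le_one_left (abs_nonneg _) ha.2)
  calc _ = |((M n ω : ℝ) / n * l n - A ω * c) + ((M' n ω : ℝ) / n * l' n - A' ω * c')| := by
        ring_nf
    _ ≤ _ := abs_add_le _ _
    _ ≤ _ := add_le_add (hsplit (hA01 ω) (hl0 n)) (hsplit (hA01' ω) (hl0' n))

theorem integral_comp_prodMk_of_indepFun {α β : Type*} [MeasurableSpace α] [MeasurableSpace β]
    {U : Ω → α} {V : Ω → β} (hU : Measurable U) (hV : Measurable V) (h : IndepFun U V P)
    {F : α → β → ℝ} (hF : Measurable (Function.uncurry F)) (hb : ∀ a b, |F a b| ≤ 1) :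
    ∫ ω, F (U ω) (V ω) ∂P = ∫ ω', ∫ ω, F (U ω) (V ω') ∂P ∂P := by
  have := Measure.isProbabilityMeasure_map (μ := P) hU.aemeasurable
  have := Measure.isProbabilityMeasure_map (μ := P) hV.aemeasurable
  have h1 := (indepFun_iff_map_prod_eq_prod_map_map hU.aemeasurable hV.aemeasurable).1 h
  have hi : Integrable (Function.uncurry F) ((P.map U).prod (P.map V)) :=
    integrable_of_measurable_of_abs_le_one hF fun p => hb p.1 p.2
  calc ∫ ω, F (U ω) (V ω) ∂P = ∫ p, Function.uncurry F p ∂(P.map fun ω => (U ω, V ω)) :=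
        (integral_map (hU.prodMk hV).aemeasurable hF.aestronglyMeasurable).symm
    _ = ∫ v, ∫ u, Function.uncurry F (u, v) ∂(P.map U) ∂(P.map V) := by
        rw [h1, integral_prod_symm _ hi]
    _ = ∫ ω', ∫ u, Function.uncurry F (u, V ω') ∂(P.map U) ∂P :=
        integral_map hV.aemeasurable
          (hF.stronglyMeasurable.integral_prod_left').aestronglyMeasurable
    _ = ∫ ω', ∫ ω, F (U ω) (V ω') ∂P ∂P := by
        congr 1
        funext ω'
        exact integral_map hU.aemeasurable
          (hF.comp (measurable_id.prodMk measurable_const)).aestronglyMeasurable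

end

/-- The weight of an index with mark `e`: `s` or `s'` according to the mark if the index is
selected by `p`, and `1` otherwise. -/
noncomputable def markWeight (p : Prop) (s s' : ℝ) (e : Bool) : ℝ :=
  if p then (if e = true then s else s') else 1

theorem markWeight_mem_Icc (p : Prop) {s s' : ℝ} (hs : s ∈ Set.Icc (0 : ℝ) 1)
    (hs' : s' ∈ Set.Icc (0 : ℝ) 1) (e : Bool) : markWeight p s s' e ∈ Set.Icc (0 : ℝ) 1 := by
  unfold markWeight
  split_ifs <;> simp_all

theorem prod_markWeight {κ : Type*} (S : Finset κ) (p : κ → Prop) (e : κ → Bool) (a b : ℝ) :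
    ∏ j ∈ S, markWeight (p j) a b (e j) =
      a ^ (S.filter fun j => p j ∧ e j = true).card *
        b ^ (S.filter fun j => p j ∧ e j = false).card := by
  rw [← Finset.prod_const, ← Finset.prod_const, Finset.prod_filter, Finset.prod_filter,
    ← Finset.prod_mul_distrib]
  refine Finset.prod_congr rfl fun j _ => ?_
  by_cases hp : p j <;> cases he : e j <;> simp [markWeight, hp]

/-- The mean of `levelWeight` under the conditional law of a variable of the equicorrelated
sequence given the common factor `z`. -/
noncomputable def conditionalLevelMean (γ x y s t : ℝ) (n : ℕ) (z : ℝ) : ℝ :=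
  ∫ a, levelWeight (un n x) (un n y) s t
    (√(1 - γ / Real.log n) * a + √(γ / Real.log n) * z) ∂(gaussianReal 0 1)

theorem measurable_conditionalLevelMean (γ x y s t : ℝ) (n : ℕ) :
    Measurable (conditionalLevelMean γ x y s t n) := by
  have hm : Measurable (Function.uncurry fun z a : ℝ => levelWeight (un n x) (un n y) s t
      (√(1 - γ / Real.log n) * a + √(γ / Real.log n) * z)) :=
    (measurable_levelWeight _ _ _ _).comp (by fun_prop)
  exact (hm.stronglyMeasurable.integral_prod_right (ν := gaussianReal 0 1)).measurable

theorem conditionalLevelMean_mem_Icc (γ x y : ℝ) {s t : ℝ} (hs : s ∈ Set.Icc (0 : ℝ) 1)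
    (ht : t ∈ Set.Icc (0 : ℝ) 1) (n : ℕ) (z : ℝ) :
    conditionalLevelMean γ x y s t n z ∈ Set.Icc (0 : ℝ) 1 := by
  have hb := fun a : ℝ => levelWeight_mem_Icc hs ht (un n x) (un n y)
    (√(1 - γ / Real.log n) * a + √(γ / Real.log n) * z)
  refine ⟨integral_nonneg fun a => (hb a).1, ?_⟩
  calc conditionalLevelMean γ x y s t n z ≤ ∫ _, (1 : ℝ) ∂(gaussianReal 0 1) :=
        integral_mono_of_nonneg (Eventually.of_forall fun a => (hb a).1) (integrable_const _)
          (Eventually.of_forall fun a => (hb a).2)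
    _ = 1 := by simp

theorem conditionalLevelMean_one_one (γ x y : ℝ) (n : ℕ) (z : ℝ) :
    conditionalLevelMean γ x y 1 1 n z = 1 := by
  simp [conditionalLevelMean, levelWeight]

theorem conditionalLevelMean_markWeight (γ x y : ℝ) (p : Prop) (s t s' t' : ℝ) (e : Bool) (n : ℕ)
    (z : ℝ) :
    conditionalLevelMean γ x y (markWeight p s s' e) (markWeight p t t' e) n z =
      markWeight p (conditionalLevelMean γ x y s t n z)
        (conditionalLevelMean γ x y s' t' n z) e := by
  unfold markWeight
  split_ifs
  · rfl
  · rfl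
  · exact conditionalLevelMean_one_one γ x y n z

theorem measurable_card_filter {Ω κ : Type*} [MeasurableSpace Ω] (S : Finset κ) {p : κ → Ω → Prop}
    [∀ ω, DecidablePred fun j => p j ω] (hp : ∀ j, MeasurableSet {ω | p j ω}) :
    Measurable fun ω => (S.filter fun j => p j ω).card := by
  simp only [Finset.card_filter]
  exact Finset.measurable_sum _ fun j _ =>
    Measurable.ite (hp j) measurable_const measurable_const

theorem tendsto_integral_prod_levelWeight_markWeight
    {Ω : Type*} [MeasurableSpace Ω] {P : Measure Ω} [IsProbabilityMeasure P]
    {X : ℕ → Ω → ℝ} {ε : ℕ → Ω → Bool} {lam : Ω → ℝ} {γ : ℝ}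
    (hγ : 0 ≤ γ) (hXmeas : ∀ n, Measurable (X n)) (hεmeas : ∀ n, Measurable (ε n))
    (hlam : Measurable lam)
    (hGauss : ∀ (m : ℕ) (idx : Fin m → ℕ) (c : Fin m → ℝ), ∃ v : ℝ≥0,
      P.map (fun ω => ∑ i, c i * X (idx i) ω) = gaussianReal 0 v)
    (hstd : ∀ n, P.map (X n) = gaussianReal 0 1)
    (hstat : ∀ (m k : ℕ), P.map (fun ω => fun i : Fin m => X (i.1 + 1 + k) ω) =
      P.map (fun ω => fun i : Fin m => X (i.1 + 1) ω))
    (hr : Tendsto (fun n : ℕ => (∫ ω, X 1 ω * X (n + 1) ω ∂P) * Real.log n)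
      atTop (nhds γ))
    (hindep : IndepFun (fun ω => fun n => X n ω) (fun ω => fun n => ε n ω) P)
    (hlam01 : ∀ ω, lam ω ∈ Set.Icc (0 : ℝ) 1)
    (hS : TendstoInMeasure P
      (fun n ω => (∑ k ∈ Finset.Icc 1 n, (if ε k ω then (1 : ℝ) else 0)) / n) atTop lam)
    {B : Set ℝ} (hBmeas : MeasurableSet B) (hBsub : B ⊆ Set.Ioc 0 1)
    (hBfrontier : volume (frontier B) = 0) {x y : ℝ} (hxy : x ≤ y)
    {s t s' t' : ℝ} (hs : s ∈ Set.Icc (0 : ℝ) 1) (ht : t ∈ Set.Icc (0 : ℝ) 1)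
    (hs' : s' ∈ Set.Icc (0 : ℝ) 1) (ht' : t' ∈ Set.Icc (0 : ℝ) 1) :
    Tendsto (fun n : ℕ => ∫ ω, ∏ j ∈ Finset.Icc 1 n, levelWeight (un n x) (un n y)
        (markWeight ((j : ℝ) / n ∈ B) s s' (ε j ω)) (markWeight ((j : ℝ) / n ∈ B) t t' (ε j ω))
        (X j ω) ∂P) atTop
      (nhds (∫ q, Real.exp (-(lam q.1 * volume.real B *
          ((1 - s) * g γ x q.2 + (s - t) * g γ y q.2) +
        (1 - lam q.1) * volume.real B * ((1 - s') * g γ x q.2 + (s' - t') * g γ y q.2)))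
        ∂(P.prod (gaussianReal 0 1)))) := by
  obtain ⟨Δ, hΔ, hΔn⟩ := exists_tendsto_zero_abs_integral_prod_levelWeight_le hγ hXmeas hGauss hstd
    hstat hr hxy
  obtain ⟨hD, hD'⟩ := tendsto_integral_abs_count_sub hεmeas hlam (Eventually.of_forall hlam01) hS
    hBmeas hBsub hBfrontier
  set M : ℕ → Ω → ℕ := fun n ω =>
    ((Finset.Icc 1 n).filter fun j : ℕ => (j : ℝ) / n ∈ B ∧ ε j ω = true).card with hM_def
  set M' : ℕ → Ω → ℕ := fun n ω =>
    ((Finset.Icc 1 n).filter fun j : ℕ => (j : ℝ) / n ∈ B ∧ ε j ω = false).card with hM_def'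
  have hmM : ∀ n, Measurable (M n) := fun n => measurable_card_filter
    (p := fun (j : ℕ) ω => (j : ℝ) / n ∈ B ∧ ε j ω = true) _ fun j =>
    (MeasurableSet.const _).inter (hεmeas j (measurableSet_singleton true))
  have hmM' : ∀ n, Measurable (M' n) := fun n => measurable_card_filter
    (p := fun (j : ℕ) ω => (j : ℝ) / n ∈ B ∧ ε j ω = false) _ fun j =>
    (MeasurableSet.const _).inter (hεmeas j (measurableSet_singleton false))
  have hMn : ∀ n ω, M n ω ≤ n := fun n ω =>
    (Finset.card_filter_le _ _).trans (by simp)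
  have hMn' : ∀ n ω, M' n ω ≤ n := fun n ω =>
    (Finset.card_filter_le _ _).trans (by simp)
  have hmX : Measurable fun ω => fun n => X n ω := measurable_pi_lambda _ hXmeas
  have hme : Measurable fun ω => fun n => ε n ω := measurable_pi_lambda _ hεmeas
  set K : ℕ → ℝ → ℝ := conditionalLevelMean γ x y s t with hK_def
  set K' : ℕ → ℝ → ℝ := conditionalLevelMean γ x y s' t' with hK_def'
  have hK01 : ∀ n z, K n z ∈ Set.Icc (0 : ℝ) 1 := conditionalLevelMean_mem_Icc γ x y hs ht
  have hK01' : ∀ n z, K' n z ∈ Set.Icc (0 : ℝ) 1 := conditionalLevelMean_mem_Icc γ x y hs' ht'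
  have hbK : ∀ n ω z, |K n z ^ M n ω * K' n z ^ M' n ω| ≤ 1 := fun n ω z => by
    rw [abs_mul, abs_of_nonneg (pow_nonneg (hK01 n z).1 _),
      abs_of_nonneg (pow_nonneg (hK01' n z).1 _)]
    exact mul_le_one₀ (pow_le_one₀ (hK01 n z).1 (hK01 n z).2) (pow_nonneg (hK01' n z).1 _)
      (pow_le_one₀ (hK01' n z).1 (hK01' n z).2)
  have hmK : ∀ n, Measurable (Function.uncurry fun ω z => K n z ^ M n ω * K' n z ^ M' n ω) :=
    fun n => (((measurable_conditionalLevelMean γ x y s t n).comp measurable_snd).pow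
      ((hmM n).comp measurable_fst)).mul
      (((measurable_conditionalLevelMean γ x y s' t' n).comp measurable_snd).pow
      ((hmM' n).comp measurable_fst))
  have hiK : ∀ n, Integrable (Function.uncurry fun ω z => K n z ^ M n ω * K' n z ^ M' n ω)
      (P.prod (gaussianReal 0 1)) := fun n =>
    integrable_of_measurable_of_abs_le_one (hmK n) fun q => hbK n q.1 q.2
  have hlim : Tendsto (fun n => ∫ ω, ∫ z, K n z ^ M n ω * K' n z ^ M' n ω ∂(gaussianReal 0 1) ∂P)
      atTop (nhds (∫ q, Real.exp (-(lam q.1 * volume.real B *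
          ((1 - s) * g γ x q.2 + (s - t) * g γ y q.2) +
        (1 - lam q.1) * volume.real B * ((1 - s') * g γ x q.2 + (s' - t') * g γ y q.2)))
        ∂(P.prod (gaussianReal 0 1)))) := by
    have hV : volume.real B ∈ Set.Icc (0 : ℝ) 1 := by
      refine ⟨measureReal_nonneg, ?_⟩
      calc volume.real B ≤ volume.real (Set.Ioc (0 : ℝ) 1) :=
            measureReal_mono hBsub (by simp)
        _ = 1 := by simp
    have hA01 : ∀ ω, lam ω * volume.real B ∈ Set.Icc (0 : ℝ) 1 := fun ω =>
      ⟨mul_nonneg (hlam01 ω).1 hV.1, mul_le_one₀ (hlam01 ω).2 hV.1 hV.2⟩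
    have hA01' : ∀ ω, (1 - lam ω) * volume.real B ∈ Set.Icc (0 : ℝ) 1 := fun ω =>
      ⟨mul_nonneg (sub_nonneg.2 (hlam01 ω).2) hV.1,
        mul_le_one₀ (sub_le_self _ (hlam01 ω).1) hV.1 hV.2⟩
    have hc : ∀ z, Tendsto (fun n : ℕ => (n : ℝ) * (1 - K n z)) atTop
        (nhds ((1 - s) * g γ x z + (s - t) * g γ y z)) := fun z =>
      tendsto_natCast_mul_one_sub_integral_levelWeight hγ hxy s t z
    have hc' : ∀ z, Tendsto (fun n : ℕ => (n : ℝ) * (1 - K' n z)) atTop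
        (nhds ((1 - s') * g γ x z + (s' - t') * g γ y z)) := fun z =>
      tendsto_natCast_mul_one_sub_integral_levelWeight hγ hxy s' t' z
    have hc0 : ∀ z, 0 ≤ (1 - s) * g γ x z + (s - t) * g γ y z := fun z =>
      ge_of_tendsto' (hc z) fun n =>
        mul_nonneg (Nat.cast_nonneg n) (sub_nonneg.2 (hK01 n z).2)
    have hc0' : ∀ z, 0 ≤ (1 - s') * g γ x z + (s' - t') * g γ y z := fun z =>
      ge_of_tendsto' (hc' z) fun n =>
        mul_nonneg (Nat.cast_nonneg n) (sub_nonneg.2 (hK01' n z).2)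
    have hiE : Integrable (fun q : Ω × ℝ => Real.exp (-(lam q.1 * volume.real B *
          ((1 - s) * g γ x q.2 + (s - t) * g γ y q.2) +
        (1 - lam q.1) * volume.real B * ((1 - s') * g γ x q.2 + (s' - t') * g γ y q.2))))
        (P.prod (gaussianReal 0 1)) := by
      refine integrable_of_measurable_of_abs_le_one (by unfold g; fun_prop) fun q => ?_
      rw [abs_of_pos (Real.exp_pos _)]
      have := mul_nonneg (hA01 q.1).1 (hc0 q.2)
      have := mul_nonneg (hA01' q.1).1 (hc0' q.2)
      exact Real.exp_le_one_iff.2 (by linarith)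
    rw [integral_prod_symm _ hiE]
    have hswap : ∀ n, ∫ ω, ∫ z, K n z ^ M n ω * K' n z ^ M' n ω ∂(gaussianReal 0 1) ∂P =
        ∫ z, ∫ ω, K n z ^ M n ω * K' n z ^ M' n ω ∂P ∂(gaussianReal 0 1) := fun n =>
      integral_integral_swap (hiK n)
    simp only [hswap]
    refine tendsto_integral_of_dominated_convergence (fun _ => 1)
      (fun n => ((hmK n).stronglyMeasurable.integral_prod_left').aestronglyMeasurable)
      (integrable_const 1) (fun n => Eventually.of_forall fun z => ?_)
      (Eventually.of_forall fun z => ?_)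
    · calc ‖∫ ω, K n z ^ M n ω * K' n z ^ M' n ω ∂P‖ ≤ 1 * P.real Set.univ :=
            norm_integral_le_of_norm_le_const (Eventually.of_forall fun ω => hbK n ω z)
        _ = 1 := by simp
    · exact tendsto_integral_pow_mul_pow (fun n => hK01 n z) (fun n => hK01' n z) (hc z) (hc' z)
        hmM hmM' hMn hMn' (hlam.mul_const _) ((measurable_const.sub hlam).mul_const _) hA01 hA01'
        hD hD'
  set S : ℕ → ℕ → Bool → ℝ := fun n j e => markWeight ((j : ℝ) / n ∈ B) s s' e with hS_def
  set T : ℕ → ℕ → Bool → ℝ := fun n j e => markWeight ((j : ℝ) / n ∈ B) t t' e with hT_def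
  have hS01 : ∀ n j e, S n j e ∈ Set.Icc (0 : ℝ) 1 := fun n j e => markWeight_mem_Icc _ hs hs' e
  have hT01 : ∀ n j e, T n j e ∈ Set.Icc (0 : ℝ) 1 := fun n j e => markWeight_mem_Icc _ ht ht' e
  set F : ℕ → (ℕ → ℝ) → (ℕ → Bool) → ℝ := fun n a e =>
    ∏ j ∈ Finset.Icc 1 n, levelWeight (un n x) (un n y) (S n j (e j)) (T n j (e j))
      (a j) with hF_def
  have hmF : ∀ n, Measurable (Function.uncurry (F n)) := fun n =>
    Finset.measurable_prod _ fun j _ => by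
      have h1 : Measurable fun p : (ℕ → ℝ) × (ℕ → Bool) => p.1 j := by fun_prop
      have h2 : Measurable fun p : (ℕ → ℝ) × (ℕ → Bool) => p.2 j :=
        (measurable_pi_apply j).comp measurable_snd
      exact Measurable.ite (measurableSet_le h1 measurable_const) measurable_const
        (Measurable.ite (measurableSet_le h1 measurable_const)
          ((Measurable.of_discrete (f := S n j)).comp h2)
          ((Measurable.of_discrete (f := T n j)).comp h2))
  have hbF : ∀ n a e, |F n a e| ≤ 1 := fun n a e => by
    rw [hF_def, Finset.abs_prod]
    exact Finset.prod_le_one (fun _ _ => abs_nonneg _) fun j _ =>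
      abs_levelWeight_le_one (hS01 n j _) (hT01 n j _) _ _ _
  have hI : ∀ n, ∫ ω, F n (fun j => X j ω) (fun j => ε j ω) ∂P =
      ∫ ω', ∫ ω, F n (fun j => X j ω) (fun j => ε j ω') ∂P ∂P := fun n =>
    integral_comp_prodMk_of_indepFun hmX hme hindep (hmF n) (hbF n)
  have hiF : ∀ n, Integrable (fun ω' => ∫ ω, F n (fun j => X j ω) (fun j => ε j ω') ∂P) P :=
    fun n => by
      have h1 : Integrable (fun q : Ω × Ω => F n (fun j => X j q.2) (fun j => ε j q.1))
          (P.prod P) :=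
        integrable_of_measurable_of_abs_le_one
          ((hmF n).comp ((hmX.comp measurable_snd).prodMk (hme.comp measurable_fst)))
          fun q => hbF n _ _
      exact h1.integral_prod_left
  have hJ : ∀ n ω', ∫ z, ∏ j ∈ Finset.Icc 1 n, ∫ a, levelWeight (un n x) (un n y)
      (S n j (ε j ω')) (T n j (ε j ω'))
      (√(1 - γ / Real.log n) * a + √(γ / Real.log n) * z) ∂(gaussianReal 0 1) ∂(gaussianReal 0 1) =
      ∫ z, K n z ^ M n ω' * K' n z ^ M' n ω' ∂(gaussianReal 0 1) := fun n ω' => by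
    congr 1
    funext z
    rw [← prod_markWeight (Finset.Icc 1 n) (fun j : ℕ => (j : ℝ) / n ∈ B) (fun j => ε j ω')]
    exact Finset.prod_congr rfl fun j _ => conditionalLevelMean_markWeight γ x y _ s t s' t' _ n z
  have hdiff : Tendsto (fun n => (∫ ω, F n (fun j => X j ω) (fun j => ε j ω) ∂P) -
      ∫ ω, ∫ z, K n z ^ M n ω * K' n z ^ M' n ω ∂(gaussianReal 0 1) ∂P) atTop (nhds 0) := by
    refine squeeze_zero_norm' ?_ hΔ
    filter_upwards [hΔn] with n hn
    rw [hI n, ← integral_sub (hiF n) (by exact (hiK n).integral_prod_left)]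
    calc _ ≤ Δ n * P.real Set.univ :=
          norm_integral_le_of_norm_le_const (Eventually.of_forall fun ω' => by
            have := hn (fun j => S n j (ε j ω')) (fun j => T n j (ε j ω')) (fun j => hS01 n j _)
              (fun j => hT01 n j _)
            rw [hJ n ω'] at this
            exact this)
      _ = Δ n := by simp
  have := hdiff.add hlim
  simpa using this

theorem card_filter_lt_eq_add {κ : Type*} (S : Finset κ) (p : κ → Prop) (e : κ → Bool) (b : Bool)
    (a : κ → ℝ) {u₁ u₂ : ℝ} (hu : u₁ ≤ u₂) [DecidablePred fun j => p j ∧ u₁ < a j ∧ e j = b]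
    [DecidablePred fun j => p j ∧ (u₁ < a j ∧ a j ≤ u₂) ∧ e j = b]
    [DecidablePred fun j => p j ∧ u₂ < a j ∧ e j = b] :
    (S.filter fun j => p j ∧ u₁ < a j ∧ e j = b).card =
      (S.filter fun j => p j ∧ (u₁ < a j ∧ a j ≤ u₂) ∧ e j = b).card +
        (S.filter fun j => p j ∧ u₂ < a j ∧ e j = b).card := by
  simp only [Finset.card_filter, ← Finset.sum_add_distrib]
  refine Finset.sum_congr rfl fun j _ => ?_
  rcases le_or_gt (a j) u₁ with h1 | h1
  · simp [h1.not_gt, (h1.trans hu).not_gt]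
  rcases le_or_gt (a j) u₂ with h2 | h2
  · simp [h1, h2, h2.not_gt]
  · simp [h1, h2, h2.not_ge]

theorem prod_levelWeight_markWeight {κ : Type*} (S : Finset κ) (p : κ → Prop) (e : κ → Bool)
    (a : κ → ℝ) {u₁ u₂ : ℝ} (hu : u₁ ≤ u₂) (s t s' t' : ℝ) :
    ∏ j ∈ S, levelWeight u₁ u₂ (markWeight (p j) s s' (e j)) (markWeight (p j) t t' (e j)) (a j) =
      s ^ (S.filter fun j => p j ∧ (u₁ < a j ∧ a j ≤ u₂) ∧ e j = true).card *
        t ^ (S.filter fun j => p j ∧ u₂ < a j ∧ e j = true).card *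
        s' ^ (S.filter fun j => p j ∧ (u₁ < a j ∧ a j ≤ u₂) ∧ e j = false).card *
        t' ^ (S.filter fun j => p j ∧ u₂ < a j ∧ e j = false).card := by
  simp only [← Finset.prod_const, Finset.prod_filter, ← Finset.prod_mul_distrib]
  refine Finset.prod_congr rfl fun j _ => ?_
  rcases le_or_gt (a j) u₁ with h1 | h1
  · simp [levelWeight, h1, h1.not_gt, (h1.trans hu).not_gt]
  rcases le_or_gt (a j) u₂ with h2 | h2
  · by_cases hp : p j <;> cases e j <;>
      simp [levelWeight, markWeight, h1, h1.not_ge, h2, h2.not_gt, hp]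
  · by_cases hp : p j <;> cases e j <;>
      simp [levelWeight, markWeight, h1, h1.not_ge, h2, h2.not_ge, hp]

theorem poissonWeight_sub_mul_poissonWeight (k l : ℕ) (c u v : ℝ) :
    poissonWeight l (c * (u - v)) * poissonWeight k (c * v) =
      (c * v) ^ k / (Nat.factorial k : ℝ) * ((c * (u - v)) ^ l / (Nat.factorial l : ℝ)) *
        Real.exp (-(c * u)) := by
  have h : Real.exp (-(c * u)) = Real.exp (-(c * (u - v))) * Real.exp (-(c * v)) := by
    rw [← Real.exp_add]; congr 1; ring
  rw [h, poissonWeight, poissonWeight]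
  ring

theorem g_anti (γ z : ℝ) {x y : ℝ} (h : x ≤ y) : g γ y z ≤ g γ x z :=
  Real.exp_le_exp.2 (by linarith)

theorem tendsto_measure_exceedance_counts
    {Ω : Type*} [MeasurableSpace Ω] {P : Measure Ω} [IsProbabilityMeasure P]
    {X : ℕ → Ω → ℝ} {ε : ℕ → Ω → Bool} {lam : Ω → ℝ} {γ : ℝ}
    (hγ : 0 ≤ γ) (hXmeas : ∀ n, Measurable (X n)) (hεmeas : ∀ n, Measurable (ε n))
    (hlam : Measurable lam)
    (hGauss : ∀ (m : ℕ) (idx : Fin m → ℕ) (c : Fin m → ℝ), ∃ v : ℝ≥0,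
      P.map (fun ω => ∑ i, c i * X (idx i) ω) = gaussianReal 0 v)
    (hstd : ∀ n, P.map (X n) = gaussianReal 0 1)
    (hstat : ∀ (m k : ℕ), P.map (fun ω => fun i : Fin m => X (i.1 + 1 + k) ω) =
      P.map (fun ω => fun i : Fin m => X (i.1 + 1) ω))
    (hr : Tendsto (fun n : ℕ => (∫ ω, X 1 ω * X (n + 1) ω ∂P) * Real.log n)
      atTop (nhds γ))
    (hindep : IndepFun (fun ω => fun n => X n ω) (fun ω => fun n => ε n ω) P)
    (hlam01 : ∀ ω, lam ω ∈ Set.Icc (0 : ℝ) 1)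
    (hS : TendstoInMeasure P
      (fun n ω => (∑ k ∈ Finset.Icc 1 n, (if ε k ω then (1 : ℝ) else 0)) / n) atTop lam)
    {B : Set ℝ} (hBmeas : MeasurableSet B) (hBsub : B ⊆ Set.Ioc 0 1)
    (hBfrontier : volume (frontier B) = 0) {x y : ℝ} (hxy : x ≤ y)
    {k₁ k₂ k₃ k₄ : ℕ} (h31 : k₃ ≤ k₁) (h42 : k₄ ≤ k₂) :
    Tendsto (fun n : ℕ => P.real {ω |
        ((Finset.Icc 1 n).filter
          (fun j : ℕ => (j : ℝ) / n ∈ B ∧ un n x < X j ω ∧ ε j ω = true)).card = k₁ ∧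
        ((Finset.Icc 1 n).filter
          (fun j : ℕ => (j : ℝ) / n ∈ B ∧ un n x < X j ω ∧ ε j ω = false)).card = k₂ ∧
        ((Finset.Icc 1 n).filter
          (fun j : ℕ => (j : ℝ) / n ∈ B ∧ un n y < X j ω ∧ ε j ω = true)).card = k₃ ∧
        ((Finset.Icc 1 n).filter
          (fun j : ℕ => (j : ℝ) / n ∈ B ∧ un n y < X j ω ∧ ε j ω = false)).card = k₄})
      atTop
      (nhds (∫ ω, ∫ z,
        (lam ω * volume.real B * g γ y z) ^ k₃ / (Nat.factorial k₃ : ℝ) *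
          ((lam ω * volume.real B * (g γ x z - g γ y z)) ^ (k₁ - k₃) /
            (Nat.factorial (k₁ - k₃) : ℝ)) *
          Real.exp (-(lam ω * volume.real B * g γ x z)) *
        (((1 - lam ω) * volume.real B * g γ y z) ^ k₄ / (Nat.factorial k₄ : ℝ) *
          (((1 - lam ω) * volume.real B * (g γ x z - g γ y z)) ^ (k₂ - k₄) /
            (Nat.factorial (k₂ - k₄) : ℝ)) *
          Real.exp (-((1 - lam ω) * volume.real B * g γ x z)))
        ∂(gaussianReal 0 1) ∂P)) := by
  set N : Fin 4 → ℕ → Ω → ℕ := fun i n ω =>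
    ![((Finset.Icc 1 n).filter fun j : ℕ =>
        (j : ℝ) / n ∈ B ∧ (un n x < X j ω ∧ X j ω ≤ un n y) ∧ ε j ω = true).card,
      ((Finset.Icc 1 n).filter fun j : ℕ =>
        (j : ℝ) / n ∈ B ∧ un n y < X j ω ∧ ε j ω = true).card,
      ((Finset.Icc 1 n).filter fun j : ℕ =>
        (j : ℝ) / n ∈ B ∧ (un n x < X j ω ∧ X j ω ≤ un n y) ∧ ε j ω = false).card,
      ((Finset.Icc 1 n).filter fun j : ℕ =>
        (j : ℝ) / n ∈ B ∧ un n y < X j ω ∧ ε j ω = false).card] i with hN_def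
  set μ : Fin 4 → Ω × ℝ → ℝ := fun i q =>
    ![lam q.1 * volume.real B * (g γ x q.2 - g γ y q.2),
      lam q.1 * volume.real B * g γ y q.2,
      (1 - lam q.1) * volume.real B * (g γ x q.2 - g γ y q.2),
      (1 - lam q.1) * volume.real B * g γ y q.2] i with hμ_def
  have hlow : ∀ (n j : ℕ) b, MeasurableSet {ω | (j : ℝ) / (n : ℝ) ∈ B ∧
      (un n x < X j ω ∧ X j ω ≤ un n y) ∧ ε j ω = b} := fun n j b =>
    (MeasurableSet.const _).inter (((measurableSet_lt measurable_const (hXmeas j)).inter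
      (measurableSet_le (hXmeas j) measurable_const)).inter
      (hεmeas j (measurableSet_singleton b)))
  have hhigh : ∀ (n j : ℕ) b, MeasurableSet {ω | (j : ℝ) / (n : ℝ) ∈ B ∧
      un n y < X j ω ∧ ε j ω = b} := fun n j b =>
    (MeasurableSet.const _).inter ((measurableSet_lt measurable_const (hXmeas j)).inter
      (hεmeas j (measurableSet_singleton b)))
  have hN : ∀ i n, Measurable (N i n) := by
    intro i n
    fin_cases i
    · exact measurable_card_filter (Finset.Icc 1 n) fun j => hlow n j true
    · exact measurable_card_filter (Finset.Icc 1 n) fun j => hhigh n j true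
    · exact measurable_card_filter (Finset.Icc 1 n) fun j => hlow n j false
    · exact measurable_card_filter (Finset.Icc 1 n) fun j => hhigh n j false
  have hμ : ∀ i, Measurable (μ i) := by
    intro i
    have hg : ∀ w, Measurable fun q : Ω × ℝ => g γ w q.2 := fun w => by unfold g; fun_prop
    have hl : Measurable fun q : Ω × ℝ => lam q.1 := hlam.comp measurable_fst
    fin_cases i
    · exact (hl.mul_const _).mul ((hg x).sub (hg y))
    · exact (hl.mul_const _).mul (hg y)
    · exact ((measurable_const.sub hl).mul_const _).mul ((hg x).sub (hg y))
    · exact ((measurable_const.sub hl).mul_const _).mul (hg y)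
  have hμ0 : ∀ i q, 0 ≤ μ i q := by
    intro i q
    have h1 := mul_nonneg (hlam01 q.1).1 (measureReal_nonneg (μ := volume) (s := B))
    have h2 := mul_nonneg (sub_nonneg.2 (hlam01 q.1).2) (measureReal_nonneg (μ := volume) (s := B))
    have h3 := sub_nonneg.2 (g_anti γ q.2 hxy)
    have h4 : 0 ≤ g γ y q.2 := (Real.exp_pos _).le
    fin_cases i
    · exact mul_nonneg h1 h3
    · exact mul_nonneg h1 h4
    · exact mul_nonneg h2 h3
    · exact mul_nonneg h2 h4
  have key := tendsto_measureReal_of_tendsto_pgf (P := P) (P' := P.prod (gaussianReal 0 1)) hN hμ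
    hμ0 (fun t ht => by
      have ht' := fun i => Set.Ioc_subset_Icc_self (ht i)
      convert! tendsto_integral_prod_levelWeight_markWeight hγ hXmeas hεmeas hlam hGauss hstd hstat
        hr hindep hlam01 hS hBmeas hBsub hBfrontier hxy (ht' 0) (ht' 1) (ht' 2) (ht' 3) using 1
      · funext n
        congr 1
        funext ω
        rw [prod_levelWeight_markWeight _ _ _ _ (un_mono n hxy), Fin.prod_univ_four]
        rfl
      · congr 2
        funext q
        rw [Fin.prod_univ_four, ← Real.exp_add, ← Real.exp_add, ← Real.exp_add]
        simp only [hμ_def, Matrix.cons_val]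
        congr 1
        ring) ![k₁ - k₃, k₃, k₂ - k₄, k₄]
  have hInt : Integrable (fun q => ∏ i, poissonWeight (![k₁ - k₃, k₃, k₂ - k₄, k₄] i) (μ i q))
      (P.prod (gaussianReal 0 1)) :=
    integrable_of_measurable_of_abs_le_one
      (Finset.measurable_prod _ fun i _ => (measurable_poissonWeight _).comp (hμ i)) fun q => by
        rw [Finset.abs_prod]
        exact Finset.prod_le_one (fun _ _ => abs_nonneg _) fun i _ => by
          rw [abs_of_nonneg (poissonWeight_nonneg _ (hμ0 i q))]
          exact (poissonWeight_mem_Icc _ (hμ0 i q)).2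
  rw [integral_prod _ hInt] at key
  convert! key using 1
  · funext n
    congr 1
    ext ω
    simp only [Set.mem_ofPred_eq, hN_def, Fin.forall_fin_succ, Matrix.cons_val,
      card_filter_lt_eq_add _ _ _ _ _ (un_mono n hxy)]
    simp
    omega
  · congr 2
    funext ω
    congr 1
    funext z
    simp only [Fin.prod_univ_four, hμ_def, Matrix.cons_val]
    rw [poissonWeight_sub_mul_poissonWeight, mul_assoc (_ * _ * _),
      poissonWeight_sub_mul_poissonWeight]

theorem stmt12
    {Ω : Type} [MeasurableSpace Ω] (P : Measure Ω) [IsProbabilityMeasure P]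
    (X : ℕ → Ω → ℝ) (ε : ℕ → Ω → Bool) (lam : Ω → ℝ) (γ : ℝ)
    (hγ : 0 ≤ γ)
    (hXmeas : ∀ n, Measurable (X n))
    (hεmeas : ∀ n, Measurable (ε n))
    (hlam : Measurable lam)
    -- every finite-dimensional distribution of `X` is centered Gaussian
    (hGauss : ∀ (m : ℕ) (idx : Fin m → ℕ) (c : Fin m → ℝ), ∃ v : ℝ≥0,
      Measure.map (fun ω => ∑ i, c i * X (idx i) ω) P = gaussianReal 0 v)
    -- each `X n` is standard Gaussian
    (hstd : ∀ n, Measure.map (X n) P = gaussianReal 0 1)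
    -- stationarity
    (hstat : ∀ (m k : ℕ),
      Measure.map (fun ω => fun i : Fin m => X (i.1 + 1 + k) ω) P =
        Measure.map (fun ω => fun i : Fin m => X (i.1 + 1) ω) P)
    -- `r_n ln n → γ`
    (hr : Tendsto (fun n : ℕ => (∫ ω, X 1 ω * X (n + 1) ω ∂P) * Real.log n)
      atTop (nhds γ))
    -- independence of the sequences `X` and `ε`
    (hindep : IndepFun (fun ω => fun n => X n ω) (fun ω => fun n => ε n ω) P)
    (hlam01 : ∀ᵐ ω ∂P, lam ω ∈ Set.Icc (0 : ℝ) 1)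
    -- `S_n / n → λ` in probability
    (hS : TendstoInMeasure P
      (fun n ω => (∑ k ∈ Finset.Icc 1 n, (if ε k ω then (1 : ℝ) else 0)) / n)
      atTop lam)
    (B : Set ℝ) (hBmeas : MeasurableSet B) (hBsub : B ⊆ Set.Ioc 0 1)
    (hBfrontier : volume (frontier B) = 0)
    (x y : ℝ) (hxy : x ≤ y)
    (k₁ k₂ k₃ k₄ : ℕ) (h31 : k₃ ≤ k₁) (h42 : k₄ ≤ k₂) :
    Tendsto (fun n : ℕ =>
      (P {ω |
          ((Finset.Icc 1 n).filter
            (fun j : ℕ => (j : ℝ) / n ∈ B ∧ un n x < X j ω ∧ ε j ω = true)).card = k₁ ∧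
          ((Finset.Icc 1 n).filter
            (fun j : ℕ => (j : ℝ) / n ∈ B ∧ un n x < X j ω ∧ ε j ω = false)).card = k₂ ∧
          ((Finset.Icc 1 n).filter
            (fun j : ℕ => (j : ℝ) / n ∈ B ∧ un n y < X j ω ∧ ε j ω = true)).card = k₃ ∧
          ((Finset.Icc 1 n).filter
            (fun j : ℕ => (j : ℝ) / n ∈ B ∧ un n y < X j ω ∧ ε j ω = false)).card = k₄}).toReal)
      atTop
      (nhds (∫ ω, ∫ z,
        (lam ω * (volume B).toReal * g γ y z) ^ k₃ / (Nat.factorial k₃ : ℝ) *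
          ((lam ω * (volume B).toReal * (g γ x z - g γ y z)) ^ (k₁ - k₃) /
            (Nat.factorial (k₁ - k₃) : ℝ)) *
          Real.exp (-(lam ω * (volume B).toReal * g γ x z)) *
        (((1 - lam ω) * (volume B).toReal * g γ y z) ^ k₄ / (Nat.factorial k₄ : ℝ) *
          (((1 - lam ω) * (volume B).toReal * (g γ x z - g γ y z)) ^ (k₂ - k₄) /
            (Nat.factorial (k₂ - k₄) : ℝ)) *
          Real.exp (-((1 - lam ω) * (volume B).toReal * g γ x z)))
        ∂(gaussianReal 0 1) ∂P)) := by

  set lam' : Ω → ℝ := fun ω => max 0 (min 1 (lam ω)) with hlam'_def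
  have hae : lam =ᵐ[P] lam' := by
    filter_upwards [hlam01] with ω hω
    rw [hlam'_def]
    simp only [min_eq_right hω.2, max_eq_right hω.1]
  have h := tendsto_measure_exceedance_counts (lam := lam') hγ hXmeas hεmeas
    (measurable_const.max (measurable_const.min hlam)) hGauss hstd hstat hr hindep
    (fun ω => ⟨le_max_left _ _, max_le zero_le_one (min_le_left _ _)⟩) (hS.congr_right hae) hBmeas
    hBsub hBfrontier hxy h31 h42
  convert! h using 2
  refine integral_congr_ae ?_
  filter_upwards [hae] with ω hω
  rw [hω]
  rfl
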